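/- Suppose F(X_1,…,X_m,Z,T) = f(Z,T) + X_1⋯X_m·g(X_1,…,X_m,Z,T) for some g ∈ k[X_1,…,X_m,Z,T]. Then the following statements are equivalent: (iv) A ≅ k^{[m+2]}; (vi) A^{[l]} ≅ k^{[l+m+2]} for some l ≥ 0 and B ⊊ DK(A); (vii) A is an 𝔸²-fibration over E and B ⊊ DK(A); (viii) f(Z,T) is a line in k[Z,T] and B ⊊ DK(A). -/

import Mathlib

/-!
Common definitions: exponential maps, the Derksen and Makar-Limanov invariants,
𝔸ⁿ-fibrations, and the ring
`A = k[X_1,…,X_m,Y,Z,T]/(X_1^{r_1}⋯X_m^{r_m}·Y − F(X_1,…,X_m,Z,T))`.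
-/

noncomputable section
open MvPolynomial

/-- An exponential map on a `k`-algebra `D`: a `k`-algebra homomorphism `φ : D → D[U]`
such that evaluating `U` at `0` gives the identity of `D`, and such that
`φ_V ∘ φ_U = φ_{U+V}` in `D[U,V]` (where `φ_V : D[U] → D[U,V]` extends `φ` with
`φ_V(U) = U`).  Here `D[U,V]` is modelled as `Polynomial (Polynomial D)`, with inner
variable `U` and outer variable `V`. -/
structure ExpMap (k D : Type) [CommRing k] [CommRing D] [Algebra k D] where
  toAlgHom : D →ₐ[k] Polynomial D
  eval_zero : ∀ d, Polynomial.eval 0 (toAlgHom d) = d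
  comp_add : ∀ d,
    Polynomial.eval₂ ((Polynomial.mapRingHom (Polynomial.C (R := D))).comp toAlgHom.toRingHom)
      (Polynomial.C Polynomial.X) (toAlgHom d)
    = Polynomial.eval₂ ((Polynomial.C (R := Polynomial D)).comp (Polynomial.C (R := D)))
      (Polynomial.C Polynomial.X + Polynomial.X) (toAlgHom d)

namespace ExpMap
variable {k D : Type} [CommRing k] [CommRing D] [Algebra k D]

/-- The ring of invariants `D^φ = {d ∈ D | φ(d) = d}` of an exponential map. -/
def invariants (φ : ExpMap k D) : Subalgebra k D where
  carrier := {d | φ.toAlgHom d = Polynomial.C d}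
  mul_mem' := fun ha hb => by
    simp only [Set.mem_setOf_eq] at *
    rw [map_mul, ha, hb, ← map_mul]
  add_mem' := fun ha hb => by
    simp only [Set.mem_setOf_eq] at *
    rw [map_add, ha, hb, ← map_add]
  algebraMap_mem' := fun c => by
    simp only [Set.mem_setOf_eq, AlgHom.commutes, Polynomial.algebraMap_apply]

end ExpMap

/-- The Derksen invariant `DK(D)`: the `k`-subalgebra of `D` generated by the rings of
invariants of all non-trivial exponential maps on `D`. -/
def Derksen (k D : Type) [CommRing k] [CommRing D] [Algebra k D] : Subalgebra k D :=
  Algebra.adjoin k (⋃ φ ∈ {ψ : ExpMap k D | ψ.invariants ≠ ⊤}, (φ.invariants : Set D))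

/-- The Makar-Limanov invariant `ML(D)`: the intersection of the rings of invariants of
all exponential maps on `D`. -/
def MakarLimanov (k D : Type) [CommRing k] [CommRing D] [Algebra k D] : Subalgebra k D :=
  ⨅ φ : ExpMap k D, φ.invariants

/-- `D` is an `𝔸ⁿ`-fibration over `R`: a finitely generated flat `R`-algebra all of whose
fibres `D ⊗_R κ(p)` over primes `p` of `R` are polynomial rings `κ(p)^{[n]}`. -/
def IsAnFibration (R D : Type) [CommRing R] [CommRing D] [Algebra R D] (n : ℕ) : Prop :=
  Algebra.FiniteType R D ∧ Module.Flat R D ∧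
  ∀ p : PrimeSpectrum R,
    Nonempty ((TensorProduct R (IsLocalRing.ResidueField (Localization.AtPrime p.asIdeal)) D)
      ≃ₐ[IsLocalRing.ResidueField (Localization.AtPrime p.asIdeal)]
      MvPolynomial (Fin n) (IsLocalRing.ResidueField (Localization.AtPrime p.asIdeal)))

/-- The polynomial ring `k[X_1,…,X_m,Y,Z,T]`:
variables `Sum.inl i` are the `X i`; `Sum.inr 0 = Y`, `Sum.inr 1 = Z`, `Sum.inr 2 = T`. -/
abbrev BigP (k : Type) [CommRing k] (m : ℕ) := MvPolynomial (Fin m ⊕ Fin 3) k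

/-- The inclusion `k[X_1,…,X_m,Z,T] → k[X_1,…,X_m,Y,Z,T]` (in the source,
`Sum.inr 0 = Z` and `Sum.inr 1 = T`). -/
def incl (k : Type) [CommRing k] (m : ℕ) : MvPolynomial (Fin m ⊕ Fin 2) k →ₐ[k] BigP k m :=
  rename (Sum.map id Fin.succ)

/-- The polynomial `G = X_1^{r_1}⋯X_m^{r_m}·Y − F(X_1,…,X_m,Z,T)`. -/
def relG (k : Type) [CommRing k] (m : ℕ) (r : Fin m → ℕ) (F : MvPolynomial (Fin m ⊕ Fin 2) k) :
    BigP k m :=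
  (∏ i, X (Sum.inl i) ^ r i) * X (Sum.inr 0) - incl k m F

/-- The ring `A = k[X_1,…,X_m,Y,Z,T]/(X_1^{r_1}⋯X_m^{r_m}·Y − F(X_1,…,X_m,Z,T))`. -/
abbrev RingA (k : Type) [CommRing k] (m : ℕ) (r : Fin m → ℕ)
    (F : MvPolynomial (Fin m ⊕ Fin 2) k) :=
  BigP k m ⧸ Ideal.span {relG k m r F}

variable (k : Type) [CommRing k] (m : ℕ) (r : Fin m → ℕ) (F : MvPolynomial (Fin m ⊕ Fin 2) k)

/-- `x i`, the image of `X i` in `A`. -/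
def xA (i : Fin m) : RingA k m r F := Ideal.Quotient.mk _ (X (Sum.inl i))
/-- `y`, the image of `Y` in `A`. -/
def yA : RingA k m r F := Ideal.Quotient.mk _ (X (Sum.inr 0))
/-- `z`, the image of `Z` in `A`. -/
def zA : RingA k m r F := Ideal.Quotient.mk _ (X (Sum.inr 1))
/-- `t`, the image of `T` in `A`. -/
def tA : RingA k m r F := Ideal.Quotient.mk _ (X (Sum.inr 2))

/-- `f(Z,T) := F(0,…,0,Z,T) ∈ k[Z,T]`. -/
def fOf : MvPolynomial (Fin 2) k :=
  aeval (Sum.elim (fun _ => (0 : MvPolynomial (Fin 2) k)) X) F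

/-- The subalgebra `E = k[x_1,…,x_m]` of `A`. -/
def EA : Subalgebra k (RingA k m r F) := Algebra.adjoin k (Set.range (xA k m r F))

/-- The subalgebra `B = k[x_1,…,x_m,z,t]` of `A`. -/
def BA : Subalgebra k (RingA k m r F) :=
  Algebra.adjoin k (Set.range (xA k m r F) ∪ {zA k m r F, tA k m r F})

section Basic

variable {k m r F}

/-- The generators `z, t` of `A`, as a family. -/
def ztA (k : Type) [CommRing k] (m : ℕ) (r : Fin m → ℕ) (F : MvPolynomial (Fin m ⊕ Fin 2) k) :
    Fin 2 → RingA k m r F := ![zA k m r F, tA k m r F]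

/-- The natural map `k[X_1,…,X_m,Z,T] → A`. -/
def polyA (k : Type) [CommRing k] (m : ℕ) (r : Fin m → ℕ) (F : MvPolynomial (Fin m ⊕ Fin 2) k) :
    MvPolynomial (Fin m ⊕ Fin 2) k →ₐ[k] RingA k m r F :=
  aeval (Sum.elim (xA k m r F) (ztA k m r F))

/-- The natural map `k[Z,T] → A`. -/
def planeA (k : Type) [CommRing k] (m : ℕ) (r : Fin m → ℕ) (F : MvPolynomial (Fin m ⊕ Fin 2) k) :
    MvPolynomial (Fin 2) k →ₐ[k] RingA k m r F :=
  aeval (ztA k m r F)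

lemma mk_incl (p : MvPolynomial (Fin m ⊕ Fin 2) k) :
    (Ideal.Quotient.mk (Ideal.span {relG k m r F}) (incl k m p)) = polyA k m r F p := by
  have : ((Ideal.Quotient.mkₐ k (Ideal.span {relG k m r F})).comp (incl k m)) =
      polyA k m r F := by
    apply MvPolynomial.algHom_ext
    rintro (i | i)
    · simp [incl, polyA, xA]
    · fin_cases i <;> simp [incl, polyA, ztA, zA, tA]
  exact DFunLike.congr_fun this p

/-- The defining relation of `A`. -/
lemma prod_xA_mul_yA :
    (∏ i, xA k m r F i ^ r i) * yA k m r F = polyA k m r F F := by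
  rw [← mk_incl, eq_comm, ← sub_eq_zero, ← neg_eq_zero, neg_sub]
  have h : (Ideal.Quotient.mk (Ideal.span {relG k m r F}) (relG k m r F)) = 0 :=
    Ideal.Quotient.eq_zero_iff_mem.2 (Ideal.subset_span rfl)
  have key : ∀ I : Ideal (BigP k m), Ideal.Quotient.mk I (relG k m r F) =
      (∏ i, Ideal.Quotient.mk I (X (Sum.inl i)) ^ r i) * Ideal.Quotient.mk I (X (Sum.inr 0)) -
        Ideal.Quotient.mk I (incl k m F) := fun I => by simp [relG]
  rw [← h]
  exact (key _).symm

lemma polyA_rename (h : MvPolynomial (Fin 2) k) :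
    polyA k m r F (rename Sum.inr h) = planeA k m r F h := by
  simp [polyA, planeA, aeval_rename]

/-- The universal property of `A`. -/
def liftA {S : Type} [CommRing S] [Algebra k S] (x : Fin m → S) (y : S) (w : Fin 2 → S)
    (h : (∏ i, x i ^ r i) * y = aeval (Sum.elim x w) F) : RingA k m r F →ₐ[k] S :=
  Ideal.Quotient.liftₐ _ (aeval (Sum.elim x ![y, w 0, w 1])) (by
    intro a ha
    obtain ⟨c, rfl⟩ := Ideal.mem_span_singleton'.1 ha
    have : aeval (Sum.elim x ![y, w 0, w 1]) (incl k m F) = aeval (Sum.elim x w) F := by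
      rw [incl, aeval_rename]
      congr 2
      funext i
      rcases i with i | i
      · rfl
      · fin_cases i <;> rfl
    rw [map_mul, relG, map_sub, this, ← h]
    simp)

section liftA

variable {S : Type} [CommRing S] [Algebra k S] (x : Fin m → S) (y : S) (w : Fin 2 → S)
    (h : (∏ i, x i ^ r i) * y = aeval (Sum.elim x w) F)

@[simp] lemma liftA_xA (i : Fin m) : liftA x y w h (xA k m r F i) = x i :=
  (Ideal.Quotient.lift_mk _ _ _).trans (by simp)

@[simp] lemma liftA_yA : liftA x y w h (yA k m r F) = y :=
  (Ideal.Quotient.lift_mk _ _ _).trans (by simp)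

@[simp] lemma liftA_ztA (j : Fin 2) : liftA x y w h (ztA k m r F j) = w j := by
  fin_cases j <;> exact (Ideal.Quotient.lift_mk _ _ _).trans (by simp)

@[simp] lemma liftA_polyA (p : MvPolynomial (Fin m ⊕ Fin 2) k) :
    liftA x y w h (polyA k m r F p) = aeval (Sum.elim x w) p := by
  rw [polyA, comp_aeval_apply]
  congr 2
  funext i
  rcases i with i | i <;> simp

@[simp] lemma liftA_planeA (p : MvPolynomial (Fin 2) k) :
    liftA x y w h (planeA k m r F p) = aeval w p := by
  rw [planeA, comp_aeval_apply]
  congr 2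
  funext i
  simp

end liftA

lemma algHom_extA {S : Type} [CommRing S] [Algebra k S] {φ ψ : RingA k m r F →ₐ[k] S}
    (hx : ∀ i, φ (xA k m r F i) = ψ (xA k m r F i)) (hy : φ (yA k m r F) = ψ (yA k m r F))
    (hw : ∀ j, φ (ztA k m r F j) = ψ (ztA k m r F j)) : φ = ψ := by
  apply Ideal.Quotient.algHom_ext
  apply MvPolynomial.algHom_ext
  rintro (i | i)
  · exact hx i
  · fin_cases i
    · exact hy
    · exact hw 0
    · exact hw 1

/-- Every element of `A` lies in a subalgebra containing the generators. -/
lemma mem_of_generators (S : Subalgebra k (RingA k m r F)) (hx : ∀ i, xA k m r F i ∈ S)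
    (hy : yA k m r F ∈ S) (hw : ∀ j, ztA k m r F j ∈ S) (a : RingA k m r F) : a ∈ S := by
  obtain ⟨p, rfl⟩ := Ideal.Quotient.mk_surjective a
  induction p using MvPolynomial.induction_on with
  | C c => exact S.algebraMap_mem c
  | add p q hp hq => rw [map_add]; exact S.add_mem hp hq
  | mul_X p i hp =>
    rw [map_mul]
    refine S.mul_mem hp ?_
    rcases i with i | i
    · exact hx i
    · fin_cases i
      · exact hy
      · exact hw 0
      · exact hw 1

lemma polyA_mem_BA (p : MvPolynomial (Fin m ⊕ Fin 2) k) : polyA k m r F p ∈ BA k m r F := by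
  have hx : ∀ i, Sum.elim (xA k m r F) (ztA k m r F) i ∈ BA k m r F := by
    rintro (i | i)
    · exact Algebra.subset_adjoin (Or.inl ⟨i, rfl⟩)
    · apply Algebra.subset_adjoin
      fin_cases i
      · exact Or.inr (Or.inl rfl)
      · exact Or.inr (Or.inr rfl)
  rw [polyA, aeval_def, eval₂_eq']
  refine Subalgebra.sum_mem _ fun d _ => Subalgebra.mul_mem _ (Subalgebra.algebraMap_mem _ _) ?_
  exact Subalgebra.prod_mem _ fun i _ => Subalgebra.pow_mem _ (hx i) _

lemma exists_polyA_of_mem_BA {a : RingA k m r F} (ha : a ∈ BA k m r F) :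
    ∃ p, polyA k m r F p = a := by
  have : BA k m r F ≤ (polyA k m r F).range := by
    refine Algebra.adjoin_le ?_
    rintro b (⟨i, rfl⟩ | rfl | rfl)
    · exact ⟨X (Sum.inl i), by simp [polyA]⟩
    · exact ⟨X (Sum.inr 0), by simp [polyA, ztA]⟩
    · exact ⟨X (Sum.inr 1), by simp [polyA, ztA]⟩
  exact this ha

lemma aeval_zero_eq_fOf (p : MvPolynomial (Fin m ⊕ Fin 2) k) {S : Type} [CommRing S] [Algebra k S]
    (w : Fin 2 → S) : aeval (Sum.elim (fun _ => (0 : S)) w) p = aeval w (fOf k m p) := by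
  rw [fOf, comp_aeval_apply]
  congr 2
  funext i
  rcases i with i | i <;> simp

end Basic

section NormalForm

variable {k m r F}

/-- The element `x^β y^j h(z,t)` of `A`. -/
def monA (k : Type) [CommRing k] (m : ℕ) (r : Fin m → ℕ) (F : MvPolynomial (Fin m ⊕ Fin 2) k)
    (p : (Fin m → ℕ) × ℕ) (h : MvPolynomial (Fin 2) k) : RingA k m r F :=
  (∏ i, xA k m r F i ^ p.1 i) * yA k m r F ^ p.2 * planeA k m r F h

/-- The exponents `(β, j)` for which `x^β y^j` is not divisible by `x^r y`. -/
def IsReducedExp (r : Fin m → ℕ) (p : (Fin m → ℕ) × ℕ) : Prop := p.2 = 0 ∨ ∃ i, p.1 i < r i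

/-- The elements of `A` that are sums of reduced terms. -/
def IsNormalForm (c : ((Fin m → ℕ) × ℕ) →₀ MvPolynomial (Fin 2) k) (a : RingA k m r F) : Prop :=
  (∀ p ∈ c.support, IsReducedExp r p) ∧ a = c.sum fun p h => monA k m r F p h

lemma monA_add (p : (Fin m → ℕ) × ℕ) (h h' : MvPolynomial (Fin 2) k) :
    monA k m r F p (h + h') = monA k m r F p h + monA k m r F p h' := by
  simp [monA, mul_add]

lemma monA_zero (p : (Fin m → ℕ) × ℕ) : monA k m r F p 0 = 0 := by
  simp [monA]

lemma exists_normalForm_add {a b : RingA k m r F} (ha : ∃ c, IsNormalForm c a)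
    (hb : ∃ c, IsNormalForm c b) : ∃ c, IsNormalForm c (a + b) := by
  classical
  obtain ⟨c, hc, rfl⟩ := ha
  obtain ⟨d, hd, rfl⟩ := hb
  refine ⟨c + d, fun p hp => ?_, ?_⟩
  · rcases Finset.mem_union.1 (Finsupp.support_add hp) with h | h
    · exact hc p h
    · exact hd p h
  · rw [Finsupp.sum_add_index' (fun p => monA_zero p) (fun p => monA_add p)]

lemma exists_normalForm_of_reduced (p : (Fin m → ℕ) × ℕ) (hp : IsReducedExp r p)
    (h : MvPolynomial (Fin 2) k) : ∃ c, IsNormalForm c (monA k m r F p h) := by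
  classical
  refine ⟨Finsupp.single p h, fun q hq => ?_, ?_⟩
  · have := Finsupp.support_single_subset hq
    rw [Finset.mem_singleton] at this
    exact this ▸ hp
  · rw [Finsupp.sum_single_index (monA_zero p)]

lemma prod_pow_add_single {R : Type} [CommRing R] (x : Fin m → R) (β : Fin m → ℕ) (i : Fin m) :
    ∏ l, x l ^ (β + Pi.single i 1 : Fin m → ℕ) l = (∏ l, x l ^ β l) * x i := by
  classical
  simp only [Pi.add_apply, pow_add, Finset.prod_mul_distrib]
  congr 1
  rw [Finset.prod_eq_single i]
  · simp
  · intro b _ hb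
    simp [hb]
  · simp

lemma exists_normalForm_monA (j : ℕ) (β : Fin m → ℕ) (h : MvPolynomial (Fin 2) k) :
    ∃ c, IsNormalForm c (monA k m r F (β, j) h) := by
  classical
  induction j generalizing β h with
  | zero => exact exists_normalForm_of_reduced _ (Or.inl rfl) h
  | succ j ih =>
    by_cases hred : ∃ i, β i < r i
    · exact exists_normalForm_of_reduced _ (Or.inr hred) h
    push Not at hred
    have key : ∀ (p : MvPolynomial (Fin m ⊕ Fin 2) k) (β : Fin m → ℕ) (h : MvPolynomial (Fin 2) k),
        ∃ c, IsNormalForm c (monA k m r F (β, j) h * polyA k m r F p) := by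
      intro p
      induction p using MvPolynomial.induction_on with
      | C c =>
        intro β h
        convert ih β (h * C c) using 3
        simp only [monA, map_mul, mul_assoc]
        congr 3
        simp [polyA, planeA]
      | add p q hp hq =>
        intro β h
        convert exists_normalForm_add (hp β h) (hq β h) using 3
        rw [map_add, mul_add]
      | mul_X p i hp =>
        intro β h
        rcases i with i | i
        · convert hp (β + Pi.single i 1) h using 3
          simp only [monA, prod_pow_add_single]
          simp only [polyA, map_mul, aeval_X, Sum.elim_inl]
          ring
        · convert hp β (h * X i) using 3
          simp only [monA, map_mul]
          simp only [polyA, planeA, aeval_X, Sum.elim_inr]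
          ring
    convert key F (β - r) h using 3
    rw [← prod_xA_mul_yA]
    have : ∏ i, xA k m r F i ^ β i =
        (∏ i, xA k m r F i ^ (β - r) i) * ∏ i, xA k m r F i ^ r i := by
      rw [← Finset.prod_mul_distrib]
      refine Finset.prod_congr rfl fun i _ => ?_
      rw [← pow_add, Pi.sub_apply, Nat.sub_add_cancel (hred i)]
    simp only [monA, this]
    ring

lemma exists_normalForm (a : RingA k m r F) : ∃ c, IsNormalForm c a := by
  classical
  obtain ⟨p, rfl⟩ := Ideal.Quotient.mk_surjective a
  have key : ∀ (p : BigP k m) (β : Fin m → ℕ) (j : ℕ) (h : MvPolynomial (Fin 2) k),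
      ∃ c, IsNormalForm c (monA k m r F (β, j) h * Ideal.Quotient.mk _ p) := by
    intro p
    induction p using MvPolynomial.induction_on with
    | C c =>
      intro β j h
      convert exists_normalForm_monA j β (h * C c) using 3
      simp only [monA, map_mul, mul_assoc]
      congr 3
      rw [planeA, aeval_C]
      rfl
    | add p q hp hq =>
      intro β j h
      convert exists_normalForm_add (hp β j h) (hq β j h) using 3
      rw [map_add, mul_add]
    | mul_X p i hp =>
      intro β j h
      rcases i with i | i
      · convert hp (β + Pi.single i 1) j h using 3
        have e : Ideal.Quotient.mk (Ideal.span {relG k m r F}) (X (Sum.inl i)) = xA k m r F i := rfl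
        rw [map_mul, e]
        simp only [monA, prod_pow_add_single]
        ring
      · fin_cases i
        · convert hp β (j + 1) h using 3
          have e : Ideal.Quotient.mk (Ideal.span {relG k m r F}) (X (Sum.inr 0)) =
            yA k m r F := rfl
          rw [map_mul]
          simp only [monA, Fin.zero_eta, e]
          ring
        · convert hp β j (h * X 0) using 3
          have e : Ideal.Quotient.mk (Ideal.span {relG k m r F}) (X (Sum.inr 1)) =
            planeA k m r F (X 0) := by rw [planeA, aeval_X]; rfl
          rw [map_mul]
          simp only [monA, map_mul, Fin.mk_one, e]
          ring
        · convert hp β j (h * X 1) using 3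
          have e : Ideal.Quotient.mk (Ideal.span {relG k m r F}) (X (Sum.inr 2)) =
            planeA k m r F (X 1) := by rw [planeA, aeval_X]; rfl
          rw [map_mul]
          simp only [monA, map_mul, Fin.reduceFinMk, e]
          ring
  simpa [monA] using key p 0 0 1

lemma mem_BA_of_normalForm {a : RingA k m r F} {c} (h : IsNormalForm c a)
    (hc : ∀ p ∈ c.support, p.2 = 0) : a ∈ BA k m r F := by
  rw [h.2]
  refine Subalgebra.sum_mem _ fun p hp => ?_
  change (∏ i, xA k m r F i ^ p.1 i) * yA k m r F ^ p.2 * planeA k m r F (c p) ∈ _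
  rw [hc p hp, pow_zero, mul_one]
  refine Subalgebra.mul_mem _ (Subalgebra.prod_mem _ fun i _ => Subalgebra.pow_mem _ ?_ _) ?_
  · exact Algebra.subset_adjoin (Or.inl ⟨i, rfl⟩)
  · rw [← polyA_rename]
    exact polyA_mem_BA _

end NormalForm

section HasLead

variable {R : Type} [CommRing R]

/-- `x` has no terms of order below `γ`, and its coefficient at `γ` is `c` (possibly zero). -/
def HasLead (x : HahnSeries ℝ R) (γ : ℝ) (c : R) : Prop :=
  (∀ δ < γ, x.coeff δ = 0) ∧ x.coeff γ = c

namespace HasLead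

variable {x y : HahnSeries ℝ R} {γ δ : ℝ} {c d : R}

lemma add (hx : HasLead x γ c) (hy : HasLead y γ d) : HasLead (x + y) γ (c + d) :=
  ⟨fun ε hε => by rw [HahnSeries.coeff_add, hx.1 ε hε, hy.1 ε hε, add_zero],
    by rw [HahnSeries.coeff_add, hx.2, hy.2]⟩

lemma zero : HasLead (0 : HahnSeries ℝ R) γ 0 := ⟨fun _ _ => rfl, rfl⟩

lemma of_lt (hx : HasLead x γ c) (h : δ < γ) : HasLead x δ 0 :=
  ⟨fun ε hε => hx.1 ε (hε.trans h), hx.1 δ h⟩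

lemma mul (hx : HasLead x γ c) (hy : HasLead y δ d) : HasLead (x * y) (γ + δ) (c * d) := by
  constructor
  · intro ε hε
    rw [HahnSeries.coeff_mul]
    refine Finset.sum_eq_zero fun ij hij => ?_
    have h := (Finset.mem_antidiagonal.1 hij).2.2
    by_cases h1 : ij.1 < γ
    · rw [hx.1 _ h1, zero_mul]
    · rw [hy.1 _ (by linarith), mul_zero]
  · rw [HahnSeries.coeff_mul]
    rw [Finset.sum_eq_single (γ, δ)]
    · rw [hx.2, hy.2]
    · intro ij hij hne
      have h := (Finset.mem_antidiagonal.1 hij).2.2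
      rcases lt_trichotomy ij.1 γ with h1 | h1 | h1
      · rw [hx.1 _ h1, zero_mul]
      · exact absurd (Prod.ext h1 (by simp only; linarith)) hne
      · rw [hy.1 _ (by linarith), mul_zero]
    · intro hn
      by_contra h0
      refine hn (Finset.mem_antidiagonal.2 ⟨?_, ?_, rfl⟩)
      · exact left_ne_zero_of_mul h0
      · exact right_ne_zero_of_mul h0

lemma single (γ : ℝ) (c : R) : HasLead (HahnSeries.single γ c) γ c :=
  ⟨fun _ h => HahnSeries.coeff_single_of_ne h.ne, HahnSeries.coeff_single_same _ _⟩

lemma C (c : R) : HasLead (HahnSeries.C c) 0 c := single 0 c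

lemma pow (hx : HasLead x γ c) (n : ℕ) : HasLead (x ^ n) (n * γ) (c ^ n) := by
  induction n with
  | zero => simpa using C (1 : R)
  | succ n ih =>
    rw [pow_succ, pow_succ]
    convert ih.mul hx using 1
    push_cast
    ring

lemma sum {ι : Type} (s : Finset ι) {x : ι → HahnSeries ℝ R} {c : ι → R}
    (h : ∀ i ∈ s, HasLead (x i) γ (c i)) : HasLead (∑ i ∈ s, x i) γ (∑ i ∈ s, c i) := by
  classical
  induction s using Finset.induction_on with
  | empty => simpa using zero
  | insert i s hi ih =>
    rw [Finset.sum_insert hi, Finset.sum_insert hi]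
    exact (h i (Finset.mem_insert_self _ _)).add
      (ih fun j hj => h j (Finset.mem_insert_of_mem hj))

lemma prod {ι : Type} (s : Finset ι) {x : ι → HahnSeries ℝ R} {γ : ι → ℝ} {c : ι → R}
    (h : ∀ i ∈ s, HasLead (x i) (γ i) (c i)) :
    HasLead (∏ i ∈ s, x i) (∑ i ∈ s, γ i) (∏ i ∈ s, c i) := by
  classical
  induction s using Finset.induction_on with
  | empty => simpa using C (1 : R)
  | insert i s hi ih =>
    rw [Finset.sum_insert hi, Finset.prod_insert hi, Finset.prod_insert hi]
    exact (h i (Finset.mem_insert_self _ _)).mul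
      (ih fun j hj => h j (Finset.mem_insert_of_mem hj))

lemma ne_zero (hx : HasLead x γ c) (hc : c ≠ 0) : x ≠ 0 := by
  rintro rfl
  exact hc hx.2.symm

lemma order_eq (hx : HasLead x γ c) (hc : c ≠ 0) : x.order = γ := by
  refine le_antisymm ?_ ?_
  · exact HahnSeries.order_le_of_coeff_ne_zero (by rw [hx.2]; exact hc)
  · exact (HahnSeries.le_order_iff_forall (hx.ne_zero hc)).2 hx.1

lemma leadingCoeff_eq (hx : HasLead x γ c) (hc : c ≠ 0) : x.leadingCoeff = c := by
  rw [HahnSeries.leadingCoeff_eq, hx.order_eq hc, hx.2]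

lemma self (x : HahnSeries ℝ R) : HasLead x x.order x.leadingCoeff :=
  ⟨fun _ h => HahnSeries.coeff_eq_zero_of_lt_order h, HahnSeries.leadingCoeff_eq.symm⟩

end HasLead

end HasLead

section Weights

/-- The real weight of `x^β y^j` when `x_i` has weight `θ i` and `y` has weight `-∑ r_i θ_i`. -/
def expWeight {m : ℕ} (θ : Fin m → ℝ) (r : Fin m → ℕ) (p : (Fin m → ℕ) × ℕ) : ℝ :=
  ∑ i, p.1 i * θ i - p.2 * ∑ i, r i * θ i

/-- Admissible weight vectors: positive entries, linearly independent over `ℤ`. -/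
structure IsAdmissible {m : ℕ} (θ : Fin m → ℝ) : Prop where
  pos : ∀ i, 0 < θ i
  indep : ∀ α : Fin m → ℤ, ∑ i, α i * θ i = 0 → α = 0

variable {m : ℕ} {θ : Fin m → ℝ} {r : Fin m → ℕ}

lemma IsAdmissible.eq_of_weight_eq (hθ : IsAdmissible θ) {p q : (Fin m → ℕ) × ℕ}
    (h : expWeight θ r p = expWeight θ r q) (i : Fin m) :
    (p.1 i : ℤ) - p.2 * r i = q.1 i - q.2 * r i := by
  have := hθ.indep (fun i => ((p.1 i : ℤ) - p.2 * r i) - (q.1 i - q.2 * r i)) (by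
    rw [expWeight, expWeight, Finset.mul_sum, Finset.mul_sum, ← Finset.sum_sub_distrib,
      ← Finset.sum_sub_distrib, ← sub_eq_zero, ← Finset.sum_sub_distrib] at h
    rw [← h]
    refine Finset.sum_congr rfl fun i _ => ?_
    push_cast
    ring)
  have := congrFun this i
  simp only [Pi.zero_apply] at this
  linarith

lemma IsReducedExp.snd_le {p q : (Fin m → ℕ) × ℕ} (hp : IsReducedExp r p)
    (h : ∀ i, (p.1 i : ℤ) - p.2 * r i = q.1 i - q.2 * r i) : p.2 ≤ q.2 := by
  by_contra! hlt
  rcases hp with hp | ⟨i, hi⟩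
  · omega
  · have := h i
    obtain ⟨e, he⟩ := Nat.exists_eq_add_of_lt hlt
    rw [he] at this
    push_cast at this
    have h1 : (0 : ℤ) ≤ e * r i := by positivity
    have h2 : (0 : ℤ) ≤ q.1 i := by positivity
    have h3 : (p.1 i : ℤ) < r i := by exact_mod_cast hi
    nlinarith

lemma IsAdmissible.eq_of_reduced (hθ : IsAdmissible θ) {p q : (Fin m → ℕ) × ℕ}
    (hp : IsReducedExp r p) (hq : IsReducedExp r q)
    (h : expWeight θ r p = expWeight θ r q) : p = q := by
  have key := hθ.eq_of_weight_eq h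
  have h2 : p.2 = q.2 := le_antisymm (hp.snd_le key) (hq.snd_le fun i => (key i).symm)
  refine Prod.ext (funext fun i => ?_) h2
  have := key i
  rw [h2] at this
  exact_mod_cast (sub_left_inj.1 this)

lemma exists_isAdmissible (m : ℕ) : ∃ θ : Fin m → ℝ, IsAdmissible θ := by
  obtain ⟨v, hv⟩ : ∃ v : Fin m → ℝ, LinearIndependent ℚ v := by
    refine exists_linearIndependent_of_le_rank ?_
    rw [Real.rank_rat_real]
    exact (Cardinal.natCast_lt_aleph0.le).trans Cardinal.aleph0_le_continuum
  rw [Fintype.linearIndependent_iff] at hv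
  have hv0 : ∀ i, v i ≠ 0 := by
    intro i hi
    have := hv (Pi.single i 1) (by simp [Pi.single_apply, hi]) i
    simp at this
  refine ⟨fun i => |v i|, fun i => abs_pos.2 (hv0 i), fun α hα => funext fun i => ?_⟩
  choose ε hε0 hε using fun i => (show ∃ ε : ℤ, ε ≠ 0 ∧ |v i| = ε * v i by
    rcases abs_choice (v i) with h | h
    · exact ⟨1, one_ne_zero, by simp [h]⟩
    · exact ⟨-1, by norm_num, by simp [h]⟩)
  have := hv (fun i => (α i : ℚ) * ε i) (by
    rw [← hα]
    refine Finset.sum_congr rfl fun i _ => ?_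
    rw [hε, Rat.smul_def]
    push_cast
    ring) i
  have hne : (ε i : ℚ) ≠ 0 := Int.cast_ne_zero.2 (hε0 i)
  have := (mul_eq_zero.1 this).resolve_right hne
  exact_mod_cast this

lemma exists_isAdmissible_weight_neg (r : Fin m → ℕ) (p : (Fin m → ℕ) × ℕ) (hp : 1 ≤ p.2)
    (i : Fin m) (hi : p.1 i < r i) : ∃ θ, IsAdmissible θ ∧ expWeight θ r p < 0 := by
  classical
  obtain ⟨θ, hθ⟩ := exists_isAdmissible m
  obtain ⟨M, hM⟩ : ∃ M : ℕ, (∑ l ∈ Finset.univ.erase i, (p.1 l : ℝ) * θ l) / θ i < M :=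
    exists_nat_gt _
  have hM0 : (0 : ℝ) < M := by
    refine lt_of_le_of_lt (div_nonneg (Finset.sum_nonneg fun l _ => ?_) (hθ.pos i).le) hM
    exact mul_nonneg (Nat.cast_nonneg _) (hθ.pos l).le
  have hMne : M ≠ 0 := by rintro rfl; simp at hM0
  let w : Fin m → ℕ := fun l => if l = i then M else 1
  have hw : ∀ l, w l ≠ 0 := fun l => by
    by_cases h : l = i <;> simp [w, h, hMne]
  refine ⟨fun l => w l * θ l, ⟨fun l => mul_pos ?_ (hθ.pos l), fun α hα => ?_⟩, ?_⟩
  · exact Nat.cast_pos.2 (Nat.pos_of_ne_zero (hw l))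
  · have := hθ.indep (fun l => α l * w l) (by
      rw [← hα]
      refine Finset.sum_congr rfl fun l _ => ?_
      push_cast
      ring)
    funext l
    have := congrFun this l
    simpa [hw l] using this
  · have hle : ∑ l, ((p.1 l : ℝ) - r l) * (w l * θ l) < 0 := by
      rw [← Finset.add_sum_erase _ _ (Finset.mem_univ i)]
      have h1 : ((p.1 i : ℝ) - r i) * (w i * θ i) ≤ -(M * θ i) := by
        have : ((p.1 i : ℝ) + 1) ≤ r i := by exact_mod_cast hi
        simp only [w, if_true]
        nlinarith [mul_pos hM0 (hθ.pos i)]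
      have h2 : ∑ l ∈ Finset.univ.erase i, ((p.1 l : ℝ) - r l) * (w l * θ l) ≤
          ∑ l ∈ Finset.univ.erase i, (p.1 l : ℝ) * θ l := by
        refine Finset.sum_le_sum fun l hl => ?_
        simp only [w, if_neg (Finset.ne_of_mem_erase hl), Nat.cast_one, one_mul]
        have : (0 : ℝ) ≤ r l := Nat.cast_nonneg _
        nlinarith [hθ.pos l]
      rw [div_lt_iff₀ (hθ.pos i)] at hM
      linarith
    refine lt_of_le_of_lt ?_ hle
    have h3 : expWeight (fun l => w l * θ l) r p =
        ∑ l, ((p.1 l : ℝ) - p.2 * r l) * (w l * θ l) := by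
      rw [expWeight, Finset.mul_sum, ← Finset.sum_sub_distrib]
      exact Finset.sum_congr rfl fun l _ => by ring
    rw [h3]
    refine Finset.sum_le_sum fun l _ => ?_
    have h4 : (1 : ℝ) ≤ p.2 := by exact_mod_cast hp
    have h5 : (0 : ℝ) ≤ r l := Nat.cast_nonneg _
    have h6 : (0 : ℝ) ≤ w l * θ l := mul_nonneg (Nat.cast_nonneg _) (hθ.pos l).le
    exact mul_le_mul_of_nonneg_right (by nlinarith) h6

end Weights

namespace ExpMap

variable {k S : Type} [CommRing k] [CommRing S] [Algebra k S]

/-- The coefficient maps of an exponential map. -/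
def coeffMap (φ : ExpMap k S) (n : ℕ) (a : S) : S := (φ.toAlgHom a).coeff n

lemma coeffMap_zero (φ : ExpMap k S) (a : S) : φ.coeffMap 0 a = a := by
  rw [coeffMap, Polynomial.coeff_zero_eq_eval_zero, φ.eval_zero]

lemma coeff_coeff_eval₂_add (P : Polynomial S) (i n : ℕ) :
    ((Polynomial.eval₂ ((Polynomial.C (R := Polynomial S)).comp (Polynomial.C (R := S)))
      (Polynomial.C Polynomial.X + Polynomial.X) P).coeff i).coeff n =
    ((n + i).choose i : S) * P.coeff (n + i) := by
  induction P using Polynomial.induction_on' with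
  | add p q hp hq =>
    rw [Polynomial.eval₂_add, Polynomial.coeff_add, Polynomial.coeff_add, hp, hq,
      Polynomial.coeff_add, mul_add]
  | monomial j a =>
    rw [Polynomial.eval₂_monomial, RingHom.comp_apply, Polynomial.coeff_C_mul,
      add_comm (Polynomial.C _) Polynomial.X, Polynomial.coeff_X_add_C_pow, Polynomial.coeff_C_mul,
      ← Polynomial.C_eq_natCast, Polynomial.coeff_mul_C, Polynomial.coeff_X_pow,
      Polynomial.coeff_monomial]
    by_cases hij : i ≤ j
    · by_cases h : n = j - i
      · subst h
        rw [Nat.sub_add_cancel hij]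
        simp [mul_comm]
      · rw [if_neg h, if_neg (by omega)]
        simp
    · rw [Nat.choose_eq_zero_of_lt (not_le.1 hij),
        if_neg (show ¬ j = n + i by omega)]
      simp

lemma coeff_coeff_eval₂_map (φ : S →+* Polynomial S) (P : Polynomial S) (i n : ℕ) :
    ((Polynomial.eval₂ ((Polynomial.mapRingHom (Polynomial.C (R := S))).comp φ)
      (Polynomial.C Polynomial.X) P).coeff i).coeff n = (φ (P.coeff n)).coeff i := by
  induction P using Polynomial.induction_on' with
  | add p q hp hq =>
    rw [Polynomial.eval₂_add, Polynomial.coeff_add, Polynomial.coeff_add, hp, hq,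
      Polynomial.coeff_add, map_add, Polynomial.coeff_add]
  | monomial j a =>
    rw [Polynomial.eval₂_monomial, ← map_pow, Polynomial.coeff_mul_C, RingHom.comp_apply,
      Polynomial.coe_mapRingHom, Polynomial.coeff_map, Polynomial.coeff_C_mul,
      Polynomial.coeff_X_pow, Polynomial.coeff_monomial]
    by_cases h : n = j
    · simp [h]
    · simp [h, Ne.symm h]

lemma coeffMap_coeffMap (φ : ExpMap k S) (i n : ℕ) (a : S) :
    φ.coeffMap i (φ.coeffMap n a) = ((n + i).choose i : S) * φ.coeffMap (n + i) a := by
  have h := congrArg (fun P => (P.coeff i).coeff n) (φ.comp_add a)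
  simp only [coeff_coeff_eval₂_add] at h
  rw [coeff_coeff_eval₂_map] at h
  exact h

lemma mem_invariants_iff (φ : ExpMap k S) (a : S) :
    a ∈ φ.invariants ↔ ∀ n, n ≠ 0 → φ.coeffMap n a = 0 := by
  change φ.toAlgHom a = Polynomial.C a ↔ _
  constructor
  · intro h n hn
    rw [coeffMap, h, Polynomial.coeff_C, if_neg hn]
  · intro h
    ext n
    rw [Polynomial.coeff_C]
    split_ifs with hn
    · subst hn
      exact φ.coeffMap_zero a
    · exact h n hn

end ExpMap

section LeadTerm

variable {k m r F}

/-- `x^β y^j h` is the unique reduced term of least weight in `a`. -/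
def IsLeadTerm (θ : Fin m → ℝ) (a : RingA k m r F) (p : (Fin m → ℕ) × ℕ)
    (h : MvPolynomial (Fin 2) k) : Prop :=
  h ≠ 0 ∧ ∃ c, IsNormalForm c a ∧ c p = h ∧
    ∀ q ∈ c.support, q ≠ p → expWeight θ r p < expWeight θ r q

variable {θ : Fin m → ℝ} {a : RingA k m r F} {p : (Fin m → ℕ) × ℕ} {h : MvPolynomial (Fin 2) k}

lemma IsLeadTerm.isReducedExp (H : IsLeadTerm θ a p h) : IsReducedExp r p := by
  obtain ⟨h0, c, hc, rfl, -⟩ := H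
  exact hc.1 p (Finsupp.mem_support_iff.2 h0)

lemma IsNormalForm.exists_isLeadTerm (hθ : IsAdmissible θ) {c} (hc : IsNormalForm c a)
    (hne : c ≠ 0) : ∃ p ∈ c.support, IsLeadTerm θ a p (c p) ∧
      ∀ q ∈ c.support, expWeight θ r p ≤ expWeight θ r q := by
  obtain ⟨p, hp, hmin⟩ := Finset.exists_min_image c.support (expWeight θ r)
    (Finsupp.support_nonempty_iff.2 hne)
  refine ⟨p, hp, ⟨Finsupp.mem_support_iff.1 hp, c, hc, rfl, fun q hq hqp => ?_⟩, hmin⟩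
  refine lt_of_le_of_ne (hmin q hq) fun h => hqp ?_
  exact hθ.eq_of_reduced (hc.1 q hq) (hc.1 p hp) h.symm

lemma exists_isLeadTerm (hθ : IsAdmissible θ) (ha : a ≠ 0) : ∃ p h, IsLeadTerm θ a p h := by
  obtain ⟨c, hc⟩ := exists_normalForm a
  obtain ⟨p, -, hp, -⟩ := hc.exists_isLeadTerm hθ (by
    rintro rfl
    exact ha (by rw [hc.2, Finsupp.sum_zero_index]))
  exact ⟨p, _, hp⟩

lemma IsLeadTerm.hasLead {R G : Type} [CommRing R] [FunLike G (RingA k m r F) (HahnSeries ℝ R)]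
    [AddMonoidHomClass G (RingA k m r F) (HahnSeries ℝ R)] (G : G)
    (hG : ∀ q h, ∃ c, HasLead (G (monA k m r F q h)) (expWeight θ r q) c)
    (H : IsLeadTerm θ a p h) {c₀ : R} (h₀ : HasLead (G (monA k m r F p h)) (expWeight θ r p) c₀) :
    HasLead (G a) (expWeight θ r p) c₀ := by
  classical
  obtain ⟨hne, c, hc, rfl, hmin⟩ := H
  rw [hc.2, Finsupp.sum, map_sum,
    ← Finset.add_sum_erase _ _ (Finsupp.mem_support_iff.2 hne : p ∈ c.support)]
  have hs := HasLead.sum (γ := expWeight θ r p) (c.support.erase p)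
    (x := fun q => G (monA k m r F q (c q))) (c := fun _ => (0 : R)) fun q hq => by
      obtain ⟨d, hd⟩ := hG q (c q)
      exact hd.of_lt (hmin q (Finset.mem_of_mem_erase hq) (Finset.ne_of_mem_erase hq))
  simpa using h₀.add hs

lemma hasLead_monA {R : Type} [CommRing R] (G : RingA k m r F →+* HahnSeries ℝ R) {cx : Fin m → R}
    {cy ch : R} (hx : ∀ i, HasLead (G (xA k m r F i)) (θ i) (cx i))
    (hy : HasLead (G (yA k m r F)) (-∑ i, r i * θ i) cy) (hw : HasLead (G (planeA k m r F h)) 0 ch) :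
    HasLead (G (monA k m r F p h)) (expWeight θ r p) ((∏ i, cx i ^ p.1 i) * cy ^ p.2 * ch) := by
  rw [monA, map_mul, map_mul, map_prod, map_pow]
  simp only [map_pow]
  convert ((HasLead.prod Finset.univ fun i _ => (hx i).pow (p.1 i)).mul (hy.pow p.2)).mul hw using 1
  rw [expWeight]
  ring

instance hahnPlaneAlgebra (k : Type) [CommRing k] :
    Algebra k (HahnSeries ℝ (MvPolynomial (Fin 2) k)) := HahnSeries.instAlgebra

/-- The homomorphism `k[X_1,…,X_m,Z,T] → k[Z,T]⟦ℝ⟧` giving `X_i` weight `θ i`. -/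
def weightPoly (k : Type) [CommRing k] {m : ℕ} (θ : Fin m → ℝ) :
    MvPolynomial (Fin m ⊕ Fin 2) k →ₐ[k] HahnSeries ℝ (MvPolynomial (Fin 2) k) :=
  aeval (Sum.elim (fun i => HahnSeries.single (θ i) 1) fun j => HahnSeries.C (X j))

lemma weightPoly_rename (h : MvPolynomial (Fin 2) k) :
    weightPoly k θ (rename Sum.inr h) = HahnSeries.C h := by
  induction h using MvPolynomial.induction_on with
  | C c =>
    rw [rename_C, weightPoly, aeval_C]
    rfl
  | add p q hp hq => rw [map_add, map_add, map_add, hp, hq]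
  | mul_X p i hp =>
    rw [map_mul, map_mul, map_mul, hp, rename_X, weightPoly, aeval_X, Sum.elim_inr]

lemma exists_hasLead_weightPoly (hθ : IsAdmissible θ) (p : MvPolynomial (Fin m ⊕ Fin 2) k) :
    ∃ c, HasLead (weightPoly k θ p) 0 c := by
  induction p using MvPolynomial.induction_on with
  | C c =>
    have := weightPoly_rename (θ := θ) (C c)
    rw [rename_C] at this
    exact ⟨_, this ▸ HasLead.C _⟩
  | add p q hp hq =>
    obtain ⟨c, hc⟩ := hp
    obtain ⟨d, hd⟩ := hq
    exact ⟨_, by rw [map_add]; exact hc.add hd⟩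
  | mul_X p i hp =>
    obtain ⟨c, hc⟩ := hp
    have : ∃ d, HasLead (weightPoly k θ (X i)) 0 d := by
      rw [weightPoly, aeval_X]
      rcases i with i | i
      · exact ⟨0, (HasLead.single _ _).of_lt (hθ.pos i)⟩
      · exact ⟨_, HasLead.C _⟩
    obtain ⟨d, hd⟩ := this
    exact ⟨c * d, by rw [map_mul]; simpa using hc.mul hd⟩

lemma hasLead_weightPoly (hm : 1 ≤ m) (hθ : IsAdmissible θ) {f : MvPolynomial (Fin 2) k}
    {g : MvPolynomial (Fin m ⊕ Fin 2) k} (hFg : F = rename Sum.inr f + (∏ i, X (Sum.inl i)) * g) :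
    HasLead (weightPoly k θ F) 0 f := by
  rw [hFg, map_add, weightPoly_rename, map_mul, map_prod]
  obtain ⟨c, hc⟩ := exists_hasLead_weightPoly hθ g
  have h1 : HasLead (∏ i, weightPoly k θ (X (Sum.inl i))) (∑ i, θ i) (∏ _i : Fin m, 1) := by
    refine HasLead.prod _ fun i _ => ?_
    rw [weightPoly, aeval_X]
    exact HasLead.single _ _
  have h2 : 0 < ∑ i, θ i :=
    Finset.sum_pos (fun i _ => hθ.pos i) ⟨⟨0, hm⟩, Finset.mem_univ _⟩
  simpa using (HasLead.C f).add ((h1.mul hc).of_lt (by simpa using h2))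

/-- The homomorphism `A → k[Z,T]⟦ℝ⟧` giving `x_i` weight `θ i` and `z, t` weight `0`. -/
def weightA (k : Type) [CommRing k] (m : ℕ) (r : Fin m → ℕ) (F : MvPolynomial (Fin m ⊕ Fin 2) k)
    (θ : Fin m → ℝ) : RingA k m r F →ₐ[k] HahnSeries ℝ (MvPolynomial (Fin 2) k) :=
  liftA (fun i => HahnSeries.single (θ i) 1)
    (HahnSeries.single (-∑ i, r i * θ i) 1 * weightPoly k θ F) (fun j => HahnSeries.C (X j)) (by
      have : ∏ i, (HahnSeries.single (θ i) (1 : MvPolynomial (Fin 2) k)) ^ r i =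
          HahnSeries.single (∑ i, r i * θ i) 1 := by
        have hp : ∀ s : Finset (Fin m),
            ∏ i ∈ s, (HahnSeries.single (θ i) (1 : MvPolynomial (Fin 2) k)) ^ r i =
            HahnSeries.single (∑ i ∈ s, r i * θ i) 1 := by
          classical
          intro s
          induction s using Finset.induction_on with
          | empty => simp
          | insert i s hi ih =>
            rw [Finset.prod_insert hi, Finset.sum_insert hi, ih, HahnSeries.single_pow,
              HahnSeries.single_mul_single]
            simp
        exact hp _
      rw [this, ← mul_assoc, HahnSeries.single_mul_single]
      simp [weightPoly])

lemma weightA_planeA (h : MvPolynomial (Fin 2) k) :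
    weightA k m r F θ (planeA k m r F h) = HahnSeries.C h := by
  rw [← polyA_rename, weightA, liftA_polyA]
  exact weightPoly_rename h

lemma hasLead_weightA_monA (hm : 1 ≤ m) (hθ : IsAdmissible θ) {f : MvPolynomial (Fin 2) k}
    {g : MvPolynomial (Fin m ⊕ Fin 2) k} (hFg : F = rename Sum.inr f + (∏ i, X (Sum.inl i)) * g)
    (p : (Fin m → ℕ) × ℕ) (h : MvPolynomial (Fin 2) k) :
    HasLead (weightA k m r F θ (monA k m r F p h)) (expWeight θ r p) (f ^ p.2 * h) := by
  have := hasLead_monA (p := p) (h := h) (weightA k m r F θ).toRingHom (θ := θ) (cx := fun _ => 1)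
    (cy := f) (ch := h) (fun i => by
      have : weightA k m r F θ (xA k m r F i) = HahnSeries.single (θ i) 1 := liftA_xA _ _ _ _ _
      exact this ▸ HasLead.single _ _) (by
      have : weightA k m r F θ (yA k m r F) = _ := liftA_yA _ _ _ _
      have h2 := (HasLead.single (-∑ i, r i * θ i) (1 : MvPolynomial (Fin 2) k)).mul
        (hasLead_weightPoly hm hθ hFg)
      rw [add_zero, one_mul] at h2
      exact this ▸ h2) (by
      have := weightA_planeA (r := r) (F := F) (θ := θ) h
      exact this ▸ HasLead.C h)
  simpa using this

end LeadTerm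

section Twist

/-- The ring homomorphism of Hahn series induced by a ring homomorphism of coefficients. -/
def hahnMap {R S : Type} [CommRing R] [CommRing S] (f : R →+* S) :
    HahnSeries ℝ R →+* HahnSeries ℝ S where
  toFun x := x.map f
  map_one' := HahnSeries.map_one (f.toMonoidWithZeroHom)
  map_mul' _ _ := HahnSeries.map_mul (f : R →ₙ+* S)
  map_zero' := HahnSeries.map_zero (f : ZeroHom R S)
  map_add' _ _ := HahnSeries.map_add (f : R →+ S)

lemma coeff_hahnMap {R S : Type} [CommRing R] [CommRing S] (f : R →+* S) (x : HahnSeries ℝ R)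
    (γ : ℝ) : (hahnMap f x).coeff γ = f (x.coeff γ) := by
  change (x.map f).coeff γ = _
  rw [HahnSeries.map_coeff]

variable {A R : Type} [CommRing A] [CommRing R] (G : A →+* HahnSeries ℝ R) (ρ : ℝ)

/-- The map `A[U] → R[U]⟦ℝ⟧` extending `A → R⟦ℝ⟧` and giving `U` weight `-ρ`. -/
def twist : Polynomial A →+* HahnSeries ℝ (Polynomial R) :=
  Polynomial.eval₂RingHom ((hahnMap (Polynomial.C (R := R))).comp G)
    (HahnSeries.single (-ρ) Polynomial.X)

lemma coeff_coeff_twist (P : Polynomial A) (γ : ℝ) (n : ℕ) :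
    ((twist G ρ P).coeff γ).coeff n = (G (P.coeff n)).coeff (γ + n * ρ) := by
  induction P using Polynomial.induction_on' with
  | add p q hp hq =>
    rw [map_add, HahnSeries.coeff_add, Polynomial.coeff_add, hp, hq, Polynomial.coeff_add, map_add,
      HahnSeries.coeff_add]
  | monomial j a =>
    rw [twist, Polynomial.coe_eval₂RingHom, Polynomial.eval₂_monomial, HahnSeries.single_pow]
    have h : γ = (γ + j * ρ) + j • (-ρ) := by rw [nsmul_eq_mul]; ring
    conv_lhs => rw [h]
    rw [HahnSeries.coeff_mul_single_add, RingHom.comp_apply, coeff_hahnMap, Polynomial.coeff_C_mul,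
      Polynomial.coeff_X_pow, Polynomial.coeff_monomial]
    by_cases hn : n = j
    · simp [hn]
    · simp [hn, Ne.symm hn]

lemma hasLead_twist {P : Polynomial A} {γ : ℝ}
    (h : ∀ n, ∃ c, HasLead (G (P.coeff n)) (γ + n * ρ) c) :
    HasLead (twist G ρ P) γ ((twist G ρ P).coeff γ) := by
  refine ⟨fun δ hδ => ?_, rfl⟩
  ext n
  obtain ⟨c, hc⟩ := h n
  rw [coeff_coeff_twist, hc.1 _ (by linarith), Polynomial.coeff_zero]

lemma exists_slope {ι : Type} [Fintype ι] (w : ι → ℝ) (P : ι → Polynomial A)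
    (hG : Function.Injective G) (hP : ∃ i n, n ≠ 0 ∧ (P i).coeff n ≠ 0) :
    ∃ ρ : ℝ, (∀ i n, n ≠ 0 → ∃ c, HasLead (G ((P i).coeff n)) (w i + n * ρ) c) ∧
      ∃ i n, n ≠ 0 ∧ (G ((P i).coeff n)).coeff (w i + n * ρ) ≠ 0 := by
  classical
  let s : Finset (ι × ℕ) := Finset.univ.sigma (fun i => (P i).support.erase 0) |>.map
    ⟨fun x => (x.1, x.2), fun x y h => by
      obtain ⟨a, b⟩ := x
      obtain ⟨c, d⟩ := y
      simp only [Prod.mk.injEq] at h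
      obtain ⟨rfl, rfl⟩ := h
      rfl⟩
  have hs : ∀ x : ι × ℕ, x ∈ s ↔ x.2 ≠ 0 ∧ (P x.1).coeff x.2 ≠ 0 := by
    intro x
    simp only [s, Finset.mem_map, Finset.mem_sigma, Finset.mem_univ, true_and, Finset.mem_erase,
      Polynomial.mem_support_iff]
    constructor
    · rintro ⟨y, hy, rfl⟩
      exact hy
    · intro h
      exact ⟨⟨x.1, x.2⟩, h, rfl⟩
  let sl : ι × ℕ → ℝ := fun x => ((G ((P x.1).coeff x.2)).order - w x.1) / x.2
  obtain ⟨i, n, hn, hin⟩ := hP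
  obtain ⟨x, hx, hmin⟩ := Finset.exists_min_image s sl ⟨(i, n), (hs _).2 ⟨hn, hin⟩⟩
  have hne : ∀ {a}, a ≠ 0 → G a ≠ 0 := fun h => (map_ne_zero_iff G hG).2 h
  refine ⟨sl x, fun i n hn => ?_, x.1, x.2, ((hs x).1 hx).1, ?_⟩
  · by_cases h0 : (P i).coeff n = 0
    · exact ⟨0, by rw [h0, map_zero]; exact HasLead.zero⟩
    · have hle : sl x ≤ sl (i, n) := hmin (i, n) ((hs _).2 ⟨hn, h0⟩)
      have hn' : (0 : ℝ) < n := Nat.cast_pos.2 (Nat.pos_of_ne_zero hn)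
      have hle2 : w i + n * sl x ≤ (G ((P i).coeff n)).order := by
        have : sl (i, n) = ((G ((P i).coeff n)).order - w i) / n := rfl
        rw [this, le_div_iff₀ hn'] at hle
        linarith
      refine ⟨_, fun δ hδ => ?_, rfl⟩
      exact HahnSeries.coeff_eq_zero_of_lt_order (hδ.trans_le hle2)
  · have hn' : (x.2 : ℝ) ≠ 0 := Nat.cast_ne_zero.2 ((hs x).1 hx).1
    have : w x.1 + x.2 * sl x = (G ((P x.1).coeff x.2)).order := by
      simp only [sl]
      field_simp
      ring
    rw [this]
    exact fun h => hne ((hs x).1 hx).2 (HahnSeries.coeff_order_eq_zero.1 h)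

end Twist

/-- The leading forms of the elements of `A` for an exponential map, relative to a weight `θ` on
`A` for which `y` has an invariant leading form. -/
structure LeadingForm (k : Type) [Field k] (m : ℕ) (r : Fin m → ℕ)
    (F : MvPolynomial (Fin m ⊕ Fin 2) k) where
  θ : Fin m → ℝ
  adm : IsAdmissible θ
  ρ : ℝ
  D : ℕ → RingA k m r F → RingA k m r F
  ord : RingA k m r F → ℝ
  Φ : RingA k m r F → Polynomial (MvPolynomial (Fin 2) k)
  ΦW : MvPolynomial (Fin 2) k →+* Polynomial (MvPolynomial (Fin 2) k)
  Φ_planeA : ∀ h, h ≠ 0 → Φ (planeA k m r F h) = ΦW h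
  ΦW_C : ∀ c : k, ΦW (C c) = Polynomial.C (C c)
  coeff_zero_ΦW : ∀ h, (ΦW h).coeff 0 = h
  Φ_mul : ∀ {a b}, a ≠ 0 → b ≠ 0 → Φ (a * b) = Φ a * Φ b
  Φ_ne_zero : ∀ {a}, a ≠ 0 → Φ a ≠ 0
  monA_ne_zero : ∀ p {h}, h ≠ 0 → monA k m r F p h ≠ 0
  ord_lead : ∀ {a p h}, IsLeadTerm θ a p h → ord a = expWeight θ r p
  Φ_lead : ∀ {a p h}, IsLeadTerm θ a p h → Φ a = Φ (monA k m r F p h)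
  coeff_zero_lead : ∀ {a p h}, IsLeadTerm θ a p h → (Φ a).coeff 0 = fOf k m F ^ p.2 * h
  D_ne_zero : ∀ {a n}, a ≠ 0 → (Φ a).coeff n ≠ 0 → D n a ≠ 0
  ord_D : ∀ {a n}, a ≠ 0 → (Φ a).coeff n ≠ 0 → ord (D n a) = ord a + n * ρ
  coeff_Φ_D : ∀ {a n}, a ≠ 0 → (Φ a).coeff n ≠ 0 → ∀ i,
    (Φ (D n a)).coeff i = ((n + i).choose i : MvPolynomial (Fin 2) k) * (Φ a).coeff (n + i)
  choose_mul_coeff_Φ : ∀ {a n}, a ≠ 0 → (Φ a).coeff n = 0 → ∀ i,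
    ((n + i).choose i : MvPolynomial (Fin 2) k) * (Φ a).coeff (n + i) = 0
  Φ_relation : Φ (monA k m r F (r, 1) 1) = ΦW (fOf k m F)
  exists_pos : ∃ a, a ≠ 0 ∧ (Φ a).natDegree ≠ 0
  natDegree_yA : (Φ (yA k m r F)).natDegree = 0

section ExistsLeadingForm

variable {k : Type} [Field k] {m : ℕ} {r : Fin m → ℕ} {F : MvPolynomial (Fin m ⊕ Fin 2) k}

lemma exists_invariant_notMem_BA (hD : ¬ Derksen k (RingA k m r F) ≤ BA k m r F) :
    ∃ φ : ExpMap k (RingA k m r F), φ.invariants ≠ ⊤ ∧ ∃ d ∈ φ.invariants, d ∉ BA k m r F := by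
  by_contra! h
  refine hD (Algebra.adjoin_le fun d hd => ?_)
  obtain ⟨φ, hφ, hd⟩ := Set.mem_iUnion₂.1 hd
  exact h φ hφ d hd

lemma exists_weight_lead_neg {d : RingA k m r F} (hd : d ∉ BA k m r F) :
    ∃ θ : Fin m → ℝ, IsAdmissible θ ∧ ∃ p h, IsLeadTerm θ d p h ∧ p.2 ≠ 0 := by
  obtain ⟨c, hc⟩ := exists_normalForm d
  obtain ⟨p, hp, hp2⟩ : ∃ p ∈ c.support, p.2 ≠ 0 := by
    by_contra! h
    exact hd (mem_BA_of_normalForm hc h)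
  obtain ⟨i, hi⟩ := (hc.1 p hp).resolve_left hp2
  obtain ⟨θ, hθ, hneg⟩ := exists_isAdmissible_weight_neg r p (Nat.one_le_iff_ne_zero.2 hp2) i hi
  obtain ⟨q, hq, hlead, hmin⟩ := hc.exists_isLeadTerm hθ (by rintro rfl; simp at hp)
  refine ⟨θ, hθ, q, _, hlead, fun h0 => ?_⟩
  have h1 := (hmin p hp).trans_lt hneg
  have h2 : 0 ≤ expWeight θ r q := by
    rw [expWeight, h0]
    simp only [Nat.cast_zero, zero_mul, sub_zero]
    exact Finset.sum_nonneg fun i _ => mul_nonneg (Nat.cast_nonneg _) (hθ.pos i).le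
  linarith

/-- The generators of `A`. -/
def genA (k : Type) [CommRing k] (m : ℕ) (r : Fin m → ℕ) (F : MvPolynomial (Fin m ⊕ Fin 2) k) :
    Fin m ⊕ Fin 3 → RingA k m r F :=
  Sum.elim (xA k m r F) ![yA k m r F, zA k m r F, tA k m r F]

lemma exists_coeffMap_genA_ne_zero {φ : ExpMap k (RingA k m r F)} (hφ : φ.invariants ≠ ⊤) :
    ∃ i n, n ≠ 0 ∧ (φ.toAlgHom (genA k m r F i)).coeff n ≠ 0 := by
  by_contra! h
  refine hφ (top_unique fun a _ => ?_)
  have h' : ∀ i, genA k m r F i ∈ φ.invariants := fun i =>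
    (φ.mem_invariants_iff _).2 fun n hn => h i n hn
  refine mem_of_generators _ (fun i => h' (Sum.inl i)) (h' (Sum.inr 0)) (fun j => ?_) a
  fin_cases j
  · exact h' (Sum.inr 1)
  · exact h' (Sum.inr 2)

theorem exists_leadingForm (hm : 1 ≤ m) (hf : fOf k m F ≠ 0) {g : MvPolynomial (Fin m ⊕ Fin 2) k}
    (hFg : F = rename Sum.inr (fOf k m F) + (∏ i, X (Sum.inl i)) * g)
    (hD : ¬ Derksen k (RingA k m r F) ≤ BA k m r F) : Nonempty (LeadingForm k m r F) := by
  obtain ⟨φ, hφ, d, hdφ, hdB⟩ := exists_invariant_notMem_BA hD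
  obtain ⟨θ, hθ, p₀, h₀, hlead₀, hp₀⟩ := exists_weight_lead_neg hdB
  set f := fOf k m F with hfdef
  let G : RingA k m r F →+* HahnSeries ℝ (MvPolynomial (Fin 2) k) := (weightA k m r F θ).toRingHom
  have hGmon : ∀ p h, HasLead (G (monA k m r F p h)) (expWeight θ r p) (f ^ p.2 * h) :=
    hasLead_weightA_monA hm hθ hFg
  have hGlead : ∀ {a p h}, IsLeadTerm θ a p h → HasLead (G a) (expWeight θ r p) (f ^ p.2 * h) :=
    fun {a p h} H => H.hasLead G (fun q h => ⟨_, hGmon q h⟩) (hGmon p h)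
  have hfh : ∀ (j : ℕ) {h}, h ≠ 0 → f ^ j * h ≠ 0 := fun j h hh => mul_ne_zero (pow_ne_zero _ hf) hh
  have hGne : ∀ {a}, a ≠ 0 → G a ≠ 0 := by
    intro a ha
    obtain ⟨p, h, H⟩ := exists_isLeadTerm hθ ha
    exact (hGlead H).ne_zero (hfh _ H.1)
  have hGinj : Function.Injective G := (injective_iff_map_eq_zero G).2 fun a ha => by
    by_contra h
    exact hGne h ha
  let w : Fin m ⊕ Fin 3 → ℝ := Sum.elim θ ![-∑ i, r i * θ i, 0, 0]
  have hGpl : ∀ h, HasLead (G (planeA k m r F h)) 0 h := fun h => by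
    have : G (planeA k m r F h) = _ := weightA_planeA h
    rw [this]
    exact HasLead.C h
  have hGgen : ∀ i, ∃ c, c ≠ 0 ∧ HasLead (G (genA k m r F i)) (w i) c := by
    rintro (i | i)
    · refine ⟨1, one_ne_zero, ?_⟩
      have : G (xA k m r F i) = HahnSeries.single (θ i) 1 := liftA_xA _ _ _ _ _
      exact this ▸ HasLead.single _ _
    · fin_cases i
      · refine ⟨f, hf, ?_⟩
        have := hGmon (0, 1) 1
        simp only [monA, expWeight, Pi.zero_apply, pow_zero, Finset.prod_const_one, one_mul, pow_one,
          map_one, mul_one, CharP.cast_eq_zero, zero_mul, Finset.sum_const_zero, Nat.cast_one,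
          zero_sub] at this
        exact this
      · have := hGpl (X 0)
        rw [planeA, aeval_X] at this
        exact ⟨_, X_ne_zero 0, this⟩
      · have := hGpl (X 1)
        rw [planeA, aeval_X] at this
        exact ⟨_, X_ne_zero 1, this⟩
  obtain ⟨ρ, hρ, i₁, n₁, hn₁, hi₁⟩ := exists_slope G w (fun i => φ.toAlgHom (genA k m r F i)) hGinj
    (exists_coeffMap_genA_ne_zero hφ)
  let Ψ : RingA k m r F →+* HahnSeries ℝ (Polynomial (MvPolynomial (Fin 2) k)) :=
    (twist G ρ).comp φ.toAlgHom.toRingHom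
  have hΨ : ∀ a γ n, ((Ψ a).coeff γ).coeff n = (G (φ.coeffMap n a)).coeff (γ + n * ρ) :=
    fun a γ n => coeff_coeff_twist G ρ _ γ n
  have hΨgen : ∀ i, HasLead (Ψ (genA k m r F i)) (w i) ((Ψ (genA k m r F i)).coeff (w i)) := by
    intro i
    refine hasLead_twist G ρ fun n => ?_
    by_cases hn : n = 0
    · subst hn
      obtain ⟨c, -, hc⟩ := hGgen i
      refine ⟨c, ?_⟩
      have : (φ.toAlgHom (genA k m r F i)).coeff 0 = genA k m r F i := φ.coeffMap_zero _
      change HasLead (G ((φ.toAlgHom (genA k m r F i)).coeff 0)) _ _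
      rw [this]
      simpa using hc
    · exact hρ i n hn
  have hΨpl : ∀ h, HasLead (Ψ (planeA k m r F h)) 0 ((Ψ (planeA k m r F h)).coeff 0) := by
    intro h
    suffices ∃ c, HasLead (Ψ (planeA k m r F h)) 0 c by
      obtain ⟨c, hc⟩ := this
      exact ⟨hc.1, rfl⟩
    induction h using MvPolynomial.induction_on with
    | C c =>
      refine ⟨_, hasLead_twist G ρ fun n => ?_⟩
      have e : φ.toAlgHom.toRingHom (planeA k m r F (C c)) =
          Polynomial.C (planeA k m r F (C c)) := by
        rw [planeA, aeval_C]
        exact φ.toAlgHom.commutes c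
      rw [e, Polynomial.coeff_C]
      split_ifs with hn
      · exact ⟨_, by simpa [hn] using hGpl (C c)⟩
      · exact ⟨0, by rw [map_zero]; exact HasLead.zero⟩
    | add p q hp hq =>
      obtain ⟨c, hc⟩ := hp
      obtain ⟨d, hd⟩ := hq
      exact ⟨_, by rw [map_add, map_add]; exact hc.add hd⟩
    | mul_X p i hp =>
      obtain ⟨c, hc⟩ := hp
      have : ∃ d, HasLead (Ψ (planeA k m r F (X i))) 0 d := by
        rw [planeA, aeval_X]
        fin_cases i
        · exact ⟨_, hΨgen (Sum.inr 1)⟩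
        · exact ⟨_, hΨgen (Sum.inr 2)⟩
      obtain ⟨d, hd⟩ := this
      exact ⟨c * d, by rw [map_mul, map_mul]; simpa using hc.mul hd⟩
  have hΨmon : ∀ p h, HasLead (Ψ (monA k m r F p h)) (expWeight θ r p)
      ((Ψ (monA k m r F p h)).coeff (expWeight θ r p)) := fun p h => by
    have := hasLead_monA (p := p) Ψ (fun i => hΨgen (Sum.inl i)) (hΨgen (Sum.inr 0)) (hΨpl h)
    exact ⟨this.1, rfl⟩
  have hΨlead : ∀ {a p h}, IsLeadTerm θ a p h → HasLead (Ψ a) (expWeight θ r p)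
      ((Ψ (monA k m r F p h)).coeff (expWeight θ r p)) :=
    fun {a p h} H => H.hasLead Ψ (fun q h => ⟨_, hΨmon q h⟩) (hΨmon p h)
  let ord : RingA k m r F → ℝ := fun a => (G a).order
  let Φ : RingA k m r F → Polynomial (MvPolynomial (Fin 2) k) := fun a => (Ψ a).coeff (ord a)
  have hordlead : ∀ {a p h}, IsLeadTerm θ a p h → ord a = expWeight θ r p :=
    fun {a p h} H => (hGlead H).order_eq (hfh _ H.1)
  have hordmon : ∀ p {h}, h ≠ 0 → ord (monA k m r F p h) = expWeight θ r p :=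
    fun p h hh => (hGmon p h).order_eq (hfh _ hh)
  have hΦ : ∀ a, a ≠ 0 → HasLead (Ψ a) (ord a) (Φ a) := by
    intro a ha
    obtain ⟨p, h, H⟩ := exists_isLeadTerm hθ ha
    refine ⟨?_, rfl⟩
    rw [hordlead H]
    exact (hΨlead H).1
  have hΦcoeff : ∀ a n, (Φ a).coeff n = (G (φ.coeffMap n a)).coeff (ord a + n * ρ) :=
    fun a n => hΨ a _ n
  have hGD : ∀ a, a ≠ 0 → ∀ n, HasLead (G (φ.coeffMap n a)) (ord a + n * ρ) ((Φ a).coeff n) := by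
    intro a ha n
    refine ⟨fun δ hδ => ?_, (hΦcoeff a n).symm⟩
    have := congrArg (fun P => P.coeff n) ((hΦ a ha).1 (δ - n * ρ) (by linarith))
    simpa [hΨ] using this
  have hΦ0 : ∀ a, (Φ a).coeff 0 = (G a).leadingCoeff := fun a => by
    rw [hΦcoeff, φ.coeffMap_zero, HahnSeries.leadingCoeff_eq]
    simp [ord]
  have hΦne : ∀ {a}, a ≠ 0 → Φ a ≠ 0 := fun {a} ha h => by
    have := hΦ0 a
    rw [h, Polynomial.coeff_zero] at this
    exact HahnSeries.leadingCoeff_ne_zero.2 (hGne ha) this.symm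
  have hordmul : ∀ {a b}, a ≠ 0 → b ≠ 0 → ord (a * b) = ord a + ord b := fun {a b} ha hb => by
    simp only [ord, map_mul]
    exact HahnSeries.order_mul (hGne ha) (hGne hb)
  have hΦmul : ∀ {a b}, a ≠ 0 → b ≠ 0 → Φ (a * b) = Φ a * Φ b := fun {a b} ha hb => by
    have := ((hΦ a ha).mul (hΦ b hb)).2
    rw [← map_mul, ← hordmul ha hb] at this
    exact this
  have hmonne : ∀ p {h}, h ≠ 0 → monA k m r F p h ≠ 0 := fun p h hh h0 => by
    refine (hGmon p h).ne_zero (hfh _ hh) ?_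
    rw [h0, map_zero]
  have hΦlead : ∀ {a p h}, IsLeadTerm θ a p h → Φ a = Φ (monA k m r F p h) := fun {a p h} H => by
    simp only [Φ]
    rw [hordlead H, hordmon p H.1, (hΨlead H).2]
  refine ⟨{
    θ := θ
    adm := hθ
    ρ := ρ
    D := φ.coeffMap
    ord := ord
    Φ := Φ
    ΦW := { toFun := fun h => (Ψ (planeA k m r F h)).coeff 0
            map_one' := by rw [map_one, map_one, HahnSeries.coeff_one, if_pos rfl]
            map_mul' := fun a b => by
              have := ((hΨpl a).mul (hΨpl b)).2
              rw [← map_mul, ← map_mul, add_zero] at this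
              exact this
            map_zero' := by rw [map_zero, map_zero, HahnSeries.coeff_zero]
            map_add' := fun a b => by rw [map_add, map_add, HahnSeries.coeff_add] }
    Φ_planeA := fun h hh => by
      have : ord (planeA k m r F h) = 0 := (hGpl h).order_eq hh
      simp only [Φ, this]
      rfl
    ΦW_C := fun c => by
      ext1 n
      have e : φ.toAlgHom (planeA k m r F (C c)) = Polynomial.C (planeA k m r F (C c)) := by
        rw [planeA, aeval_C]
        exact φ.toAlgHom.commutes c
      change ((Ψ (planeA k m r F (C c))).coeff 0).coeff n = _
      rw [hΨ, ExpMap.coeffMap, e, Polynomial.coeff_C, Polynomial.coeff_C]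
      split_ifs with hn
      · subst hn
        simpa using (hGpl (C c)).2
      · rw [map_zero, HahnSeries.coeff_zero]
    coeff_zero_ΦW := fun h => by
      change ((Ψ (planeA k m r F h)).coeff 0).coeff 0 = _
      rw [hΨ, φ.coeffMap_zero]
      simpa using (hGpl h).2
    Φ_mul := hΦmul
    Φ_ne_zero := hΦne
    monA_ne_zero := hmonne
    ord_lead := hordlead
    Φ_lead := hΦlead
    coeff_zero_lead := fun {a p h} H => by
      rw [hΦ0]
      exact (hGlead H).leadingCoeff_eq (hfh _ H.1)
    D_ne_zero := fun {a n} ha hn h0 => by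
      refine (hGD a ha n).ne_zero hn ?_
      rw [h0, map_zero]
    ord_D := fun {a n} ha hn => (hGD a ha n).order_eq hn
    coeff_Φ_D := fun {a n} ha hn i => by
      have e : ord (φ.coeffMap n a) = ord a + n * ρ := (hGD a ha n).order_eq hn
      rw [hΦcoeff, hΦcoeff, e, φ.coeffMap_coeffMap, map_mul, map_natCast, ← map_natCast
        (HahnSeries.C (Γ := ℝ) (R := MvPolynomial (Fin 2) k)), HahnSeries.C_apply,
        HahnSeries.coeff_single_zero_mul]
      congr 2
      push_cast
      ring
    choose_mul_coeff_Φ := fun {a n} ha hn i => by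
      have h1 : HasLead (G (φ.coeffMap i (φ.coeffMap n a))) (ord a + n * ρ + i * ρ) 0 := by
        by_cases h0 : φ.coeffMap n a = 0
        · rw [h0, ExpMap.coeffMap, map_zero, Polynomial.coeff_zero, map_zero]
          exact HasLead.zero
        · refine (hGD _ h0 i).of_lt (add_lt_add_left ?_ _)
          refine lt_of_le_of_ne ((HahnSeries.le_order_iff_forall (hGne h0)).2 (hGD a ha n).1) ?_
          intro h
          refine hGne h0 (HahnSeries.leadingCoeff_eq_zero.1 ?_)
          have h2 := (hGD a ha n).2
          rw [hn, h] at h2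
          rw [HahnSeries.leadingCoeff_eq]
          exact h2
      have h2 := h1.2
      rw [φ.coeffMap_coeffMap, map_mul, map_natCast, ← map_natCast
        (HahnSeries.C (Γ := ℝ) (R := MvPolynomial (Fin 2) k)), HahnSeries.C_apply,
        HahnSeries.coeff_single_zero_mul] at h2
      rw [hΦcoeff, ← h2]
      congr 2
      push_cast
      ring
    Φ_relation := by
      have e : monA k m r F (r, 1) 1 = polyA k m r F F := by
        rw [← prod_xA_mul_yA, monA, map_one, mul_one, pow_one]
      have hw0 : expWeight θ r (r, 1) = 0 := by simp [expWeight]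
      have hx : HasLead (Ψ (∏ i, xA k m r F i)) (∑ i, θ i)
          (∏ i, (Ψ (xA k m r F i)).coeff (θ i)) := by
        rw [map_prod]
        exact HasLead.prod Finset.univ fun i _ => hΨgen (Sum.inl i)
      have hpos : 0 < ∑ i, θ i :=
        Finset.sum_pos (fun i _ => hθ.pos i) ⟨⟨0, hm⟩, Finset.mem_univ _⟩
      have hpoly : ∀ P, ∃ c, HasLead (Ψ (polyA k m r F P)) 0 c := by
        intro P
        induction P using MvPolynomial.induction_on with
        | C c =>
          have := hΨpl (C c)
          rw [← polyA_rename, rename_C] at this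
          exact ⟨_, this⟩
        | add p q hp hq =>
          obtain ⟨c, hc⟩ := hp
          obtain ⟨d, hd⟩ := hq
          exact ⟨_, by rw [map_add, map_add]; exact hc.add hd⟩
        | mul_X p i hp =>
          obtain ⟨c, hc⟩ := hp
          have : ∃ d, HasLead (Ψ (polyA k m r F (X i))) 0 d := by
            rcases i with i | i
            · rw [polyA, aeval_X]
              exact ⟨0, (hΨgen (Sum.inl i)).of_lt (hθ.pos i)⟩
            · have := hΨpl (X i)
              rw [← polyA_rename, rename_X] at this
              exact ⟨_, this⟩
          obtain ⟨d, hd⟩ := this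
          exact ⟨c * d, by rw [map_mul, map_mul]; simpa using hc.mul hd⟩
      obtain ⟨c, hc⟩ := hpoly g
      have hF : HasLead (Ψ (polyA k m r F F)) 0 ((Ψ (planeA k m r F f)).coeff 0 + 0) := by
        have hsplit : polyA k m r F F = planeA k m r F f +
            (∏ i, xA k m r F i) * polyA k m r F g := by
          have := congrArg (polyA k m r F) hFg
          rw [map_add, polyA_rename, map_mul, map_prod] at this
          rw [this]
          simp only [polyA, aeval_X, Sum.elim_inl]
        rw [hsplit, map_add, map_mul]
        exact (hΨpl f).add ((hx.mul hc).of_lt (by linarith))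
      have ho : ord (monA k m r F (r, 1) 1) = 0 := by rw [hordmon _ one_ne_zero, hw0]
      simp only [Φ, ho]
      rw [e, hF.2, add_zero]
      rfl
    exists_pos := by
      obtain ⟨c, hc, hlead⟩ := hGgen i₁
      have hne : genA k m r F i₁ ≠ 0 := by
        intro h0
        refine hlead.ne_zero hc ?_
        rw [h0, map_zero]
      refine ⟨genA k m r F i₁, hne, fun h => hi₁ ?_⟩
      have e : ord (genA k m r F i₁) = w i₁ := hlead.order_eq hc
      have := Polynomial.coeff_eq_zero_of_natDegree_lt (h.trans_lt (Nat.pos_of_ne_zero hn₁))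
      rw [hΦcoeff, e] at this
      exact this
    natDegree_yA := by
      have hy : yA k m r F ≠ 0 := by
        have := hmonne (0, 1) one_ne_zero
        simpa [monA] using this
      have hd0 : d ≠ 0 := by
        rintro rfl
        exact hdB (zero_mem _)
      have hdeg : (Φ d).natDegree = 0 := by
        by_contra h
        have h1 := hΦcoeff d (Φ d).natDegree
        rw [(φ.mem_invariants_iff d).1 hdφ _ h, map_zero, HahnSeries.coeff_zero,
          Polynomial.coeff_natDegree, Polynomial.leadingCoeff_eq_zero] at h1
        exact hΦne hd0 h1
      have hsplit : monA k m r F p₀ h₀ = yA k m r F * monA k m r F (p₀.1, p₀.2 - 1) h₀ := by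
        have : yA k m r F ^ p₀.2 = yA k m r F * yA k m r F ^ (p₀.2 - 1) := by
          rw [← pow_succ', Nat.sub_add_cancel (Nat.one_le_iff_ne_zero.2 hp₀)]
        simp only [monA, this]
        ring
      have hne := hmonne (p₀.1, p₀.2 - 1) hlead₀.1
      rw [hΦlead hlead₀, hsplit, hΦmul hy hne,
        Polynomial.natDegree_mul (hΦne hy) (hΦne hne)] at hdeg
      omega }⟩

end ExistsLeadingForm

lemma natCast_choose_eq_one {k : Type} [CommRing k] {n : ℕ} (hn : 0 < n)
    (h : ∀ j, 0 < j → j < n → (n.choose j : k) = 0) (q : ℕ) {s : ℕ} (hs : s < n) :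
    ((q * n + s).choose s : k) = 1 := by
  have h1 : (1 + Polynomial.X : Polynomial k) ^ n = 1 + Polynomial.X ^ n := by
    ext j
    rw [Polynomial.coeff_one_add_X_pow, Polynomial.coeff_add, Polynomial.coeff_one, Polynomial.coeff_X_pow]
    rcases Nat.eq_zero_or_pos j with rfl | hj
    · simp [hn.ne]
    · rcases lt_trichotomy j n with hjn | rfl | hjn
      · simp [h j hj hjn, hj.ne', hjn.ne]
      · simp [hj.ne']
      · simp [Nat.choose_eq_zero_of_lt hjn, hj.ne', hjn.ne']
  have h2 : ∃ R : Polynomial k, (1 + Polynomial.X : Polynomial k) ^ (q * n + s) = (1 + Polynomial.X) ^ s + Polynomial.X ^ n * R := by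
    obtain ⟨R, hR⟩ : (Polynomial.X ^ n : Polynomial k) ∣ (1 + Polynomial.X ^ n) ^ q - 1 := by
      have h := sub_dvd_pow_sub_pow (1 + Polynomial.X ^ n : Polynomial k) 1 q
      have e : (1 + Polynomial.X ^ n : Polynomial k) - 1 = Polynomial.X ^ n := by ring
      rwa [one_pow, e] at h
    refine ⟨R * (1 + Polynomial.X) ^ s, ?_⟩
    rw [pow_add, mul_comm q, pow_mul, h1, sub_eq_iff_eq_add.1 hR]
    ring
  obtain ⟨R, hR⟩ := h2
  have h3 := congrArg (fun P => Polynomial.coeff P s) hR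
  simp only [Polynomial.coeff_one_add_X_pow, Polynomial.coeff_add, Polynomial.coeff_X_pow_mul', if_neg hs.not_ge, add_zero,
    Nat.choose_self, Nat.cast_one] at h3
  exact h3

/-- The exponent vector in `ℤ^m` of the fraction `x^β / (x^r)^j`. -/
def expVec {m : ℕ} (r : Fin m → ℕ) (p : (Fin m → ℕ) × ℕ) (i : Fin m) : ℤ := p.1 i - p.2 * r i

lemma expWeight_eq_sum {m : ℕ} (θ : Fin m → ℝ) (r : Fin m → ℕ) (p : (Fin m → ℕ) × ℕ) :
    expWeight θ r p = ∑ i, (expVec r p i : ℝ) * θ i := by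
  rw [expWeight, Finset.mul_sum, ← Finset.sum_sub_distrib]
  refine Finset.sum_congr rfl fun i _ => ?_
  rw [expVec]
  push_cast
  ring

lemma IsAdmissible.mul_expVec_eq {m : ℕ} {θ : Fin m → ℝ} (hθ : IsAdmissible θ) {r : Fin m → ℕ}
    {p q p' q' : (Fin m → ℕ) × ℕ} {c c' : ℕ}
    (h : c * (expWeight θ r p - expWeight θ r q) = c' * (expWeight θ r p' - expWeight θ r q'))
    (i : Fin m) :
    c * (expVec r p i - expVec r q i) = c' * (expVec r p' i - expVec r q' i) := by
  have := hθ.indep (fun i => c * (expVec r p i - expVec r q i) -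
    c' * (expVec r p' i - expVec r q' i)) (by
      rw [← sub_eq_zero] at h
      rw [← h]
      simp only [expWeight_eq_sum, ← Finset.sum_sub_distrib, Finset.mul_sum]
      refine Finset.sum_congr rfl fun i _ => ?_
      push_cast
      ring)
  exact sub_eq_zero.1 (congrFun this i)

lemma isLeadTerm_monA {k : Type} [CommRing k] {m : ℕ} {r : Fin m → ℕ}
    {F : MvPolynomial (Fin m ⊕ Fin 2) k} (θ : Fin m → ℝ) {p : (Fin m → ℕ) × ℕ}
    (hp : IsReducedExp r p) {h : MvPolynomial (Fin 2) k} (hh : h ≠ 0) :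
    IsLeadTerm θ (monA k m r F p h) p h := by
  classical
  refine ⟨hh, Finsupp.single p h, ⟨fun q hq => ?_, ?_⟩, Finsupp.single_eq_same, fun q hq hqp => ?_⟩
  · rwa [Finset.mem_singleton.1 (Finsupp.support_single_subset hq)]
  · rw [Finsupp.sum_single_index]
    simp [monA]
  · exact absurd (Finset.mem_singleton.1 (Finsupp.support_single_subset hq)) hqp

namespace LeadingForm

variable {k : Type} [Field k] {m : ℕ} {r : Fin m → ℕ} {F : MvPolynomial (Fin m ⊕ Fin 2) k}
  (L : LeadingForm k m r F)

/-- The degree of the leading form of an element of `A`. -/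
def deg (a : RingA k m r F) : ℕ := (L.Φ a).natDegree

/-- The degree of the leading form of an element of `k[Z,T]`. -/
def degW (h : MvPolynomial (Fin 2) k) : ℕ := (L.ΦW h).natDegree

lemma ΦW_ne_zero {h : MvPolynomial (Fin 2) k} (hh : h ≠ 0) : L.ΦW h ≠ 0 := fun h0 => hh (by
  rw [← L.coeff_zero_ΦW h, h0, Polynomial.coeff_zero])

lemma degW_mul {a b : MvPolynomial (Fin 2) k} (ha : a ≠ 0) (hb : b ≠ 0) :
    L.degW (a * b) = L.degW a + L.degW b := by
  rw [degW, map_mul, Polynomial.natDegree_mul (L.ΦW_ne_zero ha) (L.ΦW_ne_zero hb)]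
  rfl

lemma degW_zero : L.degW 0 = 0 := by rw [degW, map_zero, Polynomial.natDegree_zero]

lemma degW_one : L.degW 1 = 0 := by rw [degW, map_one, Polynomial.natDegree_one]

lemma ΦW_eq_C {h : MvPolynomial (Fin 2) k} (hh : L.degW h = 0) : L.ΦW h = Polynomial.C h := by
  rw [Polynomial.eq_C_of_natDegree_eq_zero hh, L.coeff_zero_ΦW]

lemma monA_planeA (h : MvPolynomial (Fin 2) k) : monA k m r F 0 h = planeA k m r F h := by
  simp [monA]

lemma monA_xA (i : Fin m) : monA k m r F (Pi.single i 1, 0) 1 = xA k m r F i := by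
  classical
  rw [monA, map_one, mul_one, pow_zero, mul_one, Finset.prod_eq_single i]
  · simp
  · intro j _ hj
    simp [Pi.single_eq_of_ne hj]
  · simp

lemma xA_ne_zero (L : LeadingForm k m r F) (i : Fin m) : xA k m r F i ≠ 0 := by
  rw [← monA_xA]
  exact L.monA_ne_zero _ one_ne_zero

lemma planeA_ne_zero (L : LeadingForm k m r F) {h : MvPolynomial (Fin 2) k} (hh : h ≠ 0) : planeA k m r F h ≠ 0 := by
  rw [← monA_planeA]
  exact L.monA_ne_zero _ hh

lemma yA_ne_zero (L : LeadingForm k m r F) : yA k m r F ≠ 0 := by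
  have := L.monA_ne_zero (0, 1) one_ne_zero
  simpa [monA] using this

lemma deg_mul {a b : RingA k m r F} (ha : a ≠ 0) (hb : b ≠ 0) :
    L.deg (a * b) = L.deg a + L.deg b := by
  rw [deg, L.Φ_mul ha hb, Polynomial.natDegree_mul (L.Φ_ne_zero ha) (L.Φ_ne_zero hb)]
  rfl

lemma deg_planeA {h : MvPolynomial (Fin 2) k} (hh : h ≠ 0) :
    L.deg (planeA k m r F h) = L.degW h := by
  rw [deg, L.Φ_planeA h hh, degW]

lemma exists_deg_eq {a : RingA k m r F} (ha : a ≠ 0) {n i : ℕ} (hN : L.deg a = n + i)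
    (hc : ((n + i).choose i : k) ≠ 0) : ∃ b, b ≠ 0 ∧ L.deg b = i := by
  have hc' : ((n + i).choose i : MvPolynomial (Fin 2) k) ≠ 0 := by
    rw [← map_natCast (C (R := k) (σ := Fin 2))]
    exact (map_ne_zero_iff _ (C_injective (Fin 2) k)).2 hc
  have htop : (L.Φ a).coeff (n + i) ≠ 0 := by
    rw [← hN, deg, Polynomial.coeff_natDegree]
    exact Polynomial.leadingCoeff_ne_zero.2 (L.Φ_ne_zero ha)
  have hn : (L.Φ a).coeff n ≠ 0 := fun h0 => mul_ne_zero hc' htop (L.choose_mul_coeff_Φ ha h0 i)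
  refine ⟨L.D n a, L.D_ne_zero ha hn, le_antisymm ?_ ?_⟩
  · refine Polynomial.natDegree_le_iff_coeff_eq_zero.2 fun j hj => ?_
    rw [L.coeff_Φ_D ha hn, Polynomial.coeff_eq_zero_of_natDegree_lt (n := n + j), mul_zero]
    change L.deg a < _
    omega
  · refine Polynomial.le_natDegree_of_ne_zero ?_
    rw [L.coeff_Φ_D ha hn]
    exact mul_ne_zero hc' htop

lemma exists_min_deg : ∃ a, a ≠ 0 ∧ 0 < L.deg a ∧ ∀ b, b ≠ 0 → L.deg a ∣ L.deg b := by
  classical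
  have hex : ∃ n, 0 < n ∧ ∃ a, a ≠ 0 ∧ L.deg a = n := by
    obtain ⟨a, ha, h⟩ := L.exists_pos
    exact ⟨_, Nat.pos_of_ne_zero h, a, ha, rfl⟩
  obtain ⟨hpos, a, ha, hn⟩ := Nat.find_spec hex
  have hmin : ∀ j, 0 < j → j < Nat.find hex → ∀ b, b ≠ 0 → L.deg b ≠ j :=
    fun j hj hjn b hb h => Nat.find_min hex hjn ⟨hj, b, hb, h⟩
  have hchoose : ∀ j, 0 < j → j < Nat.find hex → ((Nat.find hex).choose j : k) = 0 := by
    intro j hj hjn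
    by_contra hc
    have e : Nat.find hex - j + j = Nat.find hex := Nat.sub_add_cancel hjn.le
    obtain ⟨b, hb, hbj⟩ := L.exists_deg_eq ha (n := Nat.find hex - j) (i := j)
      (by rw [e, hn]) (by rwa [e])
    exact hmin j hj hjn b hb hbj
  refine ⟨a, ha, by rwa [hn], fun b hb => ?_⟩
  rw [hn]
  by_contra hdvd
  have hlt := Nat.mod_lt (L.deg b) hpos
  have hpos' : 0 < L.deg b % Nat.find hex :=
    Nat.pos_of_ne_zero fun h => hdvd (Nat.dvd_of_mod_eq_zero h)
  have hc := natCast_choose_eq_one hpos hchoose (L.deg b / Nat.find hex) hlt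
  obtain ⟨c, hc0, hcj⟩ := L.exists_deg_eq hb (n := L.deg b / Nat.find hex * Nat.find hex)
    (i := L.deg b % Nat.find hex) (Nat.div_add_mod' _ _).symm (by rw [hc]; exact one_ne_zero)
  exact hmin _ hpos' hlt c hc0 hcj

variable [IsDomain (RingA k m r F)]

lemma deg_one : L.deg 1 = 0 := by
  have := L.deg_mul (one_ne_zero (α := RingA k m r F)) one_ne_zero
  rw [mul_one] at this
  omega

lemma deg_pow {a : RingA k m r F} (ha : a ≠ 0) (n : ℕ) : L.deg (a ^ n) = n * L.deg a := by
  induction n with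
  | zero => rw [pow_zero, L.deg_one, zero_mul]
  | succ n ih => rw [pow_succ, L.deg_mul (pow_ne_zero _ ha) ha, ih, add_mul, one_mul]

lemma deg_prod {ι : Type} (s : Finset ι) {a : ι → RingA k m r F} (ha : ∀ i, a i ≠ 0) :
    L.deg (∏ i ∈ s, a i) = ∑ i ∈ s, L.deg (a i) := by
  classical
  induction s using Finset.induction_on with
  | empty => simp [L.deg_one]
  | insert i s hi ih =>
    rw [Finset.prod_insert hi, Finset.sum_insert hi,
      L.deg_mul (ha i) (Finset.prod_ne_zero_iff.2 fun i _ => ha i), ih]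

lemma deg_monA (p : (Fin m → ℕ) × ℕ) {h : MvPolynomial (Fin 2) k} (hh : h ≠ 0) :
    L.deg (monA k m r F p h) = ∑ i, p.1 i * L.deg (xA k m r F i) + L.degW h := by
  have hx : ∀ i, xA k m r F i ^ p.1 i ≠ 0 := fun i => pow_ne_zero _ (L.xA_ne_zero i)
  have hy := pow_ne_zero p.2 L.yA_ne_zero
  rw [monA, L.deg_mul (mul_ne_zero (Finset.prod_ne_zero_iff.2 fun i _ => hx i) hy)
    (L.planeA_ne_zero hh), L.deg_mul (Finset.prod_ne_zero_iff.2 fun i _ => hx i) hy,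
    L.deg_prod _ hx, L.deg_pow L.yA_ne_zero, L.deg_planeA hh, deg, L.natDegree_yA, mul_zero,
    add_zero]
  simp only [L.deg_pow (L.xA_ne_zero _)]

lemma deg_of_isLeadTerm {a : RingA k m r F} {p h} (H : IsLeadTerm L.θ a p h) :
    L.deg a = ∑ i, p.1 i * L.deg (xA k m r F i) + L.degW h := by
  rw [deg, L.Φ_lead H, ← L.deg_monA p H.1, deg]

lemma exists_lead_top {a : RingA k m r F} (ha : a ≠ 0) : ∃ p h, IsReducedExp r p ∧ h ≠ 0 ∧
    L.degW h = 0 ∧ (∀ i, L.deg (xA k m r F i) ≠ 0 → p.1 i = 0) ∧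
    expWeight L.θ r p = L.ord a + L.deg a * L.ρ ∧
    fOf k m F ^ p.2 * h = (L.Φ a).coeff (L.deg a) := by
  have hn : (L.Φ a).coeff (L.deg a) ≠ 0 := by
    rw [deg, Polynomial.coeff_natDegree]
    exact Polynomial.leadingCoeff_ne_zero.2 (L.Φ_ne_zero ha)
  have hb := L.D_ne_zero ha hn
  have hdeg : L.deg (L.D (L.deg a) a) = 0 := by
    refine Nat.le_zero.1 (Polynomial.natDegree_le_iff_coeff_eq_zero.2 fun j hj => ?_)
    rw [L.coeff_Φ_D ha hn, Polynomial.coeff_eq_zero_of_natDegree_lt (n := L.deg a + j), mul_zero]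
    change L.deg a < _
    omega
  obtain ⟨p, h, H⟩ := exists_isLeadTerm L.adm hb
  have hsum := L.deg_of_isLeadTerm H
  rw [hdeg, eq_comm, Nat.add_eq_zero_iff, Finset.sum_eq_zero_iff] at hsum
  refine ⟨p, h, H.isReducedExp, H.1, hsum.2, fun i hi => ?_, ?_, ?_⟩
  · exact (Nat.mul_eq_zero.1 (hsum.1 i (Finset.mem_univ i))).resolve_right hi
  · rw [← L.ord_lead H, L.ord_D ha hn]
  · rw [← L.coeff_zero_lead H, L.coeff_Φ_D ha hn]
    simp

end LeadingForm

/-- A degree function on `k[Z,T]` with one-dimensional graded pieces, up to elements of degree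
zero. -/
structure PlaneDegree (k : Type) [Field k] where
  N : MvPolynomial (Fin 2) k → ℕ
  N_mul : ∀ {a b}, a ≠ 0 → b ≠ 0 → N (a * b) = N a + N b
  N_add_le : ∀ a b, N (a + b) ≤ max (N a) (N b)
  N_C : ∀ c, N (C c) = 0
  exists_lt : ∀ {a b}, a ≠ 0 → b ≠ 0 → N a = N b → N a ≠ 0 →
    ∃ c d, c ≠ 0 ∧ d ≠ 0 ∧ N c = 0 ∧ N d = 0 ∧ N (c * a - d * b) < N a

namespace LeadingForm

variable {k : Type} [Field k] {m : ℕ} {r : Fin m → ℕ} {F : MvPolynomial (Fin m ⊕ Fin 2) k}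
  (L : LeadingForm k m r F)

lemma ord_xA (i : Fin m) : L.ord (xA k m r F i) = expWeight L.θ r (Pi.single i 1, 0) := by
  rw [← monA_xA]
  exact L.ord_lead (isLeadTerm_monA L.θ (Or.inl rfl) one_ne_zero)

lemma ord_planeA {h : MvPolynomial (Fin 2) k} (hh : h ≠ 0) : L.ord (planeA k m r F h) = 0 := by
  rw [← monA_planeA, L.ord_lead (isLeadTerm_monA L.θ (Or.inl rfl) hh)]
  simp [expWeight]

variable [IsDomain (RingA k m r F)]

lemma degW_fOf :
    L.degW (fOf k m F) = ∑ i, r i * L.deg (xA k m r F i) := by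
  have := L.deg_monA (r, 1) one_ne_zero
  rw [deg, L.Φ_relation, L.degW_one, add_zero] at this
  exact this

/-- The relation between the degrees of two elements with given leading exponents. -/
lemma exists_relation {a b : RingA k m r F} (ha : a ≠ 0) (hb : b ≠ 0) {q q' : (Fin m → ℕ) × ℕ}
    (hq : L.ord a = expWeight L.θ r q) (hq' : L.ord b = expWeight L.θ r q') :
    ∃ j j' : ℕ, ∃ β β' : Fin m → ℕ,
      (∀ i, L.deg (xA k m r F i) ≠ 0 → β i = 0 ∧ β' i = 0) ∧
      ∀ i, (L.deg b : ℤ) * (β i - j * r i - expVec r q i) =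
        L.deg a * (β' i - j' * r i - expVec r q' i) := by
  obtain ⟨p, h, -, -, -, hp, hw, -⟩ := L.exists_lead_top ha
  obtain ⟨p', h', -, -, -, hp', hw', -⟩ := L.exists_lead_top hb
  refine ⟨p.2, p'.2, p.1, p'.1, fun i hi => ⟨hp i hi, hp' i hi⟩, fun i => ?_⟩
  refine L.adm.mul_expVec_eq (p := p) (p' := p') ?_ i
  rw [hw, hw', hq, hq']
  ring

lemma eq_of_deg_xA_ne_zero {i₁ i₂ : Fin m} (hr : ∀ i, 1 < r i) (h₁ : L.deg (xA k m r F i₁) ≠ 0)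
    (h₂ : L.deg (xA k m r F i₂) ≠ 0) : i₁ = i₂ := by
  by_contra hne
  obtain ⟨j, j', β, β', h0, h⟩ := L.exists_relation (L.xA_ne_zero i₁) (L.xA_ne_zero i₂)
    (L.ord_xA i₁) (L.ord_xA i₂)
  have e1 := h i₁
  have e2 := h i₂
  simp only [expVec, (h0 i₁ h₁).1, (h0 i₁ h₁).2, (h0 i₂ h₂).1, (h0 i₂ h₂).2, Pi.single_eq_same,
    Pi.single_eq_of_ne hne, Pi.single_eq_of_ne (Ne.symm hne)] at e1 e2
  push_cast at e1 e2
  have hr1 : (0 : ℤ) < r i₁ := by exact_mod_cast (hr i₁).le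
  have hr2 : (0 : ℤ) < r i₂ := by exact_mod_cast (hr i₂).le
  have hd1 : (0 : ℤ) < L.deg (xA k m r F i₁) := by exact_mod_cast Nat.pos_of_ne_zero h₁
  have hd2 : (0 : ℤ) < L.deg (xA k m r F i₂) := by exact_mod_cast Nat.pos_of_ne_zero h₂
  have := mul_pos hd2 hr2
  have := mul_pos hd1 hr1
  have h3 : (L.deg (xA k m r F i₂) * r i₂ + L.deg (xA k m r F i₁) * r i₁ : ℤ) = 0 := by
    linear_combination r i₁ * e2 - r i₂ * e1
  linarith

lemma exists_relation_planeA {i : Fin m} (hi : L.deg (xA k m r F i) ≠ 0)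
    {h : MvPolynomial (Fin 2) k} (hh : h ≠ 0) :
    ∃ j j' : ℕ, L.degW h * (j * r i + 1) = L.deg (xA k m r F i) * (j' * r i) := by
  obtain ⟨j, j', β, β', h0, H⟩ := L.exists_relation (q' := 0) (L.xA_ne_zero i)
    (L.planeA_ne_zero hh) (L.ord_xA i) (by rw [L.ord_planeA hh]; simp [expWeight])
  refine ⟨j, j', ?_⟩
  have e := H i
  simp only [expVec, (h0 i hi).1, (h0 i hi).2, Pi.single_eq_same, L.deg_planeA hh] at e
  simp at e
  zify
  linarith

lemma exists_degW_step (hf : fOf k m F ≠ 0) (hr : ∀ i, 1 < r i) :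
    ∃ n, 0 < n ∧ (∀ h, h ≠ 0 → n ∣ L.degW h) ∧
      (L.degW (fOf k m F) = 0 ∨ L.degW (fOf k m F) = n) ∧ ∃ s, s ≠ 0 ∧ L.degW s = n := by
  obtain ⟨a, ha, hpos, hdvd⟩ := L.exists_min_deg
  obtain ⟨p, h, H⟩ := exists_isLeadTerm L.adm ha
  have hdeg := L.deg_of_isLeadTerm H
  by_cases hx : ∀ i, L.deg (xA k m r F i) = 0
  · simp only [hx, mul_zero, Finset.sum_const_zero, zero_add] at hdeg
    refine ⟨L.deg a, hpos, fun h hh => ?_, Or.inl ?_, h, H.1, hdeg.symm⟩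
    · rw [← L.deg_planeA hh]
      exact hdvd _ (L.planeA_ne_zero hh)
    · rw [L.degW_fOf]
      simp [hx]
  · push Not at hx
    obtain ⟨i, hi⟩ := hx
    have hother : ∀ j, j ≠ i → L.deg (xA k m r F j) = 0 := fun j hj => by
      by_contra h
      exact hj (L.eq_of_deg_xA_ne_zero hr h hi)
    have hsum : ∀ β : Fin m → ℕ, ∑ j, β j * L.deg (xA k m r F j) =
        β i * L.deg (xA k m r F i) := fun β => by
      rw [Finset.sum_eq_single i (fun j _ hj => by rw [hother j hj, mul_zero])]
      simp
    have hfdeg := L.degW_fOf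
    rw [hsum] at hfdeg
    rw [hsum] at hdeg
    have hri := hr i
    obtain ⟨l, hl⟩ := hdvd _ (L.xA_ne_zero i)
    have hp : p.1 i ≠ 0 := by
      intro h0
      rw [h0, zero_mul, zero_add] at hdeg
      obtain ⟨j, j', hj⟩ := L.exists_relation_planeA hi H.1
      rw [← hdeg, hl, mul_assoc, Nat.mul_right_inj hpos.ne', ← mul_assoc] at hj
      have h1 : r i ∣ 1 := (Nat.dvd_add_right (Dvd.intro_left j rfl)).1 (hj ▸ Dvd.intro_left _ rfl)
      exact hri.ne' (Nat.dvd_one.1 h1)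
    have hle : L.deg (xA k m r F i) ≤ L.deg a := by
      rw [hdeg]
      exact (Nat.le_mul_of_pos_left _ (Nat.pos_of_ne_zero hp)).trans (Nat.le_add_right _ _)
    have heq : L.deg a = L.deg (xA k m r F i) :=
      le_antisymm (Nat.le_of_dvd (Nat.pos_of_ne_zero hi) ⟨l, hl⟩) hle
    refine ⟨r i * L.deg (xA k m r F i), by positivity, fun g hg => ?_, Or.inr hfdeg, _, hf, hfdeg⟩
    obtain ⟨c, hc⟩ := hdvd _ (L.planeA_ne_zero hg)
    rw [L.deg_planeA hg, heq] at hc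
    obtain ⟨j, j', hj⟩ := L.exists_relation_planeA hi hg
    rw [hc, mul_assoc, Nat.mul_right_inj hi] at hj
    have h1 : r i ∣ c := by
      refine Nat.Coprime.dvd_of_dvd_mul_right ?_ (Dvd.intro_left j' hj.symm)
      simp
    rw [hc, mul_comm (r i)]
    exact mul_dvd_mul_left _ h1

lemma exists_degW_lt {a b : MvPolynomial (Fin 2) k} (ha : a ≠ 0) (hb : b ≠ 0)
    (hab : L.degW a = L.degW b) (h0 : L.degW a ≠ 0) :
    ∃ c d, c ≠ 0 ∧ d ≠ 0 ∧ L.degW c = 0 ∧ L.degW d = 0 ∧ L.degW (c * a - d * b) < L.degW a := by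
  obtain ⟨p, c, hp, hc, hc0, -, hw, hl⟩ := L.exists_lead_top (L.planeA_ne_zero ha)
  obtain ⟨q, d, hq, hd, hd0, -, hw', hl'⟩ := L.exists_lead_top (L.planeA_ne_zero hb)
  rw [L.ord_planeA ha, L.deg_planeA ha] at hw
  rw [L.ord_planeA hb, L.deg_planeA hb] at hw'
  obtain rfl : p = q := L.adm.eq_of_reduced hp hq (by rw [hw, hw', hab])
  rw [L.deg_planeA ha, L.Φ_planeA a ha] at hl
  rw [L.deg_planeA hb, L.Φ_planeA b hb] at hl'
  refine ⟨d, c, hd, hc, hd0, hc0, ?_⟩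
  refine lt_of_le_of_ne ?_ ?_
  · rw [degW, map_sub]
    refine (Polynomial.natDegree_sub_le _ _).trans (max_le ?_ ?_)
    · exact (L.degW_mul hd ha).le.trans (by rw [hd0, zero_add])
    · exact (L.degW_mul hc hb).le.trans (by rw [hc0, zero_add, hab])
  · intro he
    have : (L.ΦW (d * a - c * b)).coeff (L.degW a) = 0 := by
      rw [map_sub, map_mul, map_mul, L.ΦW_eq_C hc0, L.ΦW_eq_C hd0, Polynomial.coeff_sub,
        Polynomial.coeff_C_mul, Polynomial.coeff_C_mul, ← hl, hab, ← hl']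
      ring
    rw [← he, degW, Polynomial.coeff_natDegree, Polynomial.leadingCoeff_eq_zero] at this
    rw [degW, this, Polynomial.natDegree_zero] at he
    exact h0 he.symm

theorem exists_planeDegree (L : LeadingForm k m r F) (hf : fOf k m F ≠ 0) (hr : ∀ i, 1 < r i) :
    ∃ P : PlaneDegree k, P.N (fOf k m F) ≤ 1 ∧ ∃ s, P.N s = 1 := by
  obtain ⟨n, hn, hdvd, hfn, s, hs, hsn⟩ := L.exists_degW_step hf hr
  have hdvd' : ∀ h, n ∣ L.degW h := fun h => by
    by_cases hh : h = 0
    · rw [hh, L.degW_zero]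
      exact dvd_zero n
    · exact hdvd h hh
  have hdiv0 : ∀ {h}, L.degW h / n = 0 ↔ L.degW h = 0 := fun {h} => by
    obtain ⟨c, hc⟩ := hdvd' h
    rw [hc, Nat.mul_div_cancel_left _ hn]
    simp [hn.ne']
  refine ⟨{
    N := fun h => L.degW h / n
    N_mul := fun {a b} ha hb => by
      rw [L.degW_mul ha hb, Nat.add_div_of_dvd_left (hdvd b hb)]
    N_add_le := fun a b => by
      have : L.degW (a + b) ≤ max (L.degW a) (L.degW b) := by
        rw [degW, map_add]
        exact Polynomial.natDegree_add_le _ _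
      rcases le_total (L.degW a) (L.degW b) with h | h
      · exact le_max_of_le_right (Nat.div_le_div_right (by rwa [max_eq_right h] at this))
      · exact le_max_of_le_left (Nat.div_le_div_right (by rwa [max_eq_left h] at this))
    N_C := fun c => by rw [degW, L.ΦW_C, Polynomial.natDegree_C, Nat.zero_div]
    exists_lt := fun {a b} ha hb hab h0 => by
      have hab' : L.degW a = L.degW b := by
        rw [← Nat.div_mul_cancel (hdvd a ha), ← Nat.div_mul_cancel (hdvd b hb), hab]
      obtain ⟨c, d, hc, hd, hc0, hd0, hlt⟩ := L.exists_degW_lt ha hb hab'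
        (fun h => h0 (hdiv0.2 h))
      exact ⟨c, d, hc, hd, hdiv0.2 hc0, hdiv0.2 hd0,
        Nat.div_lt_div_of_lt_of_dvd (hdvd a ha) hlt⟩ }, ?_, s, ?_⟩
  · rcases hfn with h | h
    · simp [h]
    · simp [h, hn]
  · simp [hsn, hn]

end LeadingForm

section Plane

variable {k : Type} [Field k]

lemma constantCoeff_aeval_eq {σ : Type} {h : MvPolynomial σ k} (h0 : constantCoeff h = 0)
    (q : Polynomial k) : constantCoeff (Polynomial.aeval h q) = q.coeff 0 := by
  rw [Polynomial.aeval_def, Polynomial.hom_eval₂, h0, Polynomial.eval₂_at_zero]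
  simp [algebraMap_eq]

lemma aeval_injective_of_constantCoeff {σ : Type} {h : MvPolynomial σ k} (h0 : constantCoeff h = 0)
    (hne : h ≠ 0) (q : Polynomial k) (hq : Polynomial.aeval h q = 0) : q = 0 := by
  induction q using Polynomial.recOnHorner with
  | M0 => rfl
  | MC p a hp ha ih =>
    have := congrArg constantCoeff hq
    rw [constantCoeff_aeval_eq h0, Polynomial.coeff_add, hp, Polynomial.coeff_C_zero, zero_add,
      map_zero] at this
    exact absurd this ha
  | MX p hp ih =>
    rw [map_mul, Polynomial.aeval_X] at hq
    rw [ih ((mul_eq_zero.1 hq).resolve_right hne), zero_mul]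

/-- The substitution `Q(X, S) ↦ Q(h, s)`. -/
def biEval (h s : MvPolynomial (Fin 2) k) :
    Polynomial (Polynomial k) →+* MvPolynomial (Fin 2) k :=
  Polynomial.eval₂RingHom (Polynomial.aeval h).toRingHom s

lemma biEval_C (h s : MvPolynomial (Fin 2) k) (q : Polynomial k) :
    biEval h s (Polynomial.C q) = Polynomial.aeval h q := by simp [biEval]

lemma biEval_X (h s : MvPolynomial (Fin 2) k) : biEval h s Polynomial.X = s := by simp [biEval]

lemma biEval_mem_adjoin (h s : MvPolynomial (Fin 2) k) (Q : Polynomial (Polynomial k)) :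
    biEval h s Q ∈ Algebra.adjoin k {h, s} := by
  induction Q using Polynomial.induction_on' with
  | add p q hp hq => rw [map_add]; exact add_mem hp hq
  | monomial n q =>
    rw [← Polynomial.C_mul_X_pow_eq_monomial, map_mul, map_pow, biEval_C, biEval_X]
    refine mul_mem ?_ (pow_mem (Algebra.subset_adjoin (by simp)) n)
    exact Algebra.adjoin_mono (by simp) (Polynomial.aeval_mem_adjoin_singleton k h)

lemma transcendental_three {u v w : MvPolynomial (Fin 2) k} :
    ∃ R : MvPolynomial (Fin 3) k, R ≠ 0 ∧ aeval ![w, u, v] R = 0 := by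
  by_contra! h
  have hinj : Function.Injective (aeval (R := k) ![w, u, v]) :=
    (injective_iff_map_eq_zero _).2 fun R hR => by
      by_contra hne
      exact h R hne hR
  have := trdeg_le_of_injective (aeval (R := k) ![w, u, v]) hinj
  rw [MvPolynomial.trdeg_of_isDomain, MvPolynomial.trdeg_of_isDomain] at this
  simp only [Cardinal.mk_fin, Cardinal.lift_natCast, Nat.cast_le] at this
  omega

lemma not_X_mem_adjoin_singleton (s : MvPolynomial (Fin 2) k) :
    ¬ ∀ i, (X i : MvPolynomial (Fin 2) k) ∈ Algebra.adjoin k {s} := by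
  intro h
  have htop : Algebra.adjoin k {s} = (⊤ : Subalgebra k (MvPolynomial (Fin 2) k)) := by
    rw [eq_top_iff, ← MvPolynomial.adjoin_range_X, Algebra.adjoin_le_iff]
    rintro _ ⟨i, rfl⟩
    exact h i
  have hsurj : Function.Surjective (Polynomial.aeval (R := k) s) := by
    rw [← AlgHom.range_eq_top, ← Algebra.adjoin_singleton_eq_range_aeval, htop]
  have := trdeg_le_of_surjective _ hsurj
  rw [MvPolynomial.trdeg_of_isDomain, Polynomial.trdeg_of_isDomain] at this
  simp at this

namespace PlaneDegree

variable (P : PlaneDegree k)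

lemma N_zero : P.N 0 = 0 := by
  have := P.N_C 0
  rwa [map_zero] at this

lemma N_one : P.N 1 = 0 := by
  have := P.N_C 1
  rwa [map_one] at this

lemma N_neg (a : MvPolynomial (Fin 2) k) : P.N (-a) = P.N a := by
  by_cases ha : a = 0
  · rw [ha, neg_zero]
  · have h1 : (C (-1) : MvPolynomial (Fin 2) k) ≠ 0 := by simp
    have := P.N_mul h1 ha
    rw [P.N_C, zero_add] at this
    rw [← this]
    simp

lemma N_sub_le (a b : MvPolynomial (Fin 2) k) : P.N (a - b) ≤ max (P.N a) (P.N b) := by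
  rw [sub_eq_add_neg, ← P.N_neg b]
  exact P.N_add_le _ _

lemma N_mul_le (a b : MvPolynomial (Fin 2) k) : P.N (a * b) ≤ P.N a + P.N b := by
  by_cases ha : a = 0
  · rw [ha, zero_mul, P.N_zero]; exact Nat.zero_le _
  by_cases hb : b = 0
  · rw [hb, mul_zero, P.N_zero]; exact Nat.zero_le _
  exact (P.N_mul ha hb).le

lemma N_pow {a : MvPolynomial (Fin 2) k} (ha : a ≠ 0) (n : ℕ) : P.N (a ^ n) = n * P.N a := by
  induction n with
  | zero => rw [pow_zero, P.N_one, zero_mul]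
  | succ n ih => rw [pow_succ, P.N_mul (pow_ne_zero _ ha) ha, ih, add_mul, one_mul]

lemma N_sum_lt {ι : Type} (s : Finset ι) (a : ι → MvPolynomial (Fin 2) k) {n : ℕ} (hn : 0 < n)
    (h : ∀ i ∈ s, P.N (a i) < n) : P.N (∑ i ∈ s, a i) < n := by
  classical
  induction s using Finset.induction_on with
  | empty => rwa [Finset.sum_empty, P.N_zero]
  | insert i s hi ih =>
    rw [Finset.sum_insert hi]
    exact (P.N_add_le _ _).trans_lt (max_lt (h i (Finset.mem_insert_self _ _))
      (ih fun j hj => h j (Finset.mem_insert_of_mem hj)))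

/-- The subalgebra of elements of degree zero. -/
def kernel : Subalgebra k (MvPolynomial (Fin 2) k) where
  carrier := {a | P.N a = 0}
  mul_mem' := fun {a b} ha hb => by
    have := P.N_mul_le a b
    simp only [Set.mem_ofPred_eq] at ha hb ⊢
    omega
  add_mem' := fun {a b} ha hb => by
    have := P.N_add_le a b
    simp only [Set.mem_ofPred_eq] at ha hb ⊢
    omega
  algebraMap_mem' := fun c => P.N_C c

lemma mem_kernel {a : MvPolynomial (Fin 2) k} : a ∈ P.kernel ↔ P.N a = 0 := Iff.rfl

lemma mem_kernel_of_mul {a b : MvPolynomial (Fin 2) k} (h : a * b ∈ P.kernel) (h0 : a * b ≠ 0) :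
    a ∈ P.kernel ∧ b ∈ P.kernel := by
  have := P.N_mul (left_ne_zero_of_mul h0) (right_ne_zero_of_mul h0)
  rw [P.mem_kernel.1 h] at this
  exact ⟨P.mem_kernel.2 (by omega), P.mem_kernel.2 (by omega)⟩

variable {s : MvPolynomial (Fin 2) k}

lemma ne_zero_of_N (hs : P.N s = 1) : s ≠ 0 := by
  rintro rfl
  rw [P.N_zero] at hs
  omega

lemma N_eval (hs : P.N s = 1) (Q : Polynomial (MvPolynomial (Fin 2) k))
    (hQ : ∀ i, Q.coeff i ∈ P.kernel) (hne : Q ≠ 0) :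
    Q.eval s ≠ 0 ∧ P.N (Q.eval s) = Q.natDegree := by
  have hs0 := P.ne_zero_of_N hs
  rw [Polynomial.eval_eq_sum_range, Finset.sum_range_succ]
  have hlc : Q.coeff Q.natDegree ≠ 0 := Polynomial.leadingCoeff_ne_zero.2 hne
  have htop : P.N (Q.coeff Q.natDegree * s ^ Q.natDegree) = Q.natDegree := by
    rw [P.N_mul hlc (pow_ne_zero _ hs0), P.N_pow hs0, P.mem_kernel.1 (hQ _), hs]
    omega
  rcases Nat.eq_zero_or_pos Q.natDegree with h0 | hpos
  · rw [h0] at hlc ⊢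
    simpa using ⟨hlc, hQ 0⟩
  · have hlt := P.N_sum_lt (Finset.range Q.natDegree) (fun i => Q.coeff i * s ^ i) hpos
      fun i hi => by
        refine (P.N_mul_le _ _).trans_lt ?_
        rw [P.N_pow hs0, P.mem_kernel.1 (hQ _), hs]
        have := Finset.mem_range.1 hi
        omega
    set a := ∑ i ∈ Finset.range Q.natDegree, Q.coeff i * s ^ i
    set b := Q.coeff Q.natDegree * s ^ Q.natDegree
    have hN : P.N (a + b) = Q.natDegree := by
      refine le_antisymm ((P.N_add_le _ _).trans (by omega)) ?_
      have := P.N_sub_le (a + b) a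
      rw [add_sub_cancel_left, htop] at this
      omega
    refine ⟨fun h => ?_, hN⟩
    rw [h, P.N_zero] at hN
    omega

lemma exists_mul_mem_adjoin (hs : P.N s = 1) (a : MvPolynomial (Fin 2) k) :
    ∃ c ∈ P.kernel, c ≠ 0 ∧ c * a ∈ Algebra.adjoin k ((P.kernel : Set _) ∪ {s}) := by
  have hs0 := P.ne_zero_of_N hs
  have hker : ∀ {c}, c ∈ P.kernel → c ∈ Algebra.adjoin k ((P.kernel : Set _) ∪ {s}) :=
    fun hc => Algebra.subset_adjoin (Or.inl hc)
  have hsmem : s ∈ Algebra.adjoin k ((P.kernel : Set _) ∪ {s}) :=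
    Algebra.subset_adjoin (Or.inr rfl)
  induction hn : P.N a using Nat.strong_induction_on generalizing a with
  | _ n ih =>
    by_cases h0 : n = 0
    · refine ⟨1, one_mem _, one_ne_zero, ?_⟩
      rw [one_mul]
      exact hker (by rw [mem_kernel, hn, h0])
    · have ha : a ≠ 0 := by
        rintro rfl
        rw [P.N_zero] at hn
        exact h0 hn.symm
      obtain ⟨c, d, hc, hd, hc0, hd0, hlt⟩ := P.exists_lt ha (pow_ne_zero n hs0)
        (by rw [P.N_pow hs0, hs, hn, mul_one]) (by rwa [hn])
      obtain ⟨e, he, he0, hmem⟩ := ih _ (hn ▸ hlt) _ rfl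
      refine ⟨e * c, mul_mem he hc0, mul_ne_zero he0 hc, ?_⟩
      have : e * c * a = e * (c * a - d * s ^ n) + e * (d * s ^ n) := by ring
      rw [this]
      exact add_mem hmem (mul_mem (hker he) (mul_mem (hker hd0) (pow_mem hsmem n)))

lemma exists_kernel_ne (hs : P.N s = 1) :
    ∃ h ∈ P.kernel, h ≠ 0 ∧ constantCoeff h = 0 := by
  by_contra! hcon
  have hC : ∀ c ∈ P.kernel, c = C (constantCoeff c) := fun c hc => by
    by_contra hne
    refine hcon (c - C (constantCoeff c)) (sub_mem hc (P.N_C _)) (sub_ne_zero.2 hne) ?_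
    simp
  refine not_X_mem_adjoin_singleton s fun i => ?_
  obtain ⟨c, hc, hc0, hmem⟩ := P.exists_mul_mem_adjoin hs (X i)
  have hle : Algebra.adjoin k ((P.kernel : Set _) ∪ {s}) ≤ Algebra.adjoin k {s} := by
    refine Algebra.adjoin_le ?_
    rintro a (ha | ha)
    · rw [hC a ha]
      exact Subalgebra.algebraMap_mem _ _
    · exact Algebra.subset_adjoin ha
  rw [hC c hc] at hmem hc0
  have hu : constantCoeff c ≠ 0 := fun h => hc0 (by rw [h, map_zero])
  have := mul_mem (Subalgebra.algebraMap_mem (Algebra.adjoin k {s}) (constantCoeff c)⁻¹) (hle hmem)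
  rwa [algebraMap_eq, ← mul_assoc, ← map_mul, inv_mul_cancel₀ hu, map_one, one_mul] at this

lemma exists_relation_kernel (hs : P.N s = 1) {h c : MvPolynomial (Fin 2) k} (hh : h ∈ P.kernel)
    (hc : c ∈ P.kernel) : ∃ R : MvPolynomial (Fin 2) k, R ≠ 0 ∧ aeval ![h, c] R = 0 := by
  obtain ⟨R, hR, hR0⟩ := transcendental_three (u := h) (v := c) (w := s)
  have hmem : ∀ r : MvPolynomial (Fin 2) k, aeval ![h, c] r ∈ P.kernel := fun r => by
    induction r using MvPolynomial.induction_on with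
    | C a => rw [aeval_C]; exact Subalgebra.algebraMap_mem _ _
    | add p q hp hq => rw [map_add]; exact add_mem hp hq
    | mul_X p i hp =>
      rw [map_mul, aeval_X]
      refine mul_mem hp ?_
      fin_cases i
      · exact hh
      · exact hc
  set Q := (finSuccEquiv k 2 R).map (aeval (R := k) ![h, c]).toRingHom with hQ
  have heval : Q.eval s = 0 := by
    have key : (Polynomial.eval₂RingHom (aeval (R := k) ![h, c]).toRingHom s).comp
        (finSuccEquiv k 2).toAlgHom.toRingHom = (aeval (R := k) ![s, h, c]).toRingHom := by
      refine MvPolynomial.ringHom_ext (fun a => ?_) fun i => ?_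
      · change Polynomial.eval₂ _ s (finSuccEquiv k 2 (C a)) = aeval _ (C a)
        rw [finSuccEquiv_apply, eval₂Hom_C, aeval_C]
        simp [algebraMap_eq]
      · change Polynomial.eval₂ _ s (finSuccEquiv k 2 (X i)) = aeval _ (X i)
        rw [aeval_X]
        refine Fin.cases ?_ (fun j => ?_) i
        · rw [finSuccEquiv_X_zero, Polynomial.eval₂_X]
          rfl
        · rw [finSuccEquiv_X_succ, Polynomial.eval₂_C, Matrix.cons_val_succ]
          exact aeval_X _ _
    rw [hQ, Polynomial.eval_map]
    rw [← hR0]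
    exact DFunLike.congr_fun key R
  have hQ0 : Q = 0 := by
    by_contra hne
    exact (P.N_eval hs Q (fun i => by rw [hQ, Polynomial.coeff_map]; exact hmem _) hne).1 heval
  have hne : finSuccEquiv k 2 R ≠ 0 := (map_ne_zero_iff _ (finSuccEquiv k 2).injective).2 hR
  refine ⟨(finSuccEquiv k 2 R).leadingCoeff, Polynomial.leadingCoeff_ne_zero.2 hne, ?_⟩
  have := congrArg (fun q => q.coeff (finSuccEquiv k 2 R).natDegree) hQ0
  rw [hQ] at this
  simpa using this

end PlaneDegree

end Plane

section Plane

variable {k : Type} [Field k]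

lemma dvd_of_eval₂_eq_zero {A B : Type} [CommRing A] [CommRing B] [IsDomain B] (φ : A →+* B)
    {h : B} (h0 : h ≠ 0) (Q : Polynomial A) (hQ : Q ≠ 0) (hev : Q.eval₂ φ h = 0) :
    ∃ q : A, q ≠ 0 ∧ h ∣ φ q := by
  induction Q using Polynomial.recOnHorner with
  | M0 => exact absurd rfl hQ
  | MC p a hp ha ih =>
    refine ⟨a, ha, ?_⟩
    obtain ⟨p, rfl⟩ := Polynomial.X_dvd_iff.2 hp
    rw [Polynomial.eval₂_add, Polynomial.eval₂_mul, Polynomial.eval₂_X, Polynomial.eval₂_C] at hev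
    exact ⟨-p.eval₂ φ h, by linear_combination hev⟩
  | MX p hp ih =>
    rw [Polynomial.eval₂_mul, Polynomial.eval₂_X] at hev
    exact ih hp ((mul_eq_zero.1 hev).resolve_right h0)

lemma dvd_of_dvd_aeval {h c : MvPolynomial (Fin 2) k} (hp : Prime h) (h0 : constantCoeff h = 0)
    (c0 : constantCoeff c = 0) (q : Polynomial k) (hq : q ≠ 0) (hd : h ∣ Polynomial.aeval c q) :
    h ∣ c := by
  induction q using Polynomial.recOnHorner with
  | M0 => exact absurd rfl hq
  | MC p a hp' ha ih =>
    obtain ⟨e, he⟩ := hd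
    have := congrArg constantCoeff he
    rw [constantCoeff_aeval_eq c0, Polynomial.coeff_add, hp', Polynomial.coeff_C_zero, map_mul,
      h0, zero_add, zero_mul] at this
    exact absurd this ha
  | MX p hp' ih =>
    rw [map_mul, Polynomial.aeval_X] at hd
    exact (hp.dvd_or_dvd hd).elim (ih hp') id

lemma totalDegree_pos_of_constantCoeff {h : MvPolynomial (Fin 2) k} (h0 : h ≠ 0)
    (hc : constantCoeff h = 0) : 0 < h.totalDegree := by
  refine Nat.pos_of_ne_zero fun hd => h0 ?_
  rw [totalDegree_eq_zero_iff_eq_C.1 hd] at hc ⊢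
  rw [constantCoeff_C] at hc
  rw [hc, map_zero]

namespace PlaneDegree

variable (P : PlaneDegree k) {s : MvPolynomial (Fin 2) k}

lemma exists_generator (hs : P.N s = 1) :
    ∃ h ∈ P.kernel, h ≠ 0 ∧ constantCoeff h = 0 ∧
      ∀ c ∈ P.kernel, ∃ q : Polynomial k, Polynomial.aeval h q = c := by
  classical
  have hex : ∃ n, ∃ h ∈ P.kernel, h ≠ 0 ∧ constantCoeff h = 0 ∧ h.totalDegree = n := by
    obtain ⟨h, h1, h2, h3⟩ := P.exists_kernel_ne hs
    exact ⟨_, h, h1, h2, h3, rfl⟩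
  obtain ⟨h, hh, h0, hε, hd⟩ := Nat.find_spec hex
  have hmin : ∀ c ∈ P.kernel, c ≠ 0 → constantCoeff c = 0 → h.totalDegree ≤ c.totalDegree :=
    fun c hc hc0 hcε => hd ▸ Nat.find_min' hex ⟨c, hc, hc0, hcε, rfl⟩
  have hunit : ∀ a b, a * b = h → constantCoeff a = 0 → IsUnit b := by
    intro a b hab ha
    have hab0 : a * b ≠ 0 := hab ▸ h0
    have ha0 := left_ne_zero_of_mul hab0
    have hb0 := right_ne_zero_of_mul hab0
    have hle := hmin a (P.mem_kernel_of_mul (hab ▸ hh) hab0).1 ha0 ha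
    rw [← hab, totalDegree_mul_of_isDomain ha0 hb0] at hle
    have hb := totalDegree_eq_zero_iff_eq_C.1 (show b.totalDegree = 0 by omega)
    rw [hb] at hb0 ⊢
    exact (isUnit_iff_ne_zero.2 fun h => hb0 (by rw [h, map_zero])).map C
  have hirr : Irreducible h := by
    refine ⟨fun hu => ?_, fun a b hab => ?_⟩
    · have := hu.map (constantCoeff (σ := Fin 2) (R := k))
      rw [hε] at this
      exact not_isUnit_zero this
    · have := congrArg constantCoeff hab
      rw [hε, _root_.map_mul] at this
      rcases mul_eq_zero.1 this.symm with h | h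
      · exact Or.inr (hunit a b hab.symm h)
      · exact Or.inl (hunit b a (by rw [mul_comm, hab]) h)
  have hprime := hirr.prime
  have hdvd : ∀ c ∈ P.kernel, constantCoeff c = 0 → h ∣ c := by
    intro c hc hcε
    obtain ⟨R, hR, hR0⟩ := P.exists_relation_kernel hs hh hc
    obtain ⟨q, hq, hqd⟩ := dvd_of_eval₂_eq_zero (aeval (R := k) ![c]).toRingHom h0
      (finSuccEquiv k 1 R) ((map_ne_zero_iff _ (finSuccEquiv k 1).injective).2 hR) (by
        rw [← hR0]
        have key : (Polynomial.eval₂RingHom (aeval (R := k) ![c]).toRingHom h).comp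
            (finSuccEquiv k 1).toAlgHom.toRingHom = (aeval (R := k) ![h, c]).toRingHom := by
          refine MvPolynomial.ringHom_ext (fun a => ?_) fun i => ?_
          · change Polynomial.eval₂ _ h (finSuccEquiv k 1 (C a)) = aeval _ (C a)
            rw [finSuccEquiv_apply, eval₂Hom_C, aeval_C]
            simp [algebraMap_eq]
          · change Polynomial.eval₂ _ h (finSuccEquiv k 1 (X i)) = aeval _ (X i)
            rw [aeval_X]
            refine Fin.cases ?_ (fun j => ?_) i
            · rw [finSuccEquiv_X_zero, Polynomial.eval₂_X]
              rfl
            · rw [finSuccEquiv_X_succ, Polynomial.eval₂_C, Matrix.cons_val_succ]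
              exact aeval_X _ _
        exact DFunLike.congr_fun key R)
    refine dvd_of_dvd_aeval hprime hε hcε (uniqueAlgEquiv k (Fin 1) q)
      ((map_ne_zero_iff _ (uniqueAlgEquiv k (Fin 1)).injective).2 hq) ?_
    have key : (Polynomial.aeval c).comp (uniqueAlgEquiv k (Fin 1)).toAlgHom =
        aeval (R := k) ![c] := by
      refine MvPolynomial.algHom_ext fun i => ?_
      fin_cases i
      simp
    have := DFunLike.congr_fun key q
    rw [AlgHom.comp_apply] at this
    exact this ▸ hqd
  refine ⟨h, hh, h0, hε, fun c hc => ?_⟩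
  induction hn : c.totalDegree using Nat.strong_induction_on generalizing c with
  | _ n ih =>
    have hc' : c - C (constantCoeff c) ∈ P.kernel := sub_mem hc (P.N_C _)
    obtain ⟨e, he⟩ := hdvd _ hc' (by simp)
    by_cases hz : c - C (constantCoeff c) = 0
    · exact ⟨Polynomial.C (constantCoeff c), by rw [Polynomial.aeval_C, algebraMap_eq]; exact
        (sub_eq_zero.1 hz).symm⟩
    rw [he] at hz hc'
    have hlt : e.totalDegree < n := by
      have h1 := totalDegree_mul_of_isDomain (left_ne_zero_of_mul hz) (right_ne_zero_of_mul hz)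
      have h2 := totalDegree_sub_C_le c (constantCoeff c)
      have := totalDegree_pos_of_constantCoeff h0 hε
      rw [he] at h2
      omega
    obtain ⟨q, hq⟩ := ih _ hlt e (P.mem_kernel_of_mul hc' hz).2 rfl
    refine ⟨q * Polynomial.X + Polynomial.C (constantCoeff c), ?_⟩
    rw [map_add, _root_.map_mul, hq, Polynomial.aeval_X, Polynomial.aeval_C, algebraMap_eq]
    linear_combination -he

lemma biEval_injective (hs : P.N s = 1) {h : MvPolynomial (Fin 2) k} (hh : h ∈ P.kernel)
    (h0 : h ≠ 0) (hε : constantCoeff h = 0) : Function.Injective (biEval h s) := by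
  refine (injective_iff_map_eq_zero _).2 fun Q hQ => ?_
  by_contra hne
  have hinj : Function.Injective (Polynomial.aeval (R := k) h).toRingHom :=
    (injective_iff_map_eq_zero _).2 (aeval_injective_of_constantCoeff hε h0)
  refine (P.N_eval hs (Q.map (Polynomial.aeval h).toRingHom) (fun i => ?_)
    ((Polynomial.map_ne_zero_iff hinj).2 hne)).1 ?_
  · rw [Polynomial.coeff_map]
    exact Algebra.adjoin_le (Set.singleton_subset_iff.2 hh)
      (Polynomial.aeval_mem_adjoin_singleton k h)
  · rw [Polynomial.eval_map]
    exact hQ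

lemma N_biEval (hs : P.N s = 1) {h : MvPolynomial (Fin 2) k} (hh : h ∈ P.kernel)
    (h0 : h ≠ 0) (hε : constantCoeff h = 0) (Q : Polynomial (Polynomial k)) :
    P.N (biEval h s Q) = Q.natDegree := by
  by_cases hne : Q = 0
  · rw [hne, map_zero, P.N_zero, Polynomial.natDegree_zero]
  have hinj : Function.Injective (Polynomial.aeval (R := k) h).toRingHom :=
    (injective_iff_map_eq_zero _).2 (aeval_injective_of_constantCoeff hε h0)
  have := (P.N_eval hs (Q.map (Polynomial.aeval h).toRingHom) (fun i => by
    rw [Polynomial.coeff_map]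
    exact Algebra.adjoin_le (Set.singleton_subset_iff.2 hh)
      (Polynomial.aeval_mem_adjoin_singleton k h))
    ((Polynomial.map_ne_zero_iff hinj).2 hne)).2
  rw [Polynomial.eval_map, Polynomial.natDegree_map_eq_of_injective hinj] at this
  exact this

lemma exists_mul_eq_biEval (hs : P.N s = 1) {h : MvPolynomial (Fin 2) k}
    (hgen : ∀ c ∈ P.kernel, ∃ q : Polynomial k, Polynomial.aeval h q = c)
    (a : MvPolynomial (Fin 2) k) :
    ∃ π : Polynomial k, π ≠ 0 ∧ ∃ Q, Polynomial.aeval h π * a = biEval h s Q := by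
  obtain ⟨c, hc, hc0, hmem⟩ := P.exists_mul_mem_adjoin hs a
  obtain ⟨π, rfl⟩ := hgen c hc
  refine ⟨π, fun h => hc0 (by rw [h, map_zero]), ?_⟩
  suffices h' : ∀ b ∈ Algebra.adjoin k ((P.kernel : Set (MvPolynomial (Fin 2) k)) ∪ {s}),
      ∃ Q, b = biEval h s Q from h' _ hmem
  intro b hb
  induction hb using Algebra.adjoin_induction with
  | mem b hb =>
    rcases hb with hb | hb
    · obtain ⟨q, rfl⟩ := hgen b hb
      exact ⟨Polynomial.C q, (biEval_C h s q).symm⟩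
    · exact ⟨Polynomial.X, by rw [biEval_X]; exact hb⟩
  | algebraMap a => exact ⟨Polynomial.C (Polynomial.C a), by
      rw [biEval_C, Polynomial.aeval_C]⟩
  | add a b _ _ ha hb =>
    obtain ⟨p, rfl⟩ := ha
    obtain ⟨q, rfl⟩ := hb
    exact ⟨p + q, (map_add _ _ _).symm⟩
  | mul a b _ _ ha hb =>
    obtain ⟨p, rfl⟩ := ha
    obtain ⟨q, rfl⟩ := hb
    exact ⟨p * q, (_root_.map_mul _ _ _).symm⟩

end PlaneDegree

end Plane

section Slice

variable {k K σ : Type} [Field k] [Field K] [Algebra k K]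

/-- Apply a linear functional to every coefficient of a polynomial. -/
def slice (τ : K →ₗ[k] k) (v : MvPolynomial σ K) : MvPolynomial σ k :=
  ∑ d ∈ v.support, monomial d (τ (coeff d v))

lemma coeff_slice (τ : K →ₗ[k] k) (v : MvPolynomial σ K) (d : σ →₀ ℕ) :
    coeff d (slice τ v) = τ (coeff d v) := by
  classical
  rw [slice, coeff_sum]
  simp only [coeff_monomial, Finset.sum_ite_eq']
  split_ifs with h
  · rfl
  · rw [notMem_support_iff.1 h, map_zero]

lemma slice_add (τ : K →ₗ[k] k) (v w : MvPolynomial σ K) :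
    slice τ (v + w) = slice τ v + slice τ w := by
  ext d
  simp [coeff_slice]

lemma slice_sub (τ : K →ₗ[k] k) (v w : MvPolynomial σ K) :
    slice τ (v - w) = slice τ v - slice τ w := by
  ext d
  simp [coeff_slice]

lemma slice_map_mul (τ : K →ₗ[k] k) (u : MvPolynomial σ k) (v : MvPolynomial σ K) :
    slice τ (map (algebraMap k K) u * v) = u * slice τ v := by
  classical
  ext d
  rw [coeff_slice, coeff_mul, coeff_mul, map_sum]
  refine Finset.sum_congr rfl fun x _ => ?_
  rw [coeff_map, coeff_slice, ← Algebra.smul_def, map_smul, smul_eq_mul]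

lemma slice_C (τ : K →ₗ[k] k) (a : K) : slice τ (C a : MvPolynomial σ K) = C (τ a) := by
  classical
  ext d
  rw [coeff_slice, coeff_C, coeff_C]
  split_ifs <;> simp

lemma slice_C_mul (τ : K →ₗ[k] k) (a : K) (v : MvPolynomial σ K) :
    slice τ (C a * v) = slice (τ.comp (LinearMap.mulLeft k a)) v := by
  ext d
  simp [coeff_slice]

lemma slice_map (τ : K →ₗ[k] k) (u : MvPolynomial σ k) :
    slice τ (map (algebraMap k K) u) = C (τ 1) * u := by
  have := slice_map_mul τ u (C 1)
  rwa [slice_C, map_one, mul_one, mul_comm] at this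

lemma totalDegree_slice_le (τ : K →ₗ[k] k) (v : MvPolynomial σ K) :
    (slice τ v).totalDegree ≤ v.totalDegree := by
  refine Finset.sup_mono fun d hd => ?_
  rw [mem_support_iff, coeff_slice] at hd
  rw [mem_support_iff]
  exact fun h => hd (by rw [h, map_zero])

end Slice

section PlaneExtension

variable {k K : Type} [Field k] [Field K] [Algebra k K]

lemma map_aeval_eq (h : MvPolynomial (Fin 2) k) (q : Polynomial k) :
    map (algebraMap k K) (Polynomial.aeval h q) =
      Polynomial.aeval (map (algebraMap k K) h) (q.map (algebraMap k K)) := by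
  rw [Polynomial.aeval_def, Polynomial.hom_eval₂, Polynomial.aeval_def, Polynomial.eval₂_map]
  congr 1
  ext a
  simp [algebraMap_eq]

lemma map_biEval (h s : MvPolynomial (Fin 2) k) (Q : Polynomial (Polynomial k)) :
    map (algebraMap k K) (biEval h s Q) =
      biEval (map (algebraMap k K) h) (map (algebraMap k K) s)
        (Q.map (Polynomial.mapRingHom (algebraMap k K))) := by
  induction Q using Polynomial.induction_on' with
  | add p q hp hq => rw [map_add, map_add, hp, hq, Polynomial.map_add, map_add]
  | monomial n q =>
    rw [← Polynomial.C_mul_X_pow_eq_monomial, map_mul, map_pow, biEval_C, biEval_X, map_mul,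
      map_pow, map_aeval_eq, Polynomial.map_mul, Polynomial.map_pow, Polynomial.map_C,
      Polynomial.map_X, map_mul, map_pow, biEval_C, biEval_X, Polynomial.coe_mapRingHom]

lemma exists_slice_biEval (τ : K →ₗ[k] k) (h s : MvPolynomial (Fin 2) k)
    (Q : Polynomial (Polynomial K)) : ∃ Q' : Polynomial (Polynomial k),
      (∀ j i, (Q'.coeff j).coeff i = τ ((Q.coeff j).coeff i)) ∧
      slice τ (biEval (map (algebraMap k K) h) (map (algebraMap k K) s) Q) = biEval h s Q' := by
  induction Q using Polynomial.induction_on' with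
  | add p q hp hq =>
    obtain ⟨p', hp1, hp2⟩ := hp
    obtain ⟨q', hq1, hq2⟩ := hq
    exact ⟨p' + q', fun j i => by simp [hp1, hq1], by
      rw [map_add, slice_add, hp2, hq2, map_add]⟩
  | monomial n q =>
    induction q using Polynomial.induction_on' with
    | add p q hp hq =>
      obtain ⟨p', hp1, hp2⟩ := hp
      obtain ⟨q', hq1, hq2⟩ := hq
      refine ⟨p' + q', fun j i => ?_, ?_⟩
      · rw [map_add, Polynomial.coeff_add, Polynomial.coeff_add, Polynomial.coeff_add,
          Polynomial.coeff_add, map_add, hp1, hq1]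
      · rw [map_add (Polynomial.monomial n), map_add, slice_add, hp2, hq2, map_add]
    | monomial i a =>
      refine ⟨Polynomial.monomial n (Polynomial.monomial i (τ a)), fun j l => ?_, ?_⟩
      · rw [Polynomial.coeff_monomial, Polynomial.coeff_monomial]
        split_ifs
        · rw [Polynomial.coeff_monomial, Polynomial.coeff_monomial]
          split_ifs <;> simp
        · simp
      · simp only [← Polynomial.C_mul_X_pow_eq_monomial, map_mul, map_pow, biEval_C, biEval_X,
          Polynomial.aeval_C, Polynomial.aeval_X, algebraMap_eq]
        rw [mul_assoc, ← map_pow, ← map_pow, ← map_mul, mul_comm, slice_map_mul, slice_C]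
        ring

lemma biEval_map_injective {h s : MvPolynomial (Fin 2) k}
    (hinj : Function.Injective (biEval h s)) :
    Function.Injective (biEval (map (algebraMap k K) h) (map (algebraMap k K) s)) := by
  refine (injective_iff_map_eq_zero _).2 fun Q hQ => ?_
  ext j i
  rw [Polynomial.coeff_zero, Polynomial.coeff_zero]
  refine (Module.forall_dual_apply_eq_zero_iff k _).1 fun τ => ?_
  obtain ⟨Q', h1, h2⟩ := exists_slice_biEval τ h s Q
  have h0 : slice τ (0 : MvPolynomial (Fin 2) K) = 0 := by
    have := slice_C (σ := Fin 2) τ 0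
    rwa [map_zero, map_zero, map_zero] at this
  rw [hQ, h0] at h2
  have := hinj (h2.symm.trans (map_zero _).symm)
  rw [← h1, this, Polynomial.coeff_zero, Polynomial.coeff_zero]

lemma exists_mul_eq_biEval_map {h s : MvPolynomial (Fin 2) k}
    (hden : ∀ a, ∃ π : Polynomial k, π ≠ 0 ∧ ∃ Q, Polynomial.aeval h π * a = biEval h s Q)
    (a : MvPolynomial (Fin 2) K) :
    ∃ π : Polynomial K, π ≠ 0 ∧ ∃ Q, Polynomial.aeval (map (algebraMap k K) h) π * a =
      biEval (map (algebraMap k K) h) (map (algebraMap k K) s) Q := by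
  induction a using MvPolynomial.induction_on with
  | C a =>
    refine ⟨1, one_ne_zero, Polynomial.C (Polynomial.C a), ?_⟩
    rw [map_one, one_mul, biEval_C, Polynomial.aeval_C, algebraMap_eq]
  | add p q hp hq =>
    obtain ⟨π, hπ, Q, hQ⟩ := hp
    obtain ⟨ρ, hρ, R, hR⟩ := hq
    refine ⟨π * ρ, mul_ne_zero hπ hρ, Polynomial.C ρ * Q + Polynomial.C π * R, ?_⟩
    rw [map_add, map_mul, map_mul, map_mul, biEval_C, biEval_C, ← hQ, ← hR]
    ring
  | mul_X p i hp =>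
    obtain ⟨π, hπ, Q, hQ⟩ := hp
    obtain ⟨ρ, hρ, R, hR⟩ := hden (X i)
    refine ⟨π * ρ.map (algebraMap k K), mul_ne_zero hπ
      ((Polynomial.map_ne_zero_iff (algebraMap k K).injective).2 hρ),
      Q * R.map (Polynomial.mapRingHom (algebraMap k K)), ?_⟩
    rw [map_mul, map_mul, ← hQ, ← map_biEval, ← hR, map_mul, map_X, map_aeval_eq]
    ring

lemma eq_C_of_isUnit {σ : Type} {v : MvPolynomial σ k} (hv : IsUnit v) : ∃ a, a ≠ 0 ∧ v = C a := by
  obtain ⟨w, hw⟩ := hv.exists_right_inv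
  have h0 : v * w ≠ 0 := hw ▸ one_ne_zero
  have := totalDegree_mul_of_isDomain (left_ne_zero_of_mul h0) (right_ne_zero_of_mul h0)
  rw [hw, totalDegree_one] at this
  have hv' := totalDegree_eq_zero_iff_eq_C.1 (show v.totalDegree = 0 by omega)
  exact ⟨_, fun h => hv.ne_zero (by rw [hv', h, map_zero]), hv'⟩

lemma exists_aeval_eq_of_mul {h : MvPolynomial (Fin 2) k} (h0 : h ≠ 0)
    (hε : constantCoeff h = 0) {c d : Polynomial k} (hc : c ≠ 0) {v : MvPolynomial (Fin 2) k}
    (hv : Polynomial.aeval h c * v = Polynomial.aeval h d) :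
    ∃ q : Polynomial k, v = Polynomial.aeval h q := by
  classical
  have hinj := aeval_injective_of_constantCoeff hε h0
  obtain ⟨c', d', hc', hd', hu⟩ := extract_gcd c d
  have hcop := (gcd_isUnit_iff c' d').1 hu
  have hg : Polynomial.aeval h (gcd c d) ≠ 0 := fun hz =>
    hc (by rw [hc', hinj _ hz, zero_mul])
  have hv' : Polynomial.aeval h c' * v = Polynomial.aeval h d' := by
    refine mul_left_cancel₀ hg ?_
    rw [← mul_assoc, ← map_mul, ← map_mul, ← hc', ← hd', hv]
  obtain ⟨a, b, hab⟩ := hcop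
  have hu : IsUnit (Polynomial.aeval h c') := by
    refine IsUnit.of_mul_eq_one (Polynomial.aeval h a + Polynomial.aeval h b * v) ?_
    have := congrArg (Polynomial.aeval h) hab
    rw [map_add, map_mul, map_mul, map_one] at this
    linear_combination this + Polynomial.aeval h b * hv'
  obtain ⟨a, ha, hca⟩ := eq_C_of_isUnit hu
  refine ⟨Polynomial.C a⁻¹ * d', ?_⟩
  rw [map_mul, ← hv', hca, Polynomial.aeval_C, algebraMap_eq, ← mul_assoc, ← map_mul,
    inv_mul_cancel₀ ha, map_one, one_mul]

lemma prime_sub_C {h s : MvPolynomial (Fin 2) k} (h0 : h ≠ 0) (hε : constantCoeff h = 0)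
    (hinj : Function.Injective (biEval h s))
    (hden : ∀ a, ∃ π : Polynomial k, π ≠ 0 ∧ ∃ Q, Polynomial.aeval h π * a = biEval h s Q)
    (c : k) : Prime (h - C c) := by
  refine Irreducible.prime ⟨fun hu => ?_, fun a b hab => ?_⟩
  · obtain ⟨a, -, ha⟩ := eq_C_of_isUnit hu
    have h1 : h = C (a + c) := by rw [map_add, ← ha, sub_add_cancel]
    rw [h1, constantCoeff_C] at hε
    exact h0 (by rw [h1, hε, map_zero])
  · obtain ⟨π, hπ, Q, hQ⟩ := hden a
    obtain ⟨ρ, hρ, R, hR⟩ := hden b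
    have hQR : Q * R = Polynomial.C (π * ρ * (Polynomial.X - Polynomial.C c)) := by
      refine hinj ?_
      rw [map_mul, ← hQ, ← hR, biEval_C, map_mul, map_mul, map_sub, Polynomial.aeval_X,
        Polynomial.aeval_C, algebraMap_eq, hab]
      ring
    have hne : Q * R ≠ 0 := by
      rw [hQR, Ne, Polynomial.C_eq_zero]
      exact mul_ne_zero (mul_ne_zero hπ hρ) (Polynomial.X_sub_C_ne_zero c)
    have hdeg := Polynomial.natDegree_mul (left_ne_zero_of_mul hne) (right_ne_zero_of_mul hne)
    rw [hQR, Polynomial.natDegree_C] at hdeg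
    rw [Polynomial.eq_C_of_natDegree_eq_zero (show Q.natDegree = 0 by omega), biEval_C] at hQ
    rw [Polynomial.eq_C_of_natDegree_eq_zero (show R.natDegree = 0 by omega), biEval_C] at hR
    obtain ⟨p, rfl⟩ := exists_aeval_eq_of_mul h0 hε hπ hQ
    obtain ⟨q, rfl⟩ := exists_aeval_eq_of_mul h0 hε hρ hR
    have hpq : Polynomial.X - Polynomial.C c = p * q := by
      rw [← sub_eq_zero]
      refine aeval_injective_of_constantCoeff hε h0 _ ?_
      rw [map_sub, map_sub, map_mul, Polynomial.aeval_X, Polynomial.aeval_C, algebraMap_eq, hab,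
        sub_self]
    exact ((Polynomial.irreducible_X_sub_C c).isUnit_or_isUnit hpq).imp
      (fun h => h.map _) (fun h => h.map _)

lemma exists_dvd_sub_C [IsAlgClosed k] {s q : MvPolynomial (Fin 2) k} (hq : Prime q)
    (p : Polynomial k) (hp : p ≠ 0) (hd : q ∣ Polynomial.aeval s p) : ∃ c, q ∣ s - C c := by
  induction hn : p.natDegree using Nat.strong_induction_on generalizing p with
  | _ n ih =>
    by_cases h0 : p.natDegree = 0
    · rw [Polynomial.eq_C_of_natDegree_eq_zero h0] at hd hp
      rw [Polynomial.aeval_C] at hd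
      exact absurd (isUnit_of_dvd_unit hd
        ((isUnit_iff_ne_zero.2 fun h => hp (by rw [h, map_zero])).map _)) hq.not_isUnit
    · obtain ⟨c, hc⟩ := IsAlgClosed.exists_root p
        fun h => h0 (Polynomial.natDegree_eq_of_degree_eq_some h)
      obtain ⟨p, rfl⟩ := Polynomial.dvd_iff_isRoot.2 hc
      have hp' := right_ne_zero_of_mul hp
      rw [Polynomial.natDegree_mul (Polynomial.X_sub_C_ne_zero c) hp',
        Polynomial.natDegree_X_sub_C] at hn
      rw [map_mul, map_sub, Polynomial.aeval_X, Polynomial.aeval_C, algebraMap_eq] at hd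
      exact (hq.dvd_or_dvd hd).elim (fun h => ⟨c, h⟩)
        fun h => ih _ (by omega) p hp' h rfl

end PlaneExtension

section Plane

variable {k : Type} [Field k]

lemma dvd_aeval_map_eval {K : Type} [Field K] [Algebra k K] (h s p : MvPolynomial (Fin 2) k)
    (q : Polynomial k) (c : K) (hc : Polynomial.aeval c q = 0) (Q : Polynomial (Polynomial k))
    (hp : Polynomial.aeval h q * p = biEval h s Q) :
    map (algebraMap k K) h - C c ∣ Polynomial.aeval (map (algebraMap k K) s)
      (Q.map (Polynomial.aeval (R := k) c).toRingHom) := by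
  set φ := Ideal.Quotient.mk (Ideal.span {map (algebraMap k K) h - C c}) with hφ
  have hz : ∀ v, φ v = 0 ↔ map (algebraMap k K) h - C c ∣ v := fun v => by
    rw [hφ, Ideal.Quotient.eq_zero_iff_mem, Ideal.mem_span_singleton]
  have hh : φ (map (algebraMap k K) h) = φ (C c) := by
    rw [← sub_eq_zero, ← map_sub, hz]
  have key : (φ.comp (map (algebraMap k K))).comp (biEval h s) =
      (φ.comp (Polynomial.aeval (map (algebraMap k K) s)).toRingHom).comp
        (Polynomial.mapRingHom (Polynomial.aeval (R := k) c).toRingHom) := by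
    refine Polynomial.ringHom_ext' (Polynomial.ringHom_ext' ?_ ?_) ?_
    · ext a
      change φ (map _ (biEval h s _)) = φ (Polynomial.aeval _ _)
      simp [biEval_C, algebraMap_eq]
    · change φ (map _ (biEval h s _)) = φ (Polynomial.aeval _ _)
      simp [biEval_C, algebraMap_eq, hh]
    · change φ (map _ (biEval h s _)) = φ (Polynomial.aeval _ _)
      simp [biEval_X]
  have := DFunLike.congr_fun key Q
  rw [RingHom.comp_apply, RingHom.comp_apply, ← hp, map_mul, map_mul, map_aeval_eq] at this
  rw [← hz]
  refine Eq.trans this.symm ?_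
  obtain ⟨q', hq'⟩ := Polynomial.dvd_iff_isRoot.2 (show (q.map (algebraMap k K)).IsRoot c by
    rwa [Polynomial.IsRoot, Polynomial.eval_map_algebraMap])
  rw [hq', map_mul, map_sub, Polynomial.aeval_X, Polynomial.aeval_C, algebraMap_eq, map_mul,
    map_sub, hh, sub_self, zero_mul, zero_mul]

namespace PlaneDegree

variable (P : PlaneDegree k)

lemma N_slice_le {K : Type} [Field K] [Algebra k K] {h s : MvPolynomial (Fin 2) k}
    (hs : P.N s = 1) (hh : h ∈ P.kernel) (h0 : h ≠ 0) (hε : constantCoeff h = 0)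
    {q : Polynomial k} (hq : q ≠ 0) {c d : K} (hc : Polynomial.aeval c q = 0)
    {v : MvPolynomial (Fin 2) K}
    (hv : map (algebraMap k K) s - C d = (map (algebraMap k K) h - C c) * v) (τ : K →ₗ[k] k) :
    P.N (slice τ v) ≤ 1 := by
  obtain ⟨q', hq'⟩ := Polynomial.dvd_iff_isRoot.2 (show (q.map (algebraMap k K)).IsRoot c by
    rwa [Polynomial.IsRoot, Polynomial.eval_map_algebraMap])
  have hmul : map (algebraMap k K) (Polynomial.aeval h q) * v =
      biEval (map (algebraMap k K) h) (map (algebraMap k K) s)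
        (Polynomial.C q' * (Polynomial.X - Polynomial.C (Polynomial.C d))) := by
    rw [map_aeval_eq, hq', map_mul, map_sub, Polynomial.aeval_X, Polynomial.aeval_C, map_mul,
      map_sub, biEval_C, biEval_C, biEval_X, Polynomial.aeval_C, algebraMap_eq, hv]
    ring
  obtain ⟨Q', h1, h2⟩ := exists_slice_biEval τ h s
    (Polynomial.C q' * (Polynomial.X - Polynomial.C (Polynomial.C d)))
  rw [← hmul, slice_map_mul] at h2
  have hdeg : Q'.natDegree ≤ 1 := by
    refine Polynomial.natDegree_le_iff_coeff_eq_zero.2 fun j hj => ?_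
    ext i
    have : (Polynomial.C q' * (Polynomial.X - Polynomial.C (Polynomial.C d))).coeff j = 0 := by
      refine Polynomial.coeff_eq_zero_of_natDegree_lt (lt_of_le_of_lt ?_ hj)
      refine (Polynomial.natDegree_C_mul_le _ _).trans ?_
      rw [Polynomial.natDegree_X_sub_C]
    rw [h1, this, Polynomial.coeff_zero, map_zero, Polynomial.coeff_zero]
  have hN := P.N_biEval hs hh h0 hε Q'
  rw [← h2] at hN
  by_cases hz : slice τ v = 0
  · rw [hz, P.N_zero]
    exact Nat.zero_le _
  · rw [P.N_mul (fun h' => hq (aeval_injective_of_constantCoeff hε h0 _ h')) hz] at hN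
    omega

/-- The degree-one element `s` of minimal total degree generates the plane together with `h`. -/
lemma exists_biEval_eq {h s : MvPolynomial (Fin 2) k}
    (hs : P.N s = 1) (hmin : ∀ v, P.N v = 1 → s.totalDegree ≤ v.totalDegree)
    (hh : h ∈ P.kernel) (h0 : h ≠ 0) (hε : constantCoeff h = 0)
    (hgen : ∀ c ∈ P.kernel, ∃ q : Polynomial k, Polynomial.aeval h q = c)
    (π : Polynomial k) (hπ : π ≠ 0) (p : MvPolynomial (Fin 2) k) (Q : Polynomial (Polynomial k))
    (hp : Polynomial.aeval h π * p = biEval h s Q) : ∃ Q', p = biEval h s Q' := by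
  classical
  induction hn : π.natDegree using Nat.strong_induction_on generalizing π p Q with
  | _ n ih =>
  by_cases hd : π.natDegree = 0
  · obtain ⟨a, ha⟩ := Polynomial.natDegree_eq_zero.1 hd
    have ha0 : a ≠ 0 := fun h => hπ (by rw [← ha, h, map_zero])
    refine ⟨Polynomial.C (Polynomial.C a⁻¹) * Q, ?_⟩
    rw [map_mul, ← hp, ← ha, biEval_C, ← mul_assoc, ← map_mul, ← map_mul, inv_mul_cancel₀ ha0,
      map_one, map_one, one_mul]
  let K := AlgebraicClosure k
  obtain ⟨c, hc⟩ := IsAlgClosed.exists_aeval_eq_zero K π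
    fun h => hd (Polynomial.natDegree_eq_of_degree_eq_some h)
  have hint : IsIntegral k c := Algebra.IsIntegral.isIntegral c
  have hq0 := minpoly.ne_zero hint
  have hqpos := minpoly.natDegree_pos hint
  have hqc := minpoly.aeval k c
  obtain ⟨π', rfl⟩ := minpoly.dvd k c hc
  set q := minpoly k c with hqdef
  rw [_root_.map_mul, mul_assoc] at hp
  by_cases hall : ∀ j, Polynomial.aeval c (Q.coeff j) = 0
  · obtain ⟨Q', rfl⟩ := (Polynomial.C_dvd_iff_dvd_coeff q Q).2 fun j => minpoly.dvd k c (hall j)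
    rw [_root_.map_mul, biEval_C] at hp
    have hq0' : Polynomial.aeval h q ≠ 0 :=
      fun h' => hq0 (aeval_injective_of_constantCoeff hε h0 _ h')
    have hπ' := right_ne_zero_of_mul hπ
    refine ih _ ?_ π' hπ' p Q' (mul_left_cancel₀ hq0' hp) rfl
    rw [Polynomial.natDegree_mul hq0 hπ'] at hn
    omega
  · exfalso
    have hdvd := dvd_aeval_map_eval h s _ q c hqc Q hp
    have hinjK : Function.Injective (map (σ := Fin 2) (algebraMap k K)) :=
      map_injective _ (algebraMap k K).injective
    have h0K : map (algebraMap k K) h ≠ 0 := (map_ne_zero_iff _ hinjK).2 h0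
    have hεK : constantCoeff (map (algebraMap k K) h) = 0 := by
      rw [constantCoeff_map, hε, map_zero]
    have hprime := prime_sub_C h0K hεK
      (biEval_map_injective (K := K) (P.biEval_injective hs hh h0 hε))
      (exists_mul_eq_biEval_map (P.exists_mul_eq_biEval hs hgen)) c
    obtain ⟨d, v, hv⟩ := exists_dvd_sub_C hprime _ (fun h' => hall fun j => by
      have := congrArg (fun q => q.coeff j) h'
      rw [Polynomial.coeff_map] at this
      exact this) hdvd
    have hlt : ∀ τ : K →ₗ[k] k, slice τ v ∈ P.kernel := fun τ => by
      rw [mem_kernel]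
      have hle := P.N_slice_le hs hh h0 hε hq0 hqc hv τ
      by_contra hne
      have h1 : P.N (slice τ v) = 1 := by omega
      have h2 := hmin _ h1
      have h3 := totalDegree_slice_le τ v
      have hv0 : v ≠ 0 := by
        rintro rfl
        have : slice τ (0 : MvPolynomial (Fin 2) K) = 0 := by
          have := slice_C (σ := Fin 2) τ 0
          rwa [map_zero, map_zero, map_zero] at this
        rw [this, P.N_zero] at h1
        omega
      have h4 := totalDegree_mul_of_isDomain hprime.ne_zero hv0
      rw [← hv] at h4
      have h5 : 0 < (map (algebraMap k K) h - C c).totalDegree := by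
        refine Nat.pos_of_ne_zero fun h' => ?_
        have := totalDegree_eq_zero_iff_eq_C.1 h'
        refine hprime.not_isUnit ?_
        have hne := hprime.ne_zero
        rw [this] at hne ⊢
        exact (isUnit_iff_ne_zero.2 fun h => hne (by rw [h, map_zero])).map C
      have h6 := totalDegree_sub_C_le (map (algebraMap k K) s) d
      have h7 : (map (algebraMap k K) s).totalDegree ≤ s.totalDegree :=
        Finset.sup_mono (support_map_subset (algebraMap k K) s)
      omega
    obtain ⟨τ, hτ⟩ := LinearMap.exists_leftInverse_of_injective (Algebra.linearMap k K)
      (LinearMap.ker_eq_bot.2 (algebraMap k K).injective)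
    have hτ1 : τ 1 = 1 := by
      have := DFunLike.congr_fun hτ 1
      simpa using this
    have hs' := congrArg (slice τ) hv
    rw [slice_sub, slice_map, slice_C, hτ1, map_one, one_mul, sub_mul, slice_sub, slice_map_mul,
      slice_C_mul, sub_eq_iff_eq_add] at hs'
    have : s ∈ P.kernel := by
      rw [hs']
      exact add_mem (sub_mem (mul_mem hh (hlt _)) (hlt _)) (P.N_C _)
    rw [mem_kernel, hs] at this
    omega

/-- Rentschler's theorem: a degree function arising from an exponential map is the degree in a
coordinate. -/
theorem exists_coordinates (hex : ∃ s, P.N s = 1) :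
    ∃ h s, Algebra.adjoin k {h, s} = ⊤ ∧
      ∀ a, P.N a ≤ 1 → ∃ p q : Polynomial k, a = Polynomial.aeval h p + Polynomial.aeval h q * s := by
  classical
  have hex' : ∃ n, ∃ s, P.N s = 1 ∧ s.totalDegree = n := by
    obtain ⟨s, hs⟩ := hex
    exact ⟨_, s, hs, rfl⟩
  obtain ⟨s, hs, hsd⟩ := Nat.find_spec hex'
  have hmin : ∀ v, P.N v = 1 → s.totalDegree ≤ v.totalDegree :=
    fun v hv => hsd ▸ Nat.find_min' hex' ⟨v, hv, rfl⟩
  obtain ⟨h, hh, h0, hε, hgen⟩ := P.exists_generator hs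
  have hsurj : ∀ p, ∃ Q, p = biEval h s Q := fun p => by
    obtain ⟨π, hπ, Q, hQ⟩ := P.exists_mul_eq_biEval hs hgen p
    exact P.exists_biEval_eq hs hmin hh h0 hε hgen π hπ p Q hQ
  refine ⟨h, s, eq_top_iff.2 fun p _ => ?_, fun a ha => ?_⟩
  · obtain ⟨Q, rfl⟩ := hsurj p
    exact biEval_mem_adjoin h s Q
  · obtain ⟨Q, rfl⟩ := hsurj a
    rw [P.N_biEval hs hh h0 hε] at ha
    refine ⟨Q.coeff 0, Q.coeff 1, ?_⟩
    conv_lhs => rw [Polynomial.eq_X_add_C_of_natDegree_le_one ha]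
    rw [map_add, _root_.map_mul, biEval_C, biEval_C, biEval_X, add_comm]

end PlaneDegree

/-- If the Derksen invariant of `A` is larger than `B`, then `f` has degree at most one in a
coordinate of the plane. -/
theorem exists_coordinates_of_derksen {m : ℕ} {r : Fin m → ℕ}
    {F : MvPolynomial (Fin m ⊕ Fin 2) k} (hm : 1 ≤ m) (hr : ∀ i, 1 < r i) (hf : fOf k m F ≠ 0)
    [IsDomain (RingA k m r F)] {g : MvPolynomial (Fin m ⊕ Fin 2) k}
    (hFg : F = rename Sum.inr (fOf k m F) + (∏ i, X (Sum.inl i)) * g)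
    (hD : ¬ Derksen k (RingA k m r F) ≤ BA k m r F) :
    ∃ h s, Algebra.adjoin k {h, s} = ⊤ ∧ ∃ p q : Polynomial k,
      fOf k m F = Polynomial.aeval h p + Polynomial.aeval h q * s := by
  obtain ⟨L⟩ := exists_leadingForm hm hf hFg hD
  obtain ⟨P, hP, hs⟩ := L.exists_planeDegree hf hr
  obtain ⟨h, s, htop, hall⟩ := P.exists_coordinates hs
  exact ⟨h, s, htop, hall _ hP⟩

end Plane

section Coordinate

variable {k : Type} [Field k]

/-- `f` is part of a system of coordinates of the affine plane. -/
def IsCoordinate (f : MvPolynomial (Fin 2) k) : Prop :=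
  ∃ s, Algebra.adjoin k {f, s} = ⊤

lemma IsCoordinate.map {f : MvPolynomial (Fin 2) k} (h : IsCoordinate f)
    (σ : MvPolynomial (Fin 2) k ≃ₐ[k] MvPolynomial (Fin 2) k) : IsCoordinate (σ f) := by
  obtain ⟨s, hs⟩ := h
  refine ⟨σ s, ?_⟩
  have := AlgHom.map_adjoin (σ : MvPolynomial (Fin 2) k →ₐ[k] MvPolynomial (Fin 2) k) {f, s}
  rw [hs, Algebra.map_top, Set.image_pair] at this
  exact this.symm.trans ((AlgHom.range_eq_top _).2 σ.surjective)

lemma exists_coordinateEquiv {h s : MvPolynomial (Fin 2) k}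
    (htop : Algebra.adjoin k {h, s} = ⊤) :
    ∃ σ : MvPolynomial (Fin 2) k ≃ₐ[k] MvPolynomial (Fin 2) k, σ (X 0) = h ∧ σ (X 1) = s := by
  have hr : Set.range ![h, s] = {h, s} := by simp [Set.pair_comm]
  have hsurj : Function.Surjective (aeval (R := k) ![h, s]) := by
    rw [← AlgHom.range_eq_top, ← Algebra.adjoin_range_eq_range_aeval, hr, htop]
  have : Algebra.IsAlgebraic (Algebra.adjoin k (Set.range ![h, s])) (MvPolynomial (Fin 2) k) := by
    refine ⟨fun a => ?_⟩
    have ha : a ∈ Algebra.adjoin k (Set.range ![h, s]) := by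
      rw [hr, htop]
      exact Algebra.mem_top
    exact isAlgebraic_algebraMap (⟨a, ha⟩ : Algebra.adjoin k (Set.range ![h, s]))
  have hbasis := Algebra.IsAlgebraic.isTranscendenceBasis_of_le_trdeg_of_finite k ![h, s] (by
    rw [MvPolynomial.trdeg_of_isDomain, Cardinal.lift_id])
  refine ⟨AlgEquiv.ofBijective (aeval ![h, s]) ⟨hbasis.1, hsurj⟩, ?_, ?_⟩ <;> simp

lemma isCoordinate_of_const {h s : MvPolynomial (Fin 2) k} (htop : Algebra.adjoin k {h, s} = ⊤)
    (p : Polynomial k) {c : k} (hc : c ≠ 0) :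
    IsCoordinate (Polynomial.aeval h p + Polynomial.aeval h (Polynomial.C c) * s) := by
  refine ⟨h, ?_⟩
  rw [eq_top_iff, ← htop, Algebra.adjoin_le_iff]
  set A := Algebra.adjoin k {Polynomial.aeval h p + Polynomial.aeval h (Polynomial.C c) * s, h}
  have hh : h ∈ A := Algebra.subset_adjoin (by simp)
  have hf : Polynomial.aeval h p + Polynomial.aeval h (Polynomial.C c) * s ∈ A :=
    Algebra.subset_adjoin (by simp)
  have hp : Polynomial.aeval h p ∈ A := Algebra.adjoin_le (Set.singleton_subset_iff.2 hh)
      (Polynomial.aeval_mem_adjoin_singleton k h)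
  rintro _ (rfl | rfl)
  · exact hh
  · have := A.smul_mem (sub_mem hf hp) c⁻¹
    rwa [add_sub_cancel_left, Polynomial.aeval_C, ← Algebra.smul_def, smul_smul,
      inv_mul_cancel₀ hc, one_smul] at this

lemma isCoordinate_of_smul_add {h s : MvPolynomial (Fin 2) k}
    (htop : Algebra.adjoin k {h, s} = ⊤) {f : MvPolynomial (Fin 2) k} {a b : k}
    (hf : h = C a * f + C b) : IsCoordinate f := by
  refine ⟨s, ?_⟩
  rw [eq_top_iff, ← htop, Algebra.adjoin_le_iff]
  rintro _ (rfl | rfl)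
  · rw [hf]
    exact add_mem (mul_mem (Subalgebra.algebraMap_mem _ a) (Algebra.subset_adjoin (by simp)))
      (Subalgebra.algebraMap_mem _ b)
  · exact Algebra.subset_adjoin (by simp)

lemma degreeOf_aeval_X (p : Polynomial k) :
    degreeOf 1 (Polynomial.aeval (X 0 : MvPolynomial (Fin 2) k) p) = 0 := by
  have h : Polynomial.aeval (X 0 : MvPolynomial (Fin 2) k) p ∈ supported k {(0 : Fin 2)} := by
    rw [supported_eq_adjoin_X, Set.image_singleton]
    exact Polynomial.aeval_mem_adjoin_singleton k _
  by_contra hne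
  have := mem_supported.1 h (mem_vars_iff_degreeOf_ne_zero.2 hne)
  simp at this

lemma aeval_X_injective {p : Polynomial k}
    (hp : Polynomial.aeval (X 0 : MvPolynomial (Fin 2) k) p = 0) : p = 0 :=
  aeval_injective_of_constantCoeff (by simp) (X_ne_zero 0) p hp

lemma degreeOf_aeval_add_ne_zero (p q : Polynomial k) (hq : q ≠ 0) :
    degreeOf 1 (Polynomial.aeval (X 0 : MvPolynomial (Fin 2) k) p
      + Polynomial.aeval (X 0) q * X 1) ≠ 0 := by
  intro h
  have hvars : ∀ q : Polynomial k, pderiv 1 (Polynomial.aeval (X 0 : MvPolynomial (Fin 2) k) q) = 0 :=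
    fun q => pderiv_eq_zero_of_notMem_vars
      fun h => mem_vars_iff_degreeOf_ne_zero.1 h (degreeOf_aeval_X q)
  have := pderiv_eq_zero_of_notMem_vars (R := k)
    fun h' => mem_vars_iff_degreeOf_ne_zero.1 h' h
  rw [map_add, hvars, Derivation.leibniz, hvars, pderiv_X_self, smul_zero, add_zero, zero_add,
    smul_eq_mul, mul_one] at this
  exact hq (aeval_X_injective this)

lemma isUnit_of_mul_eq_X_sub_C {a b : MvPolynomial (Fin 2) k} {c : k} (hab : a * b = X 0 - C c)
    (ha : ¬ IsUnit a) : IsUnit b := by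
  have h0 : a * b ≠ 0 := by
    rw [hab]
    intro h
    have := congrArg (pderiv 0) h
    simp at this
  have ha0 := left_ne_zero_of_mul h0
  have hb0 := right_ne_zero_of_mul h0
  have hdeg := totalDegree_mul_of_isDomain ha0 hb0
  have h1 := totalDegree_sub_C_le (X 0 : MvPolynomial (Fin 2) k) c
  rw [totalDegree_X, ← hab, hdeg] at h1
  have hunit : ∀ v : MvPolynomial (Fin 2) k, v ≠ 0 → v.totalDegree = 0 → IsUnit v := by
    intro v hv hd
    have := totalDegree_eq_zero_iff_eq_C.1 hd
    rw [this] at hv ⊢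
    exact (isUnit_iff_ne_zero.2 fun h => hv (by rw [h, map_zero])).map C
  have : a.totalDegree ≠ 0 := fun h => ha (hunit a ha0 h)
  exact hunit b hb0 (by omega)

lemma exists_eq_C_of_algebraic {κ τ : Type} [Field κ] {v : MvPolynomial τ κ} {p : Polynomial κ}
    (hp : p ≠ 0) (hv : Polynomial.aeval v p = 0) : ∃ c, v = C c := by
  refine ⟨constantCoeff v, ?_⟩
  by_contra hne
  refine hp ?_
  have := aeval_injective_of_constantCoeff (h := v - C (constantCoeff v)) (by simp)
    (sub_ne_zero.2 hne) (p.comp (Polynomial.X + Polynomial.C (constantCoeff v))) (by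
      rw [Polynomial.aeval_comp, map_add, Polynomial.aeval_X, Polynomial.aeval_C, algebraMap_eq,
        sub_add_cancel, hv])
  have h2 := congrArg (fun q => q.comp (Polynomial.X - Polynomial.C (constantCoeff v))) this
  simpa [Polynomial.comp_assoc] using h2

/-- A polynomial of degree at most one in a coordinate, whose zero locus is an affine-space-like
domain, is a coordinate. -/
theorem isCoordinate_of_embedding {f : MvPolynomial (Fin 2) k} (hf0 : f ≠ 0) (p q : Polynomial k)
    (hf : f = Polynomial.aeval (X 0) p + Polynomial.aeval (X 0) q * X 1)
    {κ τ : Type} [Field κ] [Algebra k κ] (hκ : Function.Surjective (algebraMap k κ))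
    (φ : MvPolynomial (Fin 2) k →ₐ[k] MvPolynomial τ κ) (hφ : ∀ w, φ w = 0 ↔ f ∣ w) :
    IsCoordinate f := by
  classical
  have htop : Algebra.adjoin k {(X 0 : MvPolynomial (Fin 2) k), X 1} = ⊤ := by
    rw [← MvPolynomial.adjoin_range_X]
    congr 1
    ext v
    simp [Fin.exists_fin_two, eq_comm]
  have hnu : ¬ IsUnit f := fun hu => by
    have := (hφ 1).2 hu.dvd
    rw [map_one] at this
    exact one_ne_zero this
  have hprime : Prime f := ⟨hf0, hnu, fun a b hab => by
    rw [← hφ, map_mul, mul_eq_zero, hφ, hφ] at hab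
    exact hab⟩
  have hconst : ∀ w : MvPolynomial (Fin 2) k, (∃ c, φ w = C c) → ∃ c, f ∣ w - C c := by
    rintro w ⟨c, hc⟩
    obtain ⟨a, rfl⟩ := hκ c
    refine ⟨a, (hφ _).1 ?_⟩
    rw [map_sub, hc, sub_eq_zero]
    exact (φ.commutes a).symm
  by_cases hq : q = 0
  · rw [hq, map_zero, zero_mul, add_zero] at hf
    have hp : p ≠ 0 := by
      rintro rfl
      exact hf0 (by rw [hf, map_zero])
    obtain ⟨c, w, hw⟩ := hconst (X 0) (exists_eq_C_of_algebraic
      ((Polynomial.map_ne_zero_iff (algebraMap k κ).injective).2 hp) (by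
        rw [Polynomial.aeval_map_algebraMap, Polynomial.aeval_algHom_apply, ← hf, hφ]))
    obtain ⟨a, -, rfl⟩ := eq_C_of_isUnit (isUnit_of_mul_eq_X_sub_C hw.symm hnu)
    exact isCoordinate_of_smul_add htop (a := a) (b := c) (by linear_combination hw)
  · obtain ⟨p', q', hp', hq', hu⟩ := extract_gcd p q
    have hcop := (gcd_isUnit_iff p' q').1 hu
    have hq'0 : q' ≠ 0 := by
      rintro rfl
      exact hq (by rw [hq', mul_zero])
    have hfac : f = Polynomial.aeval (X 0) (gcd p q) *
        (Polynomial.aeval (X 0) p' + Polynomial.aeval (X 0) q' * X 1) := by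
      have e1 := congrArg (Polynomial.aeval (X 0 : MvPolynomial (Fin 2) k)) hp'
      have e2 := congrArg (Polynomial.aeval (X 0 : MvPolynomial (Fin 2) k)) hq'
      rw [map_mul] at e1 e2
      linear_combination hf + e1 + X 1 * e2
    obtain ⟨d, hd⟩ : IsUnit (Polynomial.aeval (X 0 : MvPolynomial (Fin 2) k) (gcd p q)) := by
      refine (hprime.irreducible.isUnit_or_isUnit hfac).resolve_right fun hu => ?_
      obtain ⟨c, -, hc⟩ := eq_C_of_isUnit hu
      exact degreeOf_aeval_add_ne_zero p' q' hq'0 (by rw [hc, degreeOf_C])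
    obtain ⟨a, b, hab⟩ := hcop
    have hunit : IsUnit (φ (Polynomial.aeval (X 0) q)) := by
      have hφd : IsUnit (φ (Polynomial.aeval (X 0) (gcd p q))) := by
        rw [← hd]
        exact d.isUnit.map φ
      have hz : φ (Polynomial.aeval (X 0) p' + Polynomial.aeval (X 0) q' * X 1) = 0 := by
        have := (hφ f).2 dvd_rfl
        rw [hfac, map_mul] at this
        exact (mul_eq_zero.1 this).resolve_left hφd.ne_zero
      rw [hq', map_mul, map_mul]
      refine hφd.mul (IsUnit.of_mul_eq_one
        (φ (Polynomial.aeval (X 0) b - Polynomial.aeval (X 0) a * X 1)) ?_)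
      have h1 := congrArg (fun p => φ (Polynomial.aeval (X 0) p)) hab
      simp only [map_add, map_mul, map_one, map_sub] at h1 hz ⊢
      linear_combination h1 - φ (Polynomial.aeval (X 0) a) * hz
    obtain ⟨c, -, hc⟩ := eq_C_of_isUnit hunit
    obtain ⟨c, w, hw⟩ := hconst _ ⟨c, hc⟩
    rw [← algebraMap_eq, ← Polynomial.aeval_C (X 0 : MvPolynomial (Fin 2) k), ← map_sub] at hw
    have hqc : q = Polynomial.C c := by
      rw [← sub_eq_zero]
      refine aeval_X_injective ?_
      by_contra hne
      have hdeg := degreeOf_aeval_X (q - Polynomial.C c)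
      rw [hw] at hne hdeg
      rw [degreeOf_mul_eq hf0 (right_ne_zero_of_mul hne)] at hdeg
      exact degreeOf_aeval_add_ne_zero p q hq (hf ▸ by omega)
    rw [hf, hqc]
    exact isCoordinate_of_const htop p fun h => hq (by rw [hqc, h, map_zero])

end Coordinate

section Trivialization

variable {k : Type} [Field k] {m : ℕ} {r : Fin m → ℕ} {F : MvPolynomial (Fin m ⊕ Fin 2) k}
  {S S' : Type} [CommRing S] [Algebra k S] [CommRing S'] [Algebra k S']
  (σ : MvPolynomial (Fin 2) k ≃ₐ[k] MvPolynomial (Fin 2) k)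
  (g : MvPolynomial (Fin m ⊕ Fin 2) k)

/-- The point of the plane whose coordinates in the system `σ (X 0), σ (X 1)` are `a, b`. -/
def coordPt (a b : S) (j : Fin 2) : S := aeval ![a, b] (σ.symm (X j))

lemma aeval_coordPt (a b : S) (w : MvPolynomial (Fin 2) k) :
    aeval (coordPt σ a b) w = aeval ![a, b] (σ.symm w) := by
  have : (aeval ![a, b]).comp σ.symm.toAlgHom = aeval (R := k) (coordPt σ a b) := by
    refine MvPolynomial.algHom_ext fun j => ?_
    rw [aeval_X]
    rfl
  rw [← this]
  rfl

lemma map_coordPt (ψ : S →ₐ[k] S') (a b : S) (j : Fin 2) :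
    ψ (coordPt σ a b j) = coordPt σ (ψ a) (ψ b) j := by
  rw [coordPt, coordPt, comp_aeval_apply]
  congr 2
  funext i
  fin_cases i <;> rfl

lemma map_aeval_coordPt (ψ : S →ₐ[k] S') (ξ : Fin m → S) (a b : S) :
    ψ (aeval (Sum.elim ξ (coordPt σ a b)) g) =
      aeval (Sum.elim (fun i => ψ (ξ i)) (coordPt σ (ψ a) (ψ b))) g := by
  rw [comp_aeval_apply]
  congr 2
  funext i
  rcases i with i | i
  · rfl
  · exact map_coordPt σ ψ a b i

lemma aeval_coordPt_sub_mem (I : Ideal S) (ξ : Fin m → S) {a a' : S} (h : a - a' ∈ I) (b : S) :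
    aeval (Sum.elim ξ (coordPt σ a b)) g - aeval (Sum.elim ξ (coordPt σ a' b)) g ∈ I := by
  have h' : Ideal.Quotient.mkₐ k I a = Ideal.Quotient.mkₐ k I a' := Ideal.Quotient.eq.2 h
  have key : Ideal.Quotient.mkₐ k I (aeval (Sum.elim ξ (coordPt σ a b)) g) =
      Ideal.Quotient.mkₐ k I (aeval (Sum.elim ξ (coordPt σ a' b)) g) := by
    rw [map_aeval_coordPt, map_aeval_coordPt, h']
  exact Ideal.Quotient.eq.1 key

/-- The successive approximations to the solution `a` of `a + ξ₁ ⋯ ξₘ g(ξ, a, b) = 0`. -/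
def approx (ξ : Fin m → S) (b : S) : ℕ → S
  | 0 => 0
  | n + 1 => - ((∏ i, ξ i) * aeval (Sum.elim ξ (coordPt σ (approx ξ b n) b)) g)

lemma map_approx (ψ : S →ₐ[k] S') (ξ : Fin m → S) (b : S) (n : ℕ) :
    ψ (approx σ g ξ b n) = approx σ g (fun i => ψ (ξ i)) (ψ b) n := by
  induction n with
  | zero => exact map_zero ψ
  | succ n ih =>
    rw [approx, approx, map_neg, map_mul, map_prod, map_aeval_coordPt, ih]

lemma approx_succ_sub_mem (ξ : Fin m → S) (b : S) (n : ℕ) :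
    approx σ g ξ b (n + 1) - approx σ g ξ b n ∈ Ideal.span {(∏ i, ξ i) ^ n} := by
  induction n with
  | zero => simp
  | succ n ih =>
    have := aeval_coordPt_sub_mem σ g _ ξ ih b
    rw [Ideal.mem_span_singleton] at this ⊢
    obtain ⟨c, hc⟩ := this
    refine ⟨-c, ?_⟩
    change -((∏ i, ξ i) * aeval (Sum.elim ξ (coordPt σ (approx σ g ξ b (n + 1)) b)) g) -
      -((∏ i, ξ i) * aeval (Sum.elim ξ (coordPt σ (approx σ g ξ b n) b)) g) = _
    rw [pow_succ']
    linear_combination (-∏ i, ξ i) * hc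

variable {σ g} {f : MvPolynomial (Fin 2) k}

lemma aeval_coordPt_eq (hσ : σ (X 0) = f)
    (hFg : F = rename Sum.inr f + (∏ i, X (Sum.inl i)) * g) (ξ : Fin m → S) (a b : S) :
    aeval (Sum.elim ξ (coordPt σ a b)) F =
      a + (∏ i, ξ i) * aeval (Sum.elim ξ (coordPt σ a b)) g := by
  have : σ.symm f = X 0 := by rw [← hσ, σ.symm_apply_apply]
  rw [hFg, map_add, map_mul, map_prod, aeval_rename, Sum.elim_comp_inr, aeval_coordPt, this,
    aeval_X]
  simp

lemma sub_approx_mem (hσ : σ (X 0) = f)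
    (hFg : F = rename Sum.inr f + (∏ i, X (Sum.inl i)) * g) {ξ : Fin m → S} {a b y : S}
    (hy : (∏ i, ξ i ^ r i) * y = aeval (Sum.elim ξ (coordPt σ a b)) F) (n : ℕ) :
    a - approx σ g ξ b n ∈ Ideal.span {(∏ i, ξ i) ^ n, ∏ i, ξ i ^ r i} := by
  induction n with
  | zero =>
    rw [pow_zero, Ideal.eq_top_of_isUnit_mem _ (Ideal.subset_span (Set.mem_insert _ _)) isUnit_one]
    trivial
  | succ n ih =>
    have := aeval_coordPt_sub_mem σ g _ ξ ih b
    rw [Ideal.mem_span_pair] at this ⊢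
    obtain ⟨c, d, hcd⟩ := this
    rw [aeval_coordPt_eq hσ hFg] at hy
    refine ⟨-c, y - (∏ i, ξ i) * d, ?_⟩
    rw [approx, pow_succ']
    linear_combination hy - (∏ i, ξ i) * hcd

lemma prod_pow_dvd (ξ : Fin m → S) (r : Fin m → ℕ) {n : ℕ} (hn : ∀ i, r i ≤ n) :
    ∏ i, ξ i ^ r i ∣ (∏ i, ξ i) ^ n := by
  rw [← Finset.prod_pow]
  exact Finset.prod_dvd_prod_of_dvd _ _ fun i _ => pow_dvd_pow _ (hn i)

/-- If `f` is a coordinate then `A` is a polynomial ring in two variables over `k[x₁, …, xₘ]`. -/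
theorem exists_trivialization [IsDomain (RingA k m r F)] (hf : IsCoordinate f)
    (hFg : F = rename Sum.inr f + (∏ i, X (Sum.inl i)) * g) :
    ∃ Θ : MvPolynomial (Fin m ⊕ Fin 2) k ≃ₐ[k] RingA k m r F,
      ∀ i, Θ (X (Sum.inl i)) = xA k m r F i := by
  obtain ⟨s, hs⟩ := hf
  obtain ⟨σ, hσ0, hσ1⟩ := exists_coordinateEquiv hs
  obtain ⟨n, hn⟩ : ∃ n, ∀ i, r i ≤ n := ⟨∑ i, r i, fun i => Finset.single_le_sum
    (fun _ _ => Nat.zero_le _) (Finset.mem_univ i)⟩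
  have hσf : σ.symm f = X 0 := by rw [← hσ0, σ.symm_apply_apply]
  have hσs : σ.symm s = X 1 := by rw [← hσ1, σ.symm_apply_apply]
  have hzt : coordPt σ (planeA k m r F f) (planeA k m r F s) = ztA k m r F := by
    funext j
    have h : ![planeA k m r F f, planeA k m r F s] = fun i => planeA k m r F (σ (X i)) := by
      funext i
      fin_cases i
      · exact congrArg (planeA k m r F) hσ0.symm
      · exact congrArg (planeA k m r F) hσ1.symm
    have h2 : aeval (R := k) (fun i => planeA k m r F (σ (X i))) =
        (planeA k m r F).comp σ.toAlgHom :=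
      MvPolynomial.algHom_ext fun i => by rw [aeval_X]; rfl
    rw [coordPt, h, h2]
    change planeA k m r F (σ (σ.symm (X j))) = _
    rw [σ.apply_symm_apply, planeA, aeval_X]
  have hyA : (∏ i, xA k m r F i ^ r i) * yA k m r F = aeval (Sum.elim (xA k m r F)
      (coordPt σ (planeA k m r F f) (planeA k m r F s))) F := by
    rw [hzt, prod_xA_mul_yA]
    rfl
  obtain ⟨v, hv⟩ : ∏ i, xA k m r F i ^ r i ∣ planeA k m r F f -
      approx σ g (xA k m r F) (planeA k m r F s) n := by
    obtain ⟨c, d, hcd⟩ := Ideal.mem_span_pair.1 (sub_approx_mem hσ0 hFg hyA n)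
    rw [← hcd]
    exact dvd_add ((prod_pow_dvd _ r hn).mul_left _) (dvd_mul_left _ _)
  set ξ : Fin m → MvPolynomial (Fin m ⊕ Fin 2) k := fun i => X (Sum.inl i) with hξ
  set T : MvPolynomial (Fin m ⊕ Fin 2) k := X (Sum.inr 0) with hT
  set a : MvPolynomial (Fin m ⊕ Fin 2) k :=
    approx σ g ξ T n + (∏ i, ξ i ^ r i) * X (Sum.inr 1) with ha
  obtain ⟨y, hy⟩ : ∏ i, ξ i ^ r i ∣ aeval (Sum.elim ξ (coordPt σ a T)) F := by
    have h1 := aeval_coordPt_sub_mem σ g (Ideal.span {∏ i, ξ i ^ r i}) ξ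
      (a := a) (a' := approx σ g ξ T n) (by
        rw [ha, add_sub_cancel_left]
        exact Ideal.mul_mem_right _ _ (Ideal.subset_span rfl)) T
    have h2 := (prod_pow_dvd ξ r hn).trans
      (Ideal.mem_span_singleton.1 (approx_succ_sub_mem σ g ξ T n))
    rw [Ideal.mem_span_singleton] at h1
    obtain ⟨c, hc⟩ := h1
    obtain ⟨d, hd⟩ := h2
    rw [approx] at hd
    refine ⟨X (Sum.inr 1) - d + (∏ i, ξ i) * c, ?_⟩
    rw [aeval_coordPt_eq hσ0 hFg]
    linear_combination ha - hd + (∏ i, ξ i) * hc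
  have hΞ := hy.symm
  let Ξ : RingA k m r F →ₐ[k] MvPolynomial (Fin m ⊕ Fin 2) k := liftA ξ y (coordPt σ a T) hΞ
  let Θ : MvPolynomial (Fin m ⊕ Fin 2) k →ₐ[k] RingA k m r F :=
    aeval (Sum.elim (xA k m r F) ![planeA k m r F s, v])
  have hne : (∏ i, ξ i ^ r i) ≠ 0 := Finset.prod_ne_zero_iff.2 fun i _ => pow_ne_zero _ (X_ne_zero _)
  have hΞx : ∀ i, Ξ (xA k m r F i) = ξ i := liftA_xA ξ y _ hΞ
  have hΞr : Ξ (∏ i, xA k m r F i ^ r i) = ∏ i, ξ i ^ r i := by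
    rw [map_prod]
    exact Finset.prod_congr rfl fun i _ => by rw [map_pow, hΞx]
  have hneA : (∏ i, xA k m r F i ^ r i) ≠ 0 := fun h => hne (by rw [← hΞr, h, map_zero])
  have hΘx : ∀ i, Θ (ξ i) = xA k m r F i := fun i => by simp [Θ, ξ]
  have hΘr : Θ (∏ i, ξ i ^ r i) = ∏ i, xA k m r F i ^ r i := by
    rw [map_prod]
    exact Finset.prod_congr rfl fun i _ => by rw [map_pow, hΘx]
  have hΘT : Θ T = planeA k m r F s := by simp [Θ, T]
  have hΘV : Θ (X (Sum.inr 1)) = v := by simp [Θ]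
  have hΘa : Θ a = planeA k m r F f := by
    rw [ha, map_add, map_mul, hΘr, hΘV, map_approx, hΘT, ← hv]
    simp only [hΘx]
    ring
  have hΞs : Ξ (planeA k m r F s) = T := by
    refine (liftA_planeA ξ y _ hΞ s).trans ?_
    rw [aeval_coordPt, hσs, aeval_X]
    rfl
  have hΞf : Ξ (planeA k m r F f) = a := by
    refine (liftA_planeA ξ y _ hΞ f).trans ?_
    rw [aeval_coordPt, hσf, aeval_X]
    rfl
  have hΞv : Ξ v = X (Sum.inr 1) := by
    refine mul_left_cancel₀ hne ?_
    have := congrArg Ξ hv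
    rw [map_mul, map_sub, hΞr, hΞf, map_approx, hΞs] at this
    simp only [hΞx] at this
    rw [← this, ha]
    ring
  refine ⟨AlgEquiv.ofAlgHom Θ Ξ ?_ ?_, hΘx⟩
  · have hw : ∀ j, Θ (Ξ (ztA k m r F j)) = ztA k m r F j := fun j => by
      rw [show Ξ (ztA k m r F j) = coordPt σ a T j from liftA_ztA ξ y _ hΞ j, map_coordPt, hΘa,
        hΘT, hzt]
    refine algHom_extA (fun i => ?_) ?_ hw
    · change Θ (Ξ _) = _
      rw [hΞx, hΘx]
      rfl
    · change Θ (Ξ _) = yA k m r F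
      rw [show Ξ (yA k m r F) = y from liftA_yA ξ y _ hΞ]
      refine mul_left_cancel₀ hneA ?_
      rw [hyA, ← hΘr, ← map_mul, hΞ, map_aeval_coordPt, hΘa, hΘT]
      simp only [hΘx]
  · refine MvPolynomial.algHom_ext ?_
    rintro (i | i)
    · exact (congrArg Ξ (hΘx i)).trans (hΞx i)
    · fin_cases i
      · exact (congrArg Ξ hΘT).trans hΞs
      · exact (congrArg Ξ hΘV).trans hΞv

end Trivialization

section Fibration

variable {k : Type} [Field k] {m : ℕ} {r : Fin m → ℕ} {F : MvPolynomial (Fin m ⊕ Fin 2) k}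

variable (k m r F) in
lemma polyA_injective : Function.Injective (polyA k m r F) := by
  rw [injective_iff_map_eq_zero]
  intro p hp
  let K := FractionRing (MvPolynomial (Fin m ⊕ Fin 2) k)
  let ν : MvPolynomial (Fin m ⊕ Fin 2) k →ₐ[k] K := IsScalarTower.toAlgHom k _ K
  have hν : Function.Injective ν := IsFractionRing.injective _ K
  have hne : ∏ i, ν (X (Sum.inl i)) ^ r i ≠ 0 := Finset.prod_ne_zero_iff.2 fun i _ =>
    pow_ne_zero _ ((map_ne_zero_iff ν hν).2 (X_ne_zero _))
  have hid : aeval (Sum.elim (fun i => ν (X (Sum.inl i))) fun j => ν (X (Sum.inr j))) = ν :=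
    MvPolynomial.algHom_ext fun i => by rcases i with i | i <;> simp
  have h : (∏ i, ν (X (Sum.inl i)) ^ r i) * (ν F / ∏ i, ν (X (Sum.inl i)) ^ r i) =
      aeval (Sum.elim (fun i => ν (X (Sum.inl i))) fun j => ν (X (Sum.inr j))) F := by
    rw [hid, mul_div_cancel₀ _ hne]
  have := liftA_polyA _ _ _ h p
  rw [hp, map_zero, hid] at this
  exact hν (by rw [← this, map_zero])

variable (k m r F) in
lemma exists_equiv_EA : ∃ e : MvPolynomial (Fin m) k ≃ₐ[k] ↥(EA k m r F),
    ∀ i, (e (X i) : RingA k m r F) = xA k m r F i := by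
  let ι : MvPolynomial (Fin m) k →ₐ[k] RingA k m r F := (polyA k m r F).comp (rename Sum.inl)
  have hι : Function.Injective ι :=
    (polyA_injective k m r F).comp (rename_injective _ Sum.inl_injective)
  have hιx : ∀ i, ι (X i) = xA k m r F i := fun i => by
    change polyA k m r F (rename _ (X i)) = _
    rw [rename_X, polyA, aeval_X, Sum.elim_inl]
  have hrange : ι.range = EA k m r F := by
    rw [EA, Algebra.adjoin_range_eq_range_aeval]
    congr 1
    exact MvPolynomial.algHom_ext fun i => by rw [hιx, aeval_X]
  exact ⟨(AlgEquiv.ofInjective ι hι).trans (Subalgebra.equivOfEq _ _ hrange), hιx⟩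

lemma isAnFibration_of_algEquiv {R D : Type} [CommRing R] [CommRing D] [Algebra R D] {n : ℕ}
    (e : MvPolynomial (Fin n) R ≃ₐ[R] D) : IsAnFibration R D n :=
  ⟨Algebra.FiniteType.equiv inferInstance e, Module.Flat.of_linearEquiv e.symm.toLinearEquiv,
    fun _ => ⟨(Algebra.TensorProduct.congr AlgEquiv.refl e.symm).trans
      (MvPolynomial.algebraTensorAlgEquiv R _)⟩⟩

/-- A trivialization of `A` makes it a polynomial ring over `k[x₁, …, xₘ]`. -/
theorem isAnFibration_of_trivialization (Θ : MvPolynomial (Fin m ⊕ Fin 2) k ≃ₐ[k] RingA k m r F)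
    (hΘ : ∀ i, Θ (X (Sum.inl i)) = xA k m r F i) :
    IsAnFibration ↥(EA k m r F) (RingA k m r F) 2 := by
  obtain ⟨e, he⟩ := exists_equiv_EA k m r F
  let Λ : MvPolynomial (Fin m ⊕ Fin 2) k ≃ₐ[k] MvPolynomial (Fin 2) ↥(EA k m r F) :=
    ((renameEquiv k (Equiv.sumComm _ _)).trans (sumAlgEquiv k _ _)).trans (mapAlgEquiv (Fin 2) e)
  let Ψ : MvPolynomial (Fin 2) ↥(EA k m r F) →ₐ[↥(EA k m r F)] RingA k m r F :=
    aeval fun j => Θ (X (Sum.inr j))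
  have hΨ : (Ψ.restrictScalars k).comp Λ.toAlgHom = Θ.toAlgHom := by
    refine MvPolynomial.algHom_ext ?_
    rintro (i | j)
    · have : Λ (X (Sum.inl i)) = C (e (X i)) := by
        simp [Λ]
      change Ψ (Λ _) = Θ _
      rw [this, hΘ, ← he]
      exact aeval_C _ _
    · have : Λ (X (Sum.inr j)) = X j := by
        simp [Λ]
      change Ψ (Λ _) = Θ _
      rw [this]
      exact aeval_X _ _
  have hΨ' : ∀ p, Ψ p = Θ (Λ.symm p) := fun p => by
    obtain ⟨q, rfl⟩ := Λ.surjective p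
    rw [Λ.symm_apply_apply]
    exact DFunLike.congr_fun hΨ q
  have hbij : Function.Bijective Ψ := by
    rw [show (Ψ : _ → _) = Θ ∘ Λ.symm from funext hΨ']
    exact Θ.bijective.comp Λ.symm.bijective
  exact isAnFibration_of_algEquiv (AlgEquiv.ofBijective Ψ hbij)

end Fibration

section Line

variable {k : Type} [Field k]

lemma IsCoordinate.of_coordinates_of_embedding {f h s : MvPolynomial (Fin 2) k}
    (htop : Algebra.adjoin k {h, s} = ⊤) (hf0 : f ≠ 0) (p q : Polynomial k)
    (hf : f = Polynomial.aeval h p + Polynomial.aeval h q * s)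
    {κ τ : Type} [Field κ] [Algebra k κ] (hκ : Function.Surjective (algebraMap k κ))
    (φ : MvPolynomial (Fin 2) k →ₐ[k] MvPolynomial τ κ) (hφ : ∀ w, φ w = 0 ↔ f ∣ w) :
    IsCoordinate f := by
  obtain ⟨σ, hσ0, hσ1⟩ := exists_coordinateEquiv htop
  have hσf : σ.symm f = Polynomial.aeval (X 0) p + Polynomial.aeval (X 0) q * X 1 := by
    rw [σ.symm_apply_eq, map_add, map_mul, ← Polynomial.aeval_algHom_apply,
      ← Polynomial.aeval_algHom_apply, hσ0, hσ1, hf]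
  have := isCoordinate_of_embedding ((map_ne_zero_iff _ σ.symm.injective).2 hf0) p q hσf hκ
    (φ.comp σ.toAlgHom) fun w => by
      change φ (σ w) = 0 ↔ _
      rw [hφ, ← map_dvd_iff σ (a := σ.symm f), σ.apply_symm_apply]
  have h2 := this.map σ
  rwa [σ.apply_symm_apply] at h2

/-- If `k[Z, T]/(f)` is a polynomial ring in one variable over `k` and `f` has degree at most one
in some coordinate, then `f` is a coordinate. -/
lemma IsCoordinate.of_line {f h s : MvPolynomial (Fin 2) k}
    (htop : Algebra.adjoin k {h, s} = ⊤) (hf0 : f ≠ 0) (p q : Polynomial k)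
    (hf : f = Polynomial.aeval h p + Polynomial.aeval h q * s)
    (e : (MvPolynomial (Fin 2) k ⧸ Ideal.span {f}) ≃ₐ[k] Polynomial k) : IsCoordinate f := by
  refine .of_coordinates_of_embedding htop hf0 p q hf (κ := k) (τ := Unit)
    Function.surjective_id
    (((e.trans (uniqueAlgEquiv k Unit).symm).toAlgHom).comp (Ideal.Quotient.mkₐ k _)) fun w => ?_
  change (e.trans (uniqueAlgEquiv k Unit).symm) (Ideal.Quotient.mk _ w) = 0 ↔ _
  rw [map_eq_zero_iff _ (AlgEquiv.injective _), Ideal.Quotient.eq_zero_iff_dvd]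

lemma IsCoordinate.line {f : MvPolynomial (Fin 2) k} (hf : IsCoordinate f) :
    Nonempty ((MvPolynomial (Fin 2) k ⧸ Ideal.span {f}) ≃ₐ[k] Polynomial k) := by
  obtain ⟨s, hs⟩ := hf
  obtain ⟨σ, hσ0, hσ1⟩ := exists_coordinateEquiv hs
  let ψ : MvPolynomial (Fin 2) k →ₐ[k] Polynomial k := aeval ![0, Polynomial.X]
  have hψ : ∀ u, ψ u = 0 ↔ X 0 ∣ u := fun u => by
    constructor
    · intro hu
      have h1 : ∀ u, X 0 ∣ u - Polynomial.aeval (X 1 : MvPolynomial (Fin 2) k) (ψ u) := fun u => by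
        rw [← Ideal.mem_span_singleton, ← Ideal.Quotient.eq]
        change (Ideal.Quotient.mkₐ k (Ideal.span {X 0})) u = ((Ideal.Quotient.mkₐ k _).comp
          ((Polynomial.aeval (X 1)).comp ψ)) u
        refine DFunLike.congr_fun (MvPolynomial.algHom_ext fun i => ?_) u
        fin_cases i
        · simp [ψ]
        · simp [ψ]
      have := h1 u
      rwa [hu, map_zero, sub_zero] at this
    · rintro ⟨c, rfl⟩
      simp [ψ]
  let φ : MvPolynomial (Fin 2) k →ₐ[k] Polynomial k := ψ.comp σ.symm.toAlgHom
  have hφ : Function.Surjective φ := fun p => ⟨σ (Polynomial.aeval (X 1) p), by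
    change ψ (σ.symm (σ _)) = p
    rw [σ.symm_apply_apply, ← Polynomial.aeval_algHom_apply]
    simp [ψ]⟩
  have hker : RingHom.ker φ = Ideal.span {f} := by
    ext w
    rw [RingHom.mem_ker, Ideal.mem_span_singleton]
    change ψ (σ.symm w) = 0 ↔ _
    rw [hψ, ← map_dvd_iff σ, σ.apply_symm_apply, hσ0]
  exact ⟨(Ideal.quotientEquivAlgOfEq k hker.symm).trans (Ideal.quotientKerAlgEquivOfSurjective hφ)⟩

end Line

section Shift

variable {k D : Type} [CommRing k] [CommRing D] [Algebra k D] {n : ℕ}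

/-- The exponential map translating the `i`-th variable of a polynomial ring. -/
def shiftExp (e : MvPolynomial (Fin n) k ≃ₐ[k] D) (i : Fin n) : ExpMap k D where
  toAlgHom := (aeval fun j => Polynomial.C (e (X j)) + if j = i then Polynomial.X else 0).comp
    e.symm.toAlgHom
  eval_zero d := by
    obtain ⟨p, rfl⟩ := e.surjective d
    change (Polynomial.evalRingHom 0) (aeval _ (e.symm (e p))) = _
    rw [e.symm_apply_apply]
    change ((Polynomial.evalRingHom 0).comp (aeval _).toRingHom) p = e.toAlgHom.toRingHom p
    refine DFunLike.congr_fun (MvPolynomial.ringHom_ext (fun c => ?_) fun j => ?_) p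
    · simp [← MvPolynomial.algebraMap_eq]
    · by_cases h : j = i <;> simp [h]
  comp_add d := by
    obtain ⟨p, rfl⟩ := e.surjective d
    set ψ : D →ₐ[k] Polynomial D := (aeval fun j =>
      Polynomial.C (e (X j)) + if j = i then Polynomial.X else 0).comp e.symm.toAlgHom with hψ
    have hψX : ∀ j, ψ (e (X j)) = Polynomial.C (e (X j)) + if j = i then Polynomial.X else 0 :=
      fun j => by
        change aeval _ (e.symm (e (X j))) = _
        rw [e.symm_apply_apply, aeval_X]
    change ((Polynomial.eval₂RingHom ((Polynomial.mapRingHom Polynomial.C).comp ψ.toRingHom)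
        (Polynomial.C Polynomial.X)).comp (ψ.toRingHom.comp e.toAlgHom.toRingHom)) p =
      ((Polynomial.eval₂RingHom (Polynomial.C.comp Polynomial.C)
        (Polynomial.C Polynomial.X + Polynomial.X)).comp
          (ψ.toRingHom.comp e.toAlgHom.toRingHom)) p
    refine DFunLike.congr_fun (MvPolynomial.ringHom_ext (fun c => ?_) fun j => ?_) p
    · have : e (C c) = algebraMap k D c := e.commutes c
      simp [this, Polynomial.algebraMap_apply]
    · have h1 : (ψ.toRingHom.comp e.toAlgHom.toRingHom) (X j) = _ := hψX j
      rw [RingHom.comp_apply, RingHom.comp_apply (Polynomial.eval₂RingHom _ _) _ (X j), h1]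
      by_cases h : j = i
      · simp [h, hψX]
        ring
      · simp [h, hψX]

lemma shiftExp_apply (e : MvPolynomial (Fin n) k ≃ₐ[k] D) (i j : Fin n) :
    (shiftExp e i).toAlgHom (e (X j)) =
      Polynomial.C (e (X j)) + if j = i then Polynomial.X else 0 := by
  change aeval _ (e.symm (e (X j))) = _
  rw [e.symm_apply_apply, aeval_X]

/-- The Derksen invariant of a polynomial ring in at least two variables is everything. -/
theorem derksen_eq_top [Nontrivial D] (e : MvPolynomial (Fin (n + 2)) k ≃ₐ[k] D) :
    Derksen k D = ⊤ := by
  have hX : ∀ j, e (X j) ∈ Derksen k D := fun j => by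
    obtain ⟨i, hi⟩ := exists_ne j
    refine Algebra.subset_adjoin (Set.mem_iUnion₂.2 ⟨shiftExp e i, fun h => ?_, ?_⟩)
    · have : e (X i) ∈ (shiftExp e i).invariants := h ▸ Algebra.mem_top
      have h2 : (shiftExp e i).toAlgHom (e (X i)) = Polynomial.C (e (X i)) := this
      rw [shiftExp_apply, if_pos rfl, add_eq_left] at h2
      exact Polynomial.X_ne_zero h2
    · change (shiftExp e i).toAlgHom (e (X j)) = Polynomial.C (e (X j))
      rw [shiftExp_apply, if_neg hi.symm, add_zero]
  rw [eq_top_iff]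
  rintro d -
  obtain ⟨p, rfl⟩ := e.surjective d
  induction p using MvPolynomial.induction_on with
  | C c =>
    rw [← MvPolynomial.algebraMap_eq, e.commutes]
    exact Subalgebra.algebraMap_mem _ _
  | add p q hp hq =>
    rw [map_add]
    exact add_mem hp hq
  | mul_X p j hp =>
    rw [map_mul]
    exact mul_mem hp (hX j)

end Shift

section Proper

variable {k : Type} [Field k] {m : ℕ} {r : Fin m → ℕ} {F : MvPolynomial (Fin m ⊕ Fin 2) k}

theorem yA_notMem_BA (hm : 1 ≤ m) (hr : ∀ i, 1 < r i) (hf : fOf k m F ≠ 0) :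
    yA k m r F ∉ BA k m r F := by
  intro hy
  obtain ⟨p, hp⟩ := exists_polyA_of_mem_BA hy
  have h := prod_xA_mul_yA (k := k) (m := m) (r := r) (F := F)
  rw [← hp] at h
  have hx : ∀ i, xA k m r F i = polyA k m r F (X (Sum.inl i)) := fun i => by
    simp [polyA]
  simp only [hx, ← map_pow, ← map_prod, ← map_mul] at h
  refine hf ?_
  rw [← polyA_injective k m r F h, fOf, map_mul, map_prod,
    Finset.prod_eq_zero (Finset.mem_univ ⟨0, hm⟩), zero_mul]
  simp [(zero_lt_one.trans (hr _)).ne']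

theorem BA_lt_derksen (hm : 1 ≤ m) (hr : ∀ i, 1 < r i) (hf : fOf k m F ≠ 0)
    [Nontrivial (RingA k m r F)] {n : ℕ} (e : MvPolynomial (Fin (n + 2)) k ≃ₐ[k] RingA k m r F) :
    BA k m r F < Derksen k (RingA k m r F) := by
  rw [derksen_eq_top e, lt_top_iff_ne_top]
  exact fun h => yA_notMem_BA hm hr hf (h ▸ Algebra.mem_top)

end Proper

section OriginFibre

open scoped TensorProduct

variable {k : Type} [Field k] {m : ℕ} {r : Fin m → ℕ} {F : MvPolynomial (Fin m ⊕ Fin 2) k}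

/-- The specialization `A → k[Z, T]/(f)` sending `x₁, …, xₘ` and `y` to zero. -/
lemma exists_specialization :
    ∃ π : RingA k m r F →ₐ[k] MvPolynomial (Fin 2) k ⧸ Ideal.span {fOf k m F},
      (∀ i, π (xA k m r F i) = 0) ∧
        ∀ w, π (planeA k m r F w) = Ideal.Quotient.mk (Ideal.span {fOf k m F}) w := by
  obtain ⟨mk, hmk⟩ : ∃ mk : MvPolynomial (Fin 2) k →ₐ[k] _, mk =
      Ideal.Quotient.mkₐ k (Ideal.span {fOf k m F}) := ⟨_, rfl⟩
  have hw : ∀ w, mk w = Ideal.Quotient.mk (Ideal.span {fOf k m F}) w := fun w => by rw [hmk]; rfl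
  have haeval : aeval (fun j => mk (X j)) = mk := MvPolynomial.algHom_ext fun j => by rw [aeval_X]
  have h0 : mk (fOf k m F) = 0 :=
    (hw _).trans (Ideal.Quotient.eq_zero_iff_mem.2 (Ideal.subset_span rfl))
  have h : (∏ i, (fun _ : Fin m => (0 : MvPolynomial (Fin 2) k ⧸ Ideal.span {fOf k m F})) i ^ r i)
      * 0 = aeval (Sum.elim (fun _ => 0) fun j => mk (X j)) F := by
    rw [mul_zero, aeval_zero_eq_fOf, haeval, h0]
  exact ⟨liftA _ 0 _ h, liftA_xA _ _ _ h, fun w => by rw [liftA_planeA, haeval, hw]⟩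

lemma exists_planeA_eq_xA_mul (hr : ∀ i, 1 < r i) {f : MvPolynomial (Fin 2) k}
    {g : MvPolynomial (Fin m ⊕ Fin 2) k}
    (hFg : F = rename Sum.inr f + (∏ i, X (Sum.inl i)) * g) (i : Fin m) :
    ∃ a, planeA k m r F f = xA k m r F i * a := by
  have h := prod_xA_mul_yA (k := k) (m := m) (r := r) (F := F)
  have h2 : polyA k m r F F = planeA k m r F f + (∏ i, xA k m r F i) * polyA k m r F g := by
    refine (congrArg (polyA k m r F) hFg).trans ?_
    rw [map_add, polyA_rename, map_mul, map_prod]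
    simp [polyA]
  have h3 : xA k m r F i ∣ ∏ i, xA k m r F i ^ r i :=
    (dvd_pow_self _ (zero_lt_one.trans (hr i)).ne').trans
      (Finset.dvd_prod_of_mem (fun i => xA k m r F i ^ r i) (Finset.mem_univ i))
  have h4 : xA k m r F i ∣ ∏ i, xA k m r F i := Finset.dvd_prod_of_mem _ (Finset.mem_univ i)
  have h5 : planeA k m r F f = (∏ i, xA k m r F i ^ r i) * yA k m r F -
      (∏ i, xA k m r F i) * polyA k m r F g := by
    rw [h, h2, add_sub_cancel_right]
  rw [h5]
  exact dvd_sub (h3.mul_right _) (h4.mul_right _)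

/-- The fibre of an `𝔸ⁿ`-fibration over a rational point, and its universal property. -/
lemma exists_fibre_of_isAnFibration {R D : Type} [CommRing R] [CommRing D] [Algebra k R]
    [Algebra k D] [Algebra R D] [IsScalarTower k R D] (ε : R →ₐ[k] k) {n : ℕ}
    (hA : IsAnFibration R D n) :
    ∃ (κ : Type) (_ : Field κ) (_ : Algebra k κ), Function.Surjective (algebraMap k κ) ∧
      ∃ η : D →ₐ[k] MvPolynomial (Fin n) κ, (∀ c, ε c = 0 → η (algebraMap R D c) = 0) ∧
        ∀ (Q : Type) [CommRing Q] [Algebra k Q] (π : D →ₐ[k] Q),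
          (∀ c, π (algebraMap R D c) = algebraMap k Q (ε c)) → ∀ d, η d = 0 → π d = 0 := by
  have hεs : Function.Surjective ε := fun c => ⟨algebraMap k R c, ε.commutes c⟩
  have hmax : (RingHom.ker ε).IsMaximal := RingHom.ker_isMaximal_of_surjective ε hεs
  let p : PrimeSpectrum R := ⟨RingHom.ker ε, hmax.isPrime⟩
  have hpmax : p.asIdeal.IsMaximal := hmax
  obtain ⟨e'⟩ := hA.2.2 p
  let κ := IsLocalRing.ResidueField (Localization.AtPrime p.asIdeal)
  let _ : Algebra k κ := ((algebraMap R κ).comp (algebraMap k R)).toAlgebra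
  have hEκ : ∀ c : R, algebraMap R κ c = algebraMap k κ (ε c) := fun c => by
    change _ = algebraMap R κ (algebraMap k R (ε c))
    rw [← sub_eq_zero, ← map_sub]
    refine (Ideal.algebraMap_residueField_eq_zero (I := p.asIdeal)).2 ?_
    change ε _ = 0
    rw [map_sub, AlgHom.commutes, sub_eq_zero]
    rfl
  have hsurj : Function.Surjective (algebraMap k κ) := fun z => by
    obtain ⟨c, hc⟩ := (Ideal.bijective_algebraMap_quotient_residueField p.asIdeal).2 z
    obtain ⟨c, rfl⟩ := Ideal.Quotient.mk_surjective c
    exact ⟨ε c, by rw [← hEκ]; exact hc⟩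
  let lam : κ ≃+* k := (RingEquiv.ofBijective (algebraMap k κ)
    ⟨(algebraMap k κ).injective, hsurj⟩).symm
  have hlam : ∀ c, lam (algebraMap k κ c) = c := fun c => RingEquiv.symm_apply_apply _ c
  have hη : ∀ c : R, e' (1 ⊗ₜ[R] algebraMap R D c) = C (algebraMap R κ c) := fun c => by
    rw [Algebra.algebraMap_eq_smul_one, ← TensorProduct.smul_tmul,
      ← Algebra.algebraMap_eq_smul_one]
    exact e'.commutes _
  refine ⟨κ, inferInstance, inferInstance, hsurj,
    { toRingHom := e'.toRingEquiv.toRingHom.comp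
        (Algebra.TensorProduct.includeRight (R := R) (A := κ) (B := D)).toRingHom
      commutes' := fun c => ?_ }, fun c hc => ?_, ?_⟩
  · change e' (1 ⊗ₜ[R] algebraMap k D c) = _
    rw [IsScalarTower.algebraMap_apply k R D, hη]
    rfl
  · change e' (1 ⊗ₜ[R] algebraMap R D c) = 0
    rw [hη, hEκ, hc, map_zero, map_zero]
  · intro Q _ _ π hπ d hd
    have hd0 : (1 : κ) ⊗ₜ[R] d = 0 := (map_eq_zero_iff _ e'.injective).1 hd
    let μ : κ →+ D →+ Q := ((AddMonoidHom.mul (R := Q)).comp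
      ((algebraMap k Q).comp lam.toRingHom).toAddMonoidHom).compl₂ π.toRingHom.toAddMonoidHom
    have hμ : ∀ c a, μ c a = algebraMap k Q (lam c) * π a := fun c a => rfl
    let ρ : κ ⊗[R] D →+ Q := TensorProduct.liftAddHom μ fun c z a => by
      rw [hμ, hμ, Algebra.smul_def, map_mul, hEκ, hlam, map_mul, Algebra.smul_def, map_mul, hπ]
      ring
    have h1 : μ 1 d = 0 := (congrArg ρ hd0).trans (map_zero ρ)
    rwa [hμ, map_one, map_one, one_mul] at h1

/-- The fibre of an `𝔸²`-fibration `A` over the origin contains `k[Z, T]/(f)`. -/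
theorem exists_embedding_of_isAnFibration (hm : 1 ≤ m) (hr : ∀ i, 1 < r i)
    {g : MvPolynomial (Fin m ⊕ Fin 2) k}
    (hFg : F = rename Sum.inr (fOf k m F) + (∏ i, X (Sum.inl i)) * g)
    (hA : IsAnFibration ↥(EA k m r F) (RingA k m r F) 2) :
    ∃ (κ : Type) (_ : Field κ) (_ : Algebra k κ),
      Function.Surjective (algebraMap k κ) ∧
      ∃ φ : MvPolynomial (Fin 2) k →ₐ[k] MvPolynomial (Fin 2) κ,
        ∀ w, φ w = 0 ↔ fOf k m F ∣ w := by
  obtain ⟨π, hπx, hπw⟩ := exists_specialization (k := k) (m := m) (r := r) (F := F)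
  obtain ⟨e, he⟩ := exists_equiv_EA k m r F
  let ε : EA k m r F →ₐ[k] k := (aeval fun _ => (0 : k)).comp e.symm.toAlgHom
  have hεe : ∀ p, ε (e p) = aeval (fun _ => (0 : k)) p := fun p => by
    change aeval _ (e.symm (e p)) = _
    rw [e.symm_apply_apply]
  have hπε : ∀ c : EA k m r F, π (algebraMap (EA k m r F) (RingA k m r F) c) =
      algebraMap k (MvPolynomial (Fin 2) k ⧸ Ideal.span {fOf k m F}) (ε c) := fun c => by
    obtain ⟨p, rfl⟩ := e.surjective c
    change ((π.comp (EA k m r F).val).comp e.toAlgHom) p = _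
    rw [hεe]
    change _ = ((Algebra.ofId k (MvPolynomial (Fin 2) k ⧸ Ideal.span {fOf k m F})).comp
      (aeval fun _ => (0 : k))) p
    refine DFunLike.congr_fun (MvPolynomial.algHom_ext fun i => ?_) p
    change π (e (X i)) = algebraMap k (MvPolynomial (Fin 2) k ⧸ Ideal.span {fOf k m F})
      (aeval (fun _ => (0 : k)) (X i))
    rw [he, hπx, aeval_X, map_zero]
  obtain ⟨κ, _, _, hκ, η, hη, huniv⟩ := exists_fibre_of_isAnFibration ε hA
  refine ⟨κ, inferInstance, inferInstance, hκ, η.comp (planeA k m r F), fun w => ⟨fun hw => ?_, ?_⟩⟩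
  · have := (hπw w).symm.trans (huniv _ π hπε (planeA k m r F w) hw)
    exact Ideal.mem_span_singleton.1 (Ideal.Quotient.eq_zero_iff_mem.1 this)
  · rintro ⟨c, rfl⟩
    obtain ⟨a, ha⟩ := exists_planeA_eq_xA_mul (r := r) hr hFg ⟨0, hm⟩
    have h0 : η (xA k m r F ⟨0, hm⟩) = 0 := by
      rw [← he]
      exact hη _ (by rw [hεe, aeval_X])
    rw [AlgHom.comp_apply, map_mul, map_mul, ha, map_mul, h0, zero_mul, zero_mul]

end OriginFibre

section FiniteResidue

lemma isJacobsonRing_int : IsJacobsonRing ℤ := by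
  rw [isJacobsonRing_iff_prime_eq]
  intro P hP
  by_cases h : P = ⊥
  · subst h
    refine le_antisymm (fun x hx => ?_) Ideal.le_jacobson
    have := Ideal.mem_jacobson_bot.1 hx x
    rcases Int.isUnit_iff.1 this with h | h
    · exact Ideal.mem_bot.2 (mul_self_eq_zero.1 (by linarith))
    · nlinarith [mul_self_nonneg x]
  · have := hP.isMaximal h
    exact Ideal.jacobson_eq_self_of_isMaximal

lemma finite_of_surjective {R K : Type} [CommRing R] [Field K] [Algebra.FiniteType ℤ R]
    (φ : R →+* K) (hφ : Function.Surjective φ) : Finite K := by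
  have : Algebra.FiniteType ℤ K := .of_surjective φ.toIntAlgHom hφ
  have := isJacobsonRing_int
  have hfin : Module.Finite ℤ K := finite_of_finite_type_of_isJacobsonRing ℤ K
  refine Module.finite_of_fg_torsion K fun x => ?_
  have hnot : ¬ Function.Injective (algebraMap ℤ K) := fun h =>
    Int.not_isField (isField_of_isIntegral_of_isField h (Field.toIsField K))
  rw [injective_iff_map_eq_zero] at hnot
  push Not at hnot
  obtain ⟨n, hn, hn0⟩ := hnot
  refine ⟨⟨n, mem_nonZeroDivisors_of_ne_zero hn0⟩, ?_⟩
  change n • x = 0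
  rw [Algebra.smul_def, hn, zero_mul]

/-- A finitely generated nonzero ring maps to a finite field. -/
theorem exists_ringHom_finite_field (R : Type) [CommRing R] [Nontrivial R]
    [Algebra.FiniteType ℤ R] :
    ∃ (K : Type) (_ : Field K) (_ : Finite K), Nonempty (R →+* K) := by
  obtain ⟨M, hM⟩ := Ideal.exists_maximal R
  let _ := Ideal.Quotient.field M
  exact ⟨R ⧸ M, inferInstance, finite_of_surjective _ Ideal.Quotient.mk_surjective,
    ⟨Ideal.Quotient.mk M⟩⟩

end FiniteResidue

section PolynomialQuotient

variable {σ R S : Type} (τ : Type) [CommRing R] [CommRing S]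

/-- Equations expressing that `R[σ]/(G)` is a polynomial ring over `R` in the variables `τ`. -/
def HasPolynomialQuotient (G : MvPolynomial σ R) : Prop :=
  ∃ (α : σ → MvPolynomial τ R) (β : τ → MvPolynomial σ R) (h : σ → MvPolynomial σ R),
    aeval α G = 0 ∧ (∀ i, aeval β (α i) = X i + G * h i) ∧ ∀ j, aeval α (β j) = X j

variable {τ} {G : MvPolynomial σ R}

lemma HasPolynomialQuotient.of_algEquiv {D : Type} [CommRing D] [Algebra R D]
    (ψ : MvPolynomial σ R →ₐ[R] D) (hψ : Function.Surjective ψ) (hker : ∀ p, ψ p = 0 ↔ G ∣ p)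
    (e : D ≃ₐ[R] MvPolynomial τ R) : HasPolynomialQuotient τ G := by
  choose β hβ using fun j => hψ (e.symm (X j))
  have hα : ∀ p, aeval (fun i => e (ψ (X i))) p = e (ψ p) := fun p =>
    DFunLike.congr_fun (MvPolynomial.algHom_ext (f := aeval fun i => e (ψ (X i)))
      (g := e.toAlgHom.comp ψ) fun i => aeval_X _ _) p
  have hβ' : ∀ p, ψ (aeval β p) = e.symm p := fun p =>
    DFunLike.congr_fun (MvPolynomial.algHom_ext (f := ψ.comp (aeval β))
      (g := e.symm.toAlgHom) fun j => by
        change ψ (aeval β (X j)) = e.symm (X j)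
        rw [aeval_X, hβ]) p
  have h : ∀ i, G ∣ aeval β (e (ψ (X i))) - X i := fun i => by
    rw [← hker, map_sub, hβ', e.symm_apply_apply, sub_self]
  choose h hh using h
  refine ⟨fun i => e (ψ (X i)), β, h, ?_, fun i => ?_, fun j => ?_⟩
  · rw [hα, (hker G).2 dvd_rfl, map_zero]
  · rw [← hh]
    ring
  · rw [hα, hβ, e.apply_symm_apply]

lemma HasPolynomialQuotient.nonempty_algEquiv (hG : HasPolynomialQuotient τ G) {D : Type}
    [CommRing D] [Algebra R D] (ψ : MvPolynomial σ R →ₐ[R] D) (hψ : Function.Surjective ψ)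
    (hker : ∀ p, ψ p = 0 ↔ G ∣ p) : Nonempty (D ≃ₐ[R] MvPolynomial τ R) := by
  obtain ⟨α, β, h, h1, h2, h3⟩ := hG
  have hsurj : Function.Surjective (aeval (R := R) α) := fun p => ⟨aeval β p, by
    refine (DFunLike.congr_fun (MvPolynomial.algHom_ext (f := (aeval α).comp (aeval β))
      (g := AlgHom.id R _) fun j => ?_) p)
    change aeval α (aeval β (X j)) = X j
    rw [aeval_X, h3]⟩
  have hdvd : ∀ p, aeval α p = 0 ↔ G ∣ p := fun p => by
    constructor
    · intro hp
      rw [← Ideal.mem_span_singleton, ← Ideal.Quotient.eq_zero_iff_mem]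
      have : (Ideal.Quotient.mkₐ R (Ideal.span {G})).comp ((aeval β).comp (aeval α)) =
          Ideal.Quotient.mkₐ R (Ideal.span {G}) := MvPolynomial.algHom_ext fun i => by
        change Ideal.Quotient.mk _ (aeval β (aeval α (X i))) = Ideal.Quotient.mk _ (X i)
        rw [aeval_X, h2, Ideal.Quotient.eq, add_sub_cancel_left]
        exact Ideal.mul_mem_right _ _ (Ideal.subset_span rfl)
      have h5 := DFunLike.congr_fun this p
      change Ideal.Quotient.mk _ (aeval β (aeval α p)) = Ideal.Quotient.mk _ p at h5
      rw [← h5, hp, map_zero, map_zero]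
    · rintro ⟨c, rfl⟩
      rw [map_mul, h1, zero_mul]
  have hkereq : RingHom.ker ψ = RingHom.ker (aeval (R := R) α) := by
    ext p
    rw [RingHom.mem_ker, RingHom.mem_ker, hker, hdvd]
  exact ⟨(Ideal.quotientKerAlgEquivOfSurjective hψ).symm.trans
    ((Ideal.quotientEquivAlgOfEq R hkereq).trans (Ideal.quotientKerAlgEquivOfSurjective hsurj))⟩

lemma map_mvPolynomial_aeval {ι : Type} (φ : R →+* S) (α : σ → MvPolynomial ι R) (p : MvPolynomial σ R) :
    map φ (aeval α p) = aeval (fun i => map φ (α i)) (map φ p) := by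
  rw [aeval_eq_bind₁, aeval_eq_bind₁, map_bind₁]

lemma HasPolynomialQuotient.map (φ : R →+* S) (hG : HasPolynomialQuotient τ G) :
    HasPolynomialQuotient τ (MvPolynomial.map φ G) := by
  obtain ⟨α, β, h, h1, h2, h3⟩ := hG
  refine ⟨fun i => MvPolynomial.map φ (α i), fun j => MvPolynomial.map φ (β j),
    fun i => MvPolynomial.map φ (h i), ?_, fun i => ?_, fun j => ?_⟩
  · rw [← map_mvPolynomial_aeval, h1, map_zero]
  · rw [← map_mvPolynomial_aeval, h2, map_add, map_mul, map_X]
  · rw [← map_mvPolynomial_aeval, h3, map_X]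

/-- The zeros of `G` are in bijection with the points of affine space. -/
lemma HasPolynomialQuotient.card_zeros (hG : HasPolynomialQuotient τ G) :
    Nat.card {x : σ → R // aeval x G = 0} = Nat.card (τ → R) := by
  obtain ⟨α, β, h, h1, h2, h3⟩ := hG
  have hα : ∀ (t : τ → R) p, aeval (fun i => aeval t (α i)) p = aeval t (aeval α p) := fun t p =>
    (comp_aeval_apply α (aeval t) p).symm
  have hβ : ∀ (x : σ → R) p, aeval (fun i => aeval x (β i)) p = aeval x (aeval β p) := fun x p =>
    (comp_aeval_apply β (aeval x) p).symm
  refine Nat.card_congr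
    { toFun := fun x j => aeval x.1 (β j)
      invFun := fun t => ⟨fun i => aeval t (α i), by rw [hα, h1, map_zero]⟩
      left_inv := fun x => Subtype.ext (funext fun i => ?_)
      right_inv := fun t => funext fun j => ?_ }
  · change aeval (fun j => aeval x.1 (β j)) (α i) = x.1 i
    rw [hβ, h2, map_add, map_mul, x.2, zero_mul, add_zero, aeval_X]
  · change aeval (fun i => aeval t (α i)) (β j) = t j
    rw [hα, h3, aeval_X]

lemma exists_finset_forall_lift (p : MvPolynomial σ S) :
    ∃ T : Finset S, ∀ (A : Subalgebra ℤ S), (T : Set S) ⊆ A →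
      ∃ q : MvPolynomial σ A, MvPolynomial.map (algebraMap A S) q = p :=
  ⟨p.coeffs, fun _ hA => mem_range_map_iff_coeffs_subset.2 fun c hc => ⟨⟨c, hA hc⟩, rfl⟩⟩

/-- The equations expressing that `S[σ]/(G)` is a polynomial ring descend to every subring
containing a certain finite set of coefficients. -/
lemma HasPolynomialQuotient.exists_finset [Finite σ] [Finite τ] {G : MvPolynomial σ S}
    (hG : HasPolynomialQuotient τ G) :
    ∃ T : Finset S, ∀ (A : Subalgebra ℤ S), (T : Set S) ⊆ A → ∀ G' : MvPolynomial σ A,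
      MvPolynomial.map (algebraMap A S) G' = G → HasPolynomialQuotient τ G' := by
  classical
  have := Fintype.ofFinite σ
  have := Fintype.ofFinite τ
  obtain ⟨α, β, h, h1, h2, h3⟩ := hG
  choose Tα hα using fun i => exists_finset_forall_lift (α i)
  choose Tβ hβ using fun j => exists_finset_forall_lift (β j)
  choose Th hh using fun i => exists_finset_forall_lift (h i)
  refine ⟨Finset.univ.biUnion Tα ∪ Finset.univ.biUnion Tβ ∪ Finset.univ.biUnion Th,
    fun A hA G' hG' => ?_⟩
  choose α' hα' using fun i => hα i A (subset_trans (fun c hc => by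
    simp only [Finset.coe_union, Finset.coe_biUnion, Set.mem_union, Set.mem_iUnion]
    exact Or.inl (Or.inl ⟨i, Finset.mem_univ i, hc⟩)) hA)
  choose β' hβ' using fun i => hβ i A (subset_trans (fun c hc => by
    simp only [Finset.coe_union, Finset.coe_biUnion, Set.mem_union, Set.mem_iUnion]
    exact Or.inl (Or.inr ⟨i, Finset.mem_univ i, hc⟩)) hA)
  choose h' hh' using fun i => hh i A (subset_trans (fun c hc => by
    simp only [Finset.coe_union, Finset.coe_biUnion, Set.mem_union, Set.mem_iUnion]
    exact Or.inr ⟨i, Finset.mem_univ i, hc⟩) hA)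
  have hinj : Function.Injective (algebraMap A S) := Subtype.val_injective
  refine ⟨α', β', h', ?_, fun i => ?_, fun j => ?_⟩
  · apply map_injective _ hinj
    rw [map_mvPolynomial_aeval, hG', map_zero]
    simp only [hα', h1]
  · apply map_injective _ hinj
    rw [map_mvPolynomial_aeval, hα', map_add, map_mul, hG', hh', map_X]
    simp only [hβ', h2]
  · apply map_injective _ hinj
    rw [map_mvPolynomial_aeval, hβ', map_X]
    simp only [hα', h3]

end PolynomialQuotient

section Counting

variable {K : Type} [Field K] {m : ℕ} {r : Fin m → ℕ}
  {F : MvPolynomial (Fin m ⊕ Fin 2) K} {f : MvPolynomial (Fin 2) K}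

lemma aeval_relG {R : Type} [CommRing R] (F : MvPolynomial (Fin m ⊕ Fin 2) R)
    (x : Fin m ⊕ Fin 3 → R) :
    aeval x (relG R m r F) = (∏ i, x (Sum.inl i) ^ r i) * x (Sum.inr 0) -
      aeval (Sum.elim (fun i => x (Sum.inl i)) fun j => x (Sum.inr j.succ)) F := by
  have : (fun i => x (Sum.map id Fin.succ i)) =
      Sum.elim (fun i => x (Sum.inl i)) fun j : Fin 2 => x (Sum.inr j.succ) := by
    funext i
    rcases i with i | i <;> rfl
  rw [← this, relG, incl, map_sub, aeval_rename]
  simp [Function.comp_def]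

lemma card_zeros_rename {σ ι : Type} [Finite σ] [Finite ι] (G : MvPolynomial σ K) :
    Nat.card {x : ι ⊕ σ → K // aeval x (rename Sum.inr G) = 0} =
      Nat.card (ι → K) * Nat.card {x : σ → K // aeval x G = 0} := by
  rw [← Nat.card_prod]
  refine Nat.card_congr
    { toFun := fun x => (fun i => x.1 (Sum.inl i), ⟨fun i => x.1 (Sum.inr i), ?_⟩)
      invFun := fun p => ⟨Sum.elim p.1 p.2.1, ?_⟩
      left_inv := fun x => Subtype.ext (funext fun i => by rcases i with i | i <;> rfl)
      right_inv := fun p => rfl }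
  · have := x.2
    rwa [aeval_rename] at this
  · rw [aeval_rename, Sum.elim_comp_inr, p.2.2]

/-- The zeros of `X₁^{r₁} ⋯ Xₘ^{rₘ} Y - F`, fibred over the coordinates `X₁, …, Xₘ, Z, T`. -/
def zerosEquiv (r : Fin m → ℕ) (F : MvPolynomial (Fin m ⊕ Fin 2) K) :
    {x : Fin m ⊕ Fin 3 → K // aeval x (relG K m r F) = 0} ≃
      Σ (ξ : Fin m → K) (w : Fin 2 → K),
        {y : K // (∏ i, ξ i ^ r i) * y = aeval (Sum.elim ξ w) F} where
  toFun x := ⟨fun i => x.1 (Sum.inl i), fun j => x.1 (Sum.inr j.succ), x.1 (Sum.inr 0), by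
    have := x.2
    rwa [aeval_relG, sub_eq_zero] at this⟩
  invFun p := ⟨Sum.elim p.1 (Fin.cons p.2.2.1 p.2.1), by
    rw [aeval_relG, sub_eq_zero]
    exact p.2.2.2⟩
  left_inv x := Subtype.ext (funext fun i => by
    rcases i with i | i
    · rfl
    · refine Fin.cases ?_ (fun j => ?_) i <;> rfl)
  right_inv p := rfl

lemma aeval_F_of_prod_eq_zero {g : MvPolynomial (Fin m ⊕ Fin 2) K}
    (hFg : F = rename Sum.inr f + (∏ i, X (Sum.inl i)) * g) {ξ : Fin m → K} (hξ : ∏ i, ξ i = 0)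
    (w : Fin 2 → K) : aeval (Sum.elim ξ w) F = aeval w f := by
  rw [hFg, map_add, map_mul, map_prod, aeval_rename, Sum.elim_comp_inr]
  simp [hξ]

/-- If `A` is stably a polynomial ring over a finite field, then the plane curve `f = 0` has as many
points as the affine line. -/
theorem card_zeros_plane [Finite K] (hm : 1 ≤ m) (hr : ∀ i, 1 < r i) {g : MvPolynomial (Fin m ⊕ Fin 2) K}
    (hFg : F = rename Sum.inr f + (∏ i, X (Sum.inl i)) * g) {l : ℕ}
    (hG : HasPolynomialQuotient (Fin (l + m + 2))
      (rename Sum.inr (relG K m r F) : MvPolynomial (Fin l ⊕ (Fin m ⊕ Fin 3)) K)) :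
    Nat.card {w : Fin 2 → K // aeval w f = 0} = Nat.card K := by
  classical
  have := Fintype.ofFinite K
  have hq : 0 < Nat.card K := Nat.card_pos
  have h1 := hG.card_zeros
  rw [card_zeros_rename, Nat.card_congr (zerosEquiv r F), Nat.card_sigma] at h1
  simp only [Nat.card_sigma, Nat.card_fun, Nat.card_eq_fintype_card (α := Fin _),
    Fintype.card_fin] at h1
  rw [add_assoc, pow_add] at h1
  have h2 := Nat.eq_of_mul_eq_mul_left (pow_pos hq l) h1
  have hunit : ∀ ξ : Fin m → K, ∏ i, ξ i ≠ 0 → ∑ w : Fin 2 → K,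
      Nat.card {y : K // (∏ i, ξ i ^ r i) * y = aeval (Sum.elim ξ w) F} = Nat.card K ^ 2 := by
    intro ξ hξ
    have hne : ∏ i, ξ i ^ r i ≠ 0 := Finset.prod_ne_zero_iff.2 fun i hi =>
      pow_ne_zero _ (Finset.prod_ne_zero_iff.1 hξ i hi)
    have hone : ∀ w : Fin 2 → K,
        Nat.card {y : K // (∏ i, ξ i ^ r i) * y = aeval (Sum.elim ξ w) F} = 1 := fun w => by
      rw [Nat.card_eq_one_iff_unique]
      refine ⟨⟨fun a b => Subtype.ext (mul_left_cancel₀ hne (a.2.trans b.2.symm))⟩,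
        ⟨⟨aeval (Sum.elim ξ w) F / ∏ i, ξ i ^ r i, mul_div_cancel₀ _ hne⟩⟩⟩
    rw [Finset.sum_congr rfl fun w _ => hone w]
    simp [Nat.card_eq_fintype_card]
  have hzero : ∀ ξ : Fin m → K, ∏ i, ξ i = 0 → ∑ w : Fin 2 → K,
      Nat.card {y : K // (∏ i, ξ i ^ r i) * y = aeval (Sum.elim ξ w) F} =
        Nat.card K * Nat.card {w : Fin 2 → K // aeval w f = 0} := by
    intro ξ hξ
    obtain ⟨i, hi, hi0⟩ := Finset.prod_eq_zero_iff.1 hξ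
    have h0 : ∏ i, ξ i ^ r i = 0 := Finset.prod_eq_zero hi
      (by rw [hi0, zero_pow (zero_lt_one.trans (hr i)).ne'])
    rw [← Nat.card_sigma, mul_comm, ← Nat.card_prod]
    refine Nat.card_congr
      { toFun := fun p => (⟨p.1, ?_⟩, p.2.1)
        invFun := fun p => ⟨p.1.1, p.2, ?_⟩
        left_inv := fun p => rfl
        right_inv := fun p => rfl }
    · exact (aeval_F_of_prod_eq_zero hFg hξ _).symm.trans
        (p.2.2.symm.trans ((congrArg (· * _) h0).trans (zero_mul _)))
    · exact ((congrArg (· * _) h0).trans (zero_mul _)).trans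
        ((aeval_F_of_prod_eq_zero hFg hξ _).trans p.1.2).symm
  have hsum : ∑ _ξ : Fin m → K, Nat.card K ^ 2 = Nat.card K ^ (m + 2) := by
    simp [Nat.card_eq_fintype_card, pow_add]
  rw [← hsum] at h2
  have hcase : ∀ ξ : Fin m → K, ∏ i, ξ i = 0 ∨ ∏ i, ξ i ≠ 0 := fun ξ => em _
  have hξ0 : ∏ i : Fin m, (0 : Fin m → K) i = 0 :=
    Finset.prod_eq_zero (Finset.mem_univ ⟨0, hm⟩) rfl
  have hkey : Nat.card K * Nat.card {w : Fin 2 → K // aeval w f = 0} = Nat.card K ^ 2 := by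
    rcases lt_trichotomy (Nat.card K * Nat.card {w : Fin 2 → K // aeval w f = 0})
      (Nat.card K ^ 2) with h | h | h
    · refine absurd h2 (ne_of_lt (Finset.sum_lt_sum (fun ξ _ => ?_)
        ⟨0, Finset.mem_univ _, by rwa [hzero _ hξ0]⟩))
      rcases hcase ξ with h' | h'
      · rw [hzero _ h']
        exact h.le
      · rw [hunit _ h']
    · exact h
    · refine absurd h2.symm (ne_of_lt (Finset.sum_lt_sum (fun ξ _ => ?_)
        ⟨0, Finset.mem_univ _, by rwa [hzero _ hξ0]⟩))
      rcases hcase ξ with h' | h'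
      · rw [hzero _ h']
        exact h.le
      · rw [hunit _ h']
  rw [sq] at hkey
  exact Nat.eq_of_mul_eq_mul_left hq hkey

/-- If the curve `a(Z) + b(Z) T = 0` has as many points as the affine line and `b` has a zero then
`b` vanishes everywhere. -/
theorem eval_eq_zero_of_card_zeros [Finite K] {a b : Polynomial K}
    (hf : f = Polynomial.aeval (X 0) a + Polynomial.aeval (X 0) b * X 1)
    (hcard : Nat.card {w : Fin 2 → K // aeval w f = 0} = Nat.card K) {θ : K} (hθ : b.eval θ = 0)
    (u : K) : b.eval u = 0 := by
  classical
  have := Fintype.ofFinite K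
  have hev : ∀ w : Fin 2 → K, aeval w f = a.eval (w 0) + b.eval (w 0) * w 1 := fun w => by
    rw [hf, map_add, map_mul, ← Polynomial.aeval_algHom_apply, ← Polynomial.aeval_algHom_apply]
    simp
  let c : K → ℕ := fun z => Nat.card {t : K // a.eval z + b.eval z * t = 0}
  have hsum : ∑ z, c z = Nat.card K := by
    rw [← hcard, ← Nat.card_sigma]
    refine Nat.card_congr
      { toFun := fun p => ⟨![p.1, p.2.1], by rw [hev]; exact p.2.2⟩
        invFun := fun w => ⟨w.1 0, w.1 1, by rw [← hev]; exact w.2⟩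
        left_inv := fun p => rfl
        right_inv := fun w => Subtype.ext (funext fun i => by fin_cases i <;> rfl) }
  have hc1 : ∀ z, b.eval z ≠ 0 → c z = 1 := fun z hz => by
    rw [Nat.card_eq_one_iff_unique]
    refine ⟨⟨fun s t => Subtype.ext (mul_left_cancel₀ hz
      (add_left_cancel (s.2.trans t.2.symm)))⟩, ⟨⟨-a.eval z / b.eval z, ?_⟩⟩⟩
    rw [mul_div_cancel₀ _ hz, add_neg_cancel]
  have hc0 : ∀ z, b.eval z = 0 → a.eval z ≠ 0 → c z = 0 := fun z hz haz => by
    have : IsEmpty {t : K // a.eval z + b.eval z * t = 0} :=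
      ⟨fun t => haz (by simpa [hz] using t.2)⟩
    exact Nat.card_of_isEmpty
  have hcq : ∀ z, b.eval z = 0 → a.eval z = 0 → c z = Nat.card K := fun z hz haz =>
    Nat.card_congr (Equiv.subtypeUnivEquiv fun t => by rw [hz, haz, zero_mul, add_zero])
  obtain ⟨z, hz, haz⟩ : ∃ z, b.eval z = 0 ∧ a.eval z = 0 := by
    by_contra! hno
    refine absurd hsum (ne_of_lt ?_)
    have : Nat.card K = ∑ _z : K, 1 := by simp [Nat.card_eq_fintype_card]
    rw [this]
    refine Finset.sum_lt_sum (fun z _ => ?_) ⟨θ, Finset.mem_univ _, ?_⟩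
    · by_cases hz : b.eval z = 0
      · rw [hc0 z hz (hno z hz)]
        exact zero_le_one
      · exact (hc1 z hz).le
    · rw [hc0 θ hθ (hno θ hθ)]
      exact zero_lt_one
  by_contra hu
  have hne : u ≠ z := fun h => hu (h ▸ hz)
  have h3 : c z + c u ≤ ∑ z, c z := by
    rw [← Finset.sum_pair hne.symm]
    exact Finset.sum_le_sum_of_subset (Finset.subset_univ _)
  rw [hsum, hcq z hz haz, hc1 u hu] at h3
  omega

end Counting

section StableQuotient

/-- The quotient map `k[U₁, …, U_l, X₁, …, Xₘ, Y, Z, T] → A[U₁, …, U_l]`. -/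
def stableMk (l : ℕ) : MvPolynomial (Fin l ⊕ (Fin m ⊕ Fin 3)) k →ₐ[k]
    MvPolynomial (Fin l) (RingA k m r F) :=
  (mapAlgHom (Ideal.Quotient.mkₐ k (Ideal.span {relG k m r F}))).comp
    (sumAlgEquiv k (Fin l) (Fin m ⊕ Fin 3)).toAlgHom

lemma stableMk_surjective (l : ℕ) : Function.Surjective (stableMk k m r F l) := fun p => by
  obtain ⟨q, rfl⟩ := map_surjective _ Ideal.Quotient.mk_surjective p
  exact ⟨(sumAlgEquiv k (Fin l) (Fin m ⊕ Fin 3)).symm q,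
    congrArg (map _) ((sumAlgEquiv k (Fin l) (Fin m ⊕ Fin 3)).apply_symm_apply q)⟩

lemma stableMk_eq_zero_iff (l : ℕ) (p : MvPolynomial (Fin l ⊕ (Fin m ⊕ Fin 3)) k) :
    stableMk k m r F l p = 0 ↔ rename Sum.inr (relG k m r F) ∣ p := by
  let e := sumAlgEquiv k (Fin l) (Fin m ⊕ Fin 3)
  have he : e (rename Sum.inr (relG k m r F)) = C (relG k m r F) :=
    DFunLike.congr_fun (MvPolynomial.algHom_ext (f := e.toAlgHom.comp (rename Sum.inr))
      (g := IsScalarTower.toAlgHom k (MvPolynomial (Fin m ⊕ Fin 3) k)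
        (MvPolynomial (Fin l) (MvPolynomial (Fin m ⊕ Fin 3) k))) fun i => by
          change e (rename Sum.inr (X i)) = C (X i)
          rw [rename_X]
          exact sumRingEquiv_X_inr k (Fin l) _ i) _
  rw [← map_dvd_iff e, he, C_dvd_iff_dvd_coeff]
  change map (Ideal.Quotient.mk _) (e p) = 0 ↔ _
  rw [MvPolynomial.ext_iff]
  refine forall_congr' fun d => ?_
  rw [coeff_map, coeff_zero, Ideal.Quotient.eq_zero_iff_mem, Ideal.mem_span_singleton]

lemma hasPolynomialQuotient_of_algEquiv {τ : Type} {l : ℕ}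
    (e : MvPolynomial (Fin l) (RingA k m r F) ≃ₐ[k] MvPolynomial τ k) :
    HasPolynomialQuotient τ
      (rename Sum.inr (relG k m r F) : MvPolynomial (Fin l ⊕ (Fin m ⊕ Fin 3)) k) :=
  .of_algEquiv (D := MvPolynomial (Fin l) (RingA k m r F)) (stableMk k m r F l) (stableMk_surjective k m r F l)
    (stableMk_eq_zero_iff k m r F l) e

variable {k m r F}

lemma map_relG {S : Type} [CommRing S] (φ : k →+* S) :
    map φ (relG k m r F) = relG S m r (map φ F) := by
  simp [relG, incl, map_rename]

lemma HasPolynomialQuotient.map_relG {S τ : Type} [CommRing S] {l : ℕ} (φ : k →+* S)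
    (h : HasPolynomialQuotient τ
      (rename Sum.inr (relG k m r F) : MvPolynomial (Fin l ⊕ (Fin m ⊕ Fin 3)) k)) :
    HasPolynomialQuotient τ
      (rename Sum.inr (relG S m r (MvPolynomial.map φ F)) :
        MvPolynomial (Fin l ⊕ (Fin m ⊕ Fin 3)) S) := by
  have := h.map φ
  rwa [map_rename, _root_.map_relG] at this

end StableQuotient

section PlaneSubst

variable {k m r F}

/-- The endomorphism of `k[X₁, …, Xₘ, Z, T]` fixing the `Xᵢ` and extending `σ`. -/
def planeSubst (σ : MvPolynomial (Fin 2) k →ₐ[k] MvPolynomial (Fin 2) k) :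
    MvPolynomial (Fin m ⊕ Fin 2) k →ₐ[k] MvPolynomial (Fin m ⊕ Fin 2) k :=
  aeval (Sum.elim (fun i => X (Sum.inl i)) fun j => rename Sum.inr (σ (X j)))

lemma planeSubst_X_inl (σ : MvPolynomial (Fin 2) k →ₐ[k] MvPolynomial (Fin 2) k) (i : Fin m) :
    planeSubst σ (X (Sum.inl i)) = X (Sum.inl i) := aeval_X _ _

lemma planeSubst_rename (σ : MvPolynomial (Fin 2) k →ₐ[k] MvPolynomial (Fin 2) k)
    (p : MvPolynomial (Fin 2) k) :
    planeSubst (m := m) σ (rename Sum.inr p) = rename Sum.inr (σ p) := by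
  rw [planeSubst, aeval_rename, Sum.elim_comp_inr]
  exact DFunLike.congr_fun (MvPolynomial.algHom_ext (f := aeval fun j => rename Sum.inr (σ (X j)))
    (g := (rename Sum.inr).comp σ) fun j => aeval_X _ _) p

lemma aeval_apply_X {S : Type} [CommRing S] [Algebra k S]
    (σ : MvPolynomial (Fin 2) k →ₐ[k] S) (p : MvPolynomial (Fin 2) k) :
    aeval (fun j => σ (X j)) p = σ p :=
  DFunLike.congr_fun (MvPolynomial.algHom_ext (f := aeval fun j => σ (X j)) (g := σ)
    fun _ => aeval_X _ _) p

lemma aeval_planeSubst {S : Type} [CommRing S] [Algebra k S] (x : Fin m → S) (w : Fin 2 → S)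
    (σ : MvPolynomial (Fin 2) k →ₐ[k] MvPolynomial (Fin 2) k)
    (p : MvPolynomial (Fin m ⊕ Fin 2) k) :
    aeval (Sum.elim x w) (planeSubst σ p) = aeval (Sum.elim x fun j => aeval w (σ (X j))) p := by
  rw [planeSubst, comp_aeval_apply]
  congr 2
  funext i
  rcases i with i | i
  · simp
  · simp [aeval_rename]

/-- An automorphism of `k[Z,T]` induces an isomorphism between the corresponding rings `A`. -/
theorem nonempty_algEquiv_planeSubst
    (σ : MvPolynomial (Fin 2) k ≃ₐ[k] MvPolynomial (Fin 2) k) :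
    Nonempty (RingA k m r F ≃ₐ[k] RingA k m r (planeSubst σ.toAlgHom F)) := by
  have h1 : (∏ i, xA k m r (planeSubst σ.toAlgHom F) i ^ r i) * yA k m r (planeSubst σ.toAlgHom F) =
      aeval (Sum.elim (xA k m r (planeSubst σ.toAlgHom F)) fun j =>
        planeA k m r (planeSubst σ.toAlgHom F) (σ (X j))) F :=
    prod_xA_mul_yA.trans (aeval_planeSubst _ _ _ _)
  have haev : ∀ q, aeval (fun j => planeA k m r F (σ.symm (X j))) q = planeA k m r F (σ.symm q) :=
    aeval_apply_X ((planeA k m r F).comp σ.symm.toAlgHom)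
  have h2 : (∏ i, xA k m r F i ^ r i) * yA k m r F =
      aeval (Sum.elim (xA k m r F) fun j => planeA k m r F (σ.symm (X j)))
        (planeSubst σ.toAlgHom F) := by
    rw [aeval_planeSubst]
    refine prod_xA_mul_yA.trans ?_
    rw [polyA]
    congr 2
    funext i
    rcases i with i | i
    · rfl
    · refine Eq.trans ?_ (haev _).symm
      change _ = planeA k m r F (σ.symm (σ (X i)))
      rw [σ.symm_apply_apply, planeA, aeval_X]
      rfl
  refine ⟨AlgEquiv.ofAlgHom (liftA _ _ _ h1) (liftA _ _ _ h2) ?_ ?_⟩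
  · refine algHom_extA (fun i => ?_) ?_ fun j => ?_
    · simp
    · simp
    · rw [AlgHom.comp_apply, liftA_ztA, liftA_planeA]
      refine (aeval_apply_X ((planeA k m r (planeSubst σ.toAlgHom F)).comp σ.toAlgHom) _).trans ?_
      change planeA k m r _ (σ (σ.symm (X j))) = _
      rw [σ.apply_symm_apply, planeA, aeval_X]
      rfl
  · refine algHom_extA (fun i => ?_) ?_ fun j => ?_
    · simp
    · simp
    · rw [AlgHom.comp_apply, liftA_ztA, liftA_planeA, haev, σ.symm_apply_apply, planeA, aeval_X]
      rfl

end PlaneSubst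

section Specialize

variable {m r}

lemma mvPolynomial_map_polynomial_aeval {R S σ : Type} [CommRing R] [CommRing S] (φ : R →+* S)
    (i : σ) (p : Polynomial R) :
    map φ (Polynomial.aeval (X i) p) = Polynomial.aeval (X i) (p.map φ) := by
  rw [Polynomial.aeval_def, Polynomial.hom_eval₂, Polynomial.aeval_def, Polynomial.eval₂_map,
    map_X]
  congr 1
  ext c
  simp

lemma polynomial_exists_lift {S : Type} [CommRing S] {A : Subalgebra ℤ S} {p : Polynomial S}
    (h : (p.coeffs : Set S) ⊆ A) : ∃ q : Polynomial A, q.map (algebraMap A S) = p :=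
  (Polynomial.mem_lifts p).1 <| (Polynomial.lifts_iff_coeffs_subset_range p).2 fun c hc =>
    ⟨⟨c, h hc⟩, rfl⟩

lemma map_family {R S : Type} [CommRing R] [CommRing S] (φ : R →+* S) (a b : Polynomial R)
    (g : MvPolynomial (Fin m ⊕ Fin 2) R) :
    map φ (rename Sum.inr (Polynomial.aeval (X 0) a + Polynomial.aeval (X 0) b * X 1) +
      (∏ i : Fin m, X (Sum.inl i)) * g) =
    rename Sum.inr (Polynomial.aeval (X 0) (a.map φ) + Polynomial.aeval (X 0) (b.map φ) * X 1) +
      (∏ i, X (Sum.inl i)) * map φ g := by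
  rw [map_add, map_mul, map_prod, map_rename, map_add, map_mul, map_X,
    mvPolynomial_map_polynomial_aeval, mvPolynomial_map_polynomial_aeval]
  simp

/-- If `A` is stably a polynomial ring and `f = a(Z) + b(Z) T`, then `b` has no zeros, unless it
vanishes everywhere: after specialization to a finite field this follows by counting points. -/
theorem eval_eq_zero_of_hasPolynomialQuotient {L : Type} [Field L] (hm : 1 ≤ m)
    (hr : ∀ i, 1 < r i) {a b : Polynomial L} {g F : MvPolynomial (Fin m ⊕ Fin 2) L}
    (hF : F = rename Sum.inr (Polynomial.aeval (X 0) a + Polynomial.aeval (X 0) b * X 1) +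
      (∏ i, X (Sum.inl i)) * g) {l : ℕ}
    (hG : HasPolynomialQuotient (Fin (l + m + 2))
      (rename Sum.inr (relG L m r F) : MvPolynomial (Fin l ⊕ (Fin m ⊕ Fin 3)) L))
    {θ : L} (hθ : b.eval θ = 0) (u : L) : b.eval u = 0 := by
  classical
  by_contra hu
  obtain ⟨T, hT⟩ := hG.exists_finset
  obtain ⟨Tg, hTg⟩ := exists_finset_forall_lift g
  let S : Finset L := T ∪ Tg ∪ a.coeffs ∪ b.coeffs ∪ {θ, u, (b.eval u)⁻¹}
  let A : Subalgebra ℤ L := Algebra.adjoin ℤ (S : Set L)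
  have hA : ∀ x ∈ S, x ∈ A := fun x hx => Algebra.subset_adjoin hx
  have hfin : Algebra.FiniteType ℤ A := A.fg_iff_finiteType.1 (Subalgebra.fg_adjoin_finset S)
  obtain ⟨a', ha'⟩ := polynomial_exists_lift (A := A) (p := a) fun x hx =>
    hA x (by simp only [S, Finset.mem_union]; exact .inl (.inl (.inr hx)))
  obtain ⟨b', hb'⟩ := polynomial_exists_lift (A := A) (p := b) fun x hx =>
    hA x (by simp only [S, Finset.mem_union]; exact .inl (.inr hx))
  obtain ⟨g', hg'⟩ := hTg A fun x hx =>
    hA x (by simp only [S, Finset.mem_union]; exact .inl (.inl (.inl (.inr hx))))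
  have hθA : θ ∈ A := hA θ (by simp [S])
  have huA : u ∈ A := hA u (by simp [S])
  have hvA : (b.eval u)⁻¹ ∈ A := hA _ (by simp [S])
  have hev : ∀ x : A, ((b'.eval x : A) : L) = b.eval (x : L) := fun x => by
    rw [← hb']
    exact (Polynomial.eval_map_apply (f := algebraMap A L) x).symm
  have hF' := map_family (algebraMap A L) a' b' g'
  rw [ha', hb', hg', ← hF] at hF'
  have hG' := hT A (fun x hx =>
    hA x (by simp only [S, Finset.mem_union]; exact .inl (.inl (.inl (.inl hx)))))
    (rename Sum.inr (relG A m r _)) (by rw [map_rename, map_relG, hF'])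
  obtain ⟨K, _, _, ⟨φ⟩⟩ := exists_ringHom_finite_field A
  have h0 := eval_eq_zero_of_card_zeros rfl
    (card_zeros_plane hm hr (map_family φ a' b' g') (hG'.map_relG φ)) (θ := φ ⟨θ, hθA⟩)
    (by rw [Polynomial.eval_map_apply, Subtype.ext (a1 := b'.eval ⟨θ, hθA⟩) (a2 := 0)
      ((hev _).trans hθ), map_zero]) (φ ⟨u, huA⟩)
  rw [Polynomial.eval_map_apply] at h0
  have h1 : b'.eval ⟨u, huA⟩ * ⟨_, hvA⟩ = 1 := Subtype.ext (by
    change ((b'.eval ⟨u, huA⟩ : A) : L) * (b.eval u)⁻¹ = 1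
    rw [hev]
    exact mul_inv_cancel₀ hu)
  refine one_ne_zero (α := K) ?_
  rw [← map_one φ, ← h1, map_mul, h0, zero_mul]

end Specialize

section Prime

variable {m r}

lemma exists_prod_pow_mul_eq_polyA (F : MvPolynomial (Fin m ⊕ Fin 2) k) (a : RingA k m r F) :
    ∃ (e : Fin m → ℕ) (P : MvPolynomial (Fin m ⊕ Fin 2) k),
      (∏ i, xA k m r F i ^ e i) * a = polyA k m r F P := by
  let S : Subalgebra k (RingA k m r F) :=
    { carrier := {a | ∃ (e : Fin m → ℕ) (P : MvPolynomial (Fin m ⊕ Fin 2) k),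
        (∏ i, xA k m r F i ^ e i) * a = polyA k m r F P}
      mul_mem' := by
        rintro a b ⟨e, P, h⟩ ⟨e', P', h'⟩
        refine ⟨e + e', P * P', ?_⟩
        simp only [Pi.add_apply, pow_add, Finset.prod_mul_distrib]
        rw [map_mul, ← h, ← h']
        ring
      add_mem' := by
        rintro a b ⟨e, P, h⟩ ⟨e', P', h'⟩
        refine ⟨e + e', (∏ i, X (Sum.inl i) ^ e' i) * P + (∏ i, X (Sum.inl i) ^ e i) * P', ?_⟩
        have hX : ∀ i, polyA k m r F (X (Sum.inl i)) = xA k m r F i := fun i => aeval_X _ _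
        simp only [Pi.add_apply, pow_add, Finset.prod_mul_distrib]
        simp only [map_add, map_mul, map_prod, map_pow, hX, ← h, ← h']
        ring
      algebraMap_mem' := fun c => ⟨0, C c, by
        simp only [Pi.zero_apply, pow_zero, Finset.prod_const_one, one_mul]
        exact (aeval_C _ _).symm⟩ }
  refine mem_of_generators S (fun i => ⟨0, X (Sum.inl i), ?_⟩) ⟨r, F, prod_xA_mul_yA⟩
    (fun j => ⟨0, X (Sum.inr j), ?_⟩) a
  · simp [polyA]
  · simp [polyA]

end Prime

section PrimeField

variable {K : Type} [Field K] {m : ℕ} {r : Fin m → ℕ} {F : MvPolynomial (Fin m ⊕ Fin 2) K}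

/-- A specialization of `A` sending one of the `xᵢ` to `0` and the others to `1`. -/
lemma exists_specialization_one {f : MvPolynomial (Fin 2) K}
    {g : MvPolynomial (Fin m ⊕ Fin 2) K}
    (hFg : F = rename Sum.inr f + (∏ i, X (Sum.inl i)) * g) (j : Fin m) :
    ∃ χ : RingA K m r F →ₐ[K] MvPolynomial (Fin 2) K ⧸ Ideal.span {f},
      χ (xA K m r F j) = 0 ∧ ∀ i, i ≠ j → χ (xA K m r F i) = 1 := by
  classical
  let S := MvPolynomial (Fin 2) K ⧸ Ideal.span {f}
  let x : Fin m → S := fun i => if i = j then 0 else 1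
  have hx : ∏ i, x i = 0 := Finset.prod_eq_zero (Finset.mem_univ j) (if_pos rfl)
  have hf0 : aeval (fun l => Ideal.Quotient.mkₐ K (Ideal.span {f}) (X l)) f = 0 :=
    (aeval_apply_X (Ideal.Quotient.mkₐ K (Ideal.span {f})) f).trans
      (Ideal.Quotient.eq_zero_iff_mem.2 (Ideal.mem_span_singleton_self f))
  have h : (∏ i, x i ^ r i) * (0 : S) =
      aeval (Sum.elim x fun l => Ideal.Quotient.mkₐ K (Ideal.span {f}) (X l)) F := by
    rw [hFg, map_add, aeval_rename, Sum.elim_comp_inr, hf0, map_mul, map_prod]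
    simp only [aeval_X, Sum.elim_inl]
    rw [hx, mul_zero, zero_mul, add_zero]
  refine ⟨liftA x 0 _ h, ?_, fun i hi => ?_⟩
  · rw [liftA_xA]
    exact if_pos rfl
  · rw [liftA_xA]
    exact if_neg hi

lemma xA_ne_zero (i : Fin m) : xA K m r F i ≠ 0 := fun h => by
  refine X_ne_zero (R := K) (Sum.inl i : Fin m ⊕ Fin 2) (polyA_injective K m r F ?_)
  rw [map_zero, polyA, aeval_X]
  exact h

/-- Monomials in the `xᵢ` divide each other in `A` only if they do in the polynomial ring. -/
lemma le_of_prod_xA_pow_mul_eq [IsDomain (RingA K m r F)]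
    {f : MvPolynomial (Fin 2) K} {g : MvPolynomial (Fin m ⊕ Fin 2) K}
    (hFg : F = rename Sum.inr f + (∏ i, X (Sum.inl i)) * g) (hu : ¬ IsUnit f)
    {c : K} (hc : c ≠ 0) {d e : Fin m → ℕ} {p : RingA K m r F}
    (h : (∏ i, xA K m r F i ^ e i) * p =
      algebraMap K (RingA K m r F) c * ∏ i, xA K m r F i ^ d i) (j : Fin m) : e j ≤ d j := by
  classical
  by_contra! hlt
  obtain ⟨χ, hχ0, hχ1⟩ := exists_specialization_one (r := r) hFg j
  have : Nontrivial (MvPolynomial (Fin 2) K ⧸ Ideal.span {f}) :=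
    Ideal.Quotient.nontrivial_iff.2 fun h => hu (Ideal.span_singleton_eq_top.1 h)
  have h2 : xA K m r F j ^ (e j - d j) *
      ((∏ i ∈ Finset.univ.erase j, xA K m r F i ^ e i) * p) =
      algebraMap K (RingA K m r F) c * ∏ i ∈ Finset.univ.erase j, xA K m r F i ^ d i := by
    refine mul_left_cancel₀ (pow_ne_zero (d j) (xA_ne_zero j)) ?_
    rw [← Finset.mul_prod_erase _ _ (Finset.mem_univ j),
      ← Finset.mul_prod_erase _ _ (Finset.mem_univ j)] at h
    rw [← mul_assoc, ← pow_add, Nat.add_sub_cancel' hlt.le]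
    linear_combination h
  have h3 := congrArg χ h2
  rw [map_mul, map_pow, hχ0, zero_pow (Nat.sub_pos_of_lt hlt).ne', zero_mul, map_mul, map_prod,
    Finset.prod_congr rfl (fun i hi => by rw [map_pow, hχ1 i (Finset.ne_of_mem_erase hi), one_pow]),
    Finset.prod_const_one, mul_one, AlgHom.commutes] at h3
  exact hc ((map_eq_zero _).1 h3.symm)

lemma isUnit_of_prod_xA_pow_mul_eq [IsDomain (RingA K m r F)] {c : K} (hc : c ≠ 0)
    {e : Fin m → ℕ} {p : RingA K m r F} (h : (∏ i, xA K m r F i ^ e i) * p =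
      algebraMap K (RingA K m r F) c * ∏ i, xA K m r F i ^ e i) : IsUnit p := by
  rw [mul_comm (algebraMap _ _ c)] at h
  rw [mul_left_cancel₀ (Finset.prod_ne_zero_iff.2 fun i _ => pow_ne_zero _ (xA_ne_zero i)) h]
  exact (isUnit_iff_ne_zero.2 hc).map _

lemma not_isUnit_xA {f : MvPolynomial (Fin 2) K}
    {g : MvPolynomial (Fin m ⊕ Fin 2) K}
    (hFg : F = rename Sum.inr f + (∏ i, X (Sum.inl i)) * g) (hu : ¬ IsUnit f) (j : Fin m) :
    ¬ IsUnit (xA K m r F j) := fun h => by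
  obtain ⟨χ, hχ0, -⟩ := exists_specialization_one (r := r) hFg j
  have : Nontrivial (MvPolynomial (Fin 2) K ⧸ Ideal.span {f}) :=
    Ideal.Quotient.nontrivial_iff.2 fun h => hu (Ideal.span_singleton_eq_top.1 h)
  have := h.map χ
  rw [hχ0] at this
  exact not_isUnit_zero this

lemma polyA_monomial {n d : (Fin m ⊕ Fin 2) →₀ ℕ} (hn : ∀ j, n (Sum.inr j) = 0) (hd : d ≤ n)
    (c : K) : polyA K m r F (monomial d c) =
      algebraMap K (RingA K m r F) c * ∏ i, xA K m r F i ^ d (Sum.inl i) := by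
  rw [polyA, aeval_monomial, Finsupp.prod_fintype _ _ fun i => pow_zero _, Fintype.prod_sum_type]
  have : ∀ j, d (Sum.inr j) = 0 := fun j => Nat.le_zero.1 ((hd _).trans (hn j).le)
  simp [this]

theorem irreducible_xA [IsDomain (RingA K m r F)]
    {f : MvPolynomial (Fin 2) K} {g : MvPolynomial (Fin m ⊕ Fin 2) K}
    (hFg : F = rename Sum.inr f + (∏ i, X (Sum.inl i)) * g) (hu : ¬ IsUnit f) (j : Fin m) :
    Irreducible (xA K m r F j) := by
  classical
  refine ⟨not_isUnit_xA hFg hu j, fun {p q} hpq => ?_⟩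
  obtain ⟨e, P, hP⟩ := exists_prod_pow_mul_eq_polyA K F p
  obtain ⟨e', Q, hQ⟩ := exists_prod_pow_mul_eq_polyA K F q
  let n : (Fin m ⊕ Fin 2) →₀ ℕ :=
    Finsupp.equivFunOnFinite.symm (Sum.elim (e + e' + Pi.single j 1 : Fin m → ℕ) 0)
  have hn0 : ∀ l, n (Sum.inr l) = 0 := fun l => rfl
  have hPQ : P * Q = monomial n 1 := by
    refine polyA_injective K m r F ?_
    rw [map_mul, ← hP, ← hQ, polyA_monomial hn0 le_rfl, map_one, one_mul]
    have : ∀ i, n (Sum.inl i) = (e + e' + Pi.single j 1 : Fin m → ℕ) i := fun i => rfl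
    simp only [this]
    rw [prod_pow_add_single, hpq]
    simp only [Pi.add_apply, pow_add, Finset.prod_mul_distrib]
    ring
  obtain ⟨d, c, hd, hc, rfl⟩ := (dvd_monomial_iff_exists one_ne_zero).1 (Dvd.intro _ hPQ)
  obtain ⟨d', c', hd', hc', rfl⟩ :=
    (dvd_monomial_iff_exists one_ne_zero).1 (Dvd.intro_left _ hPQ)
  have hc0 : c ≠ 0 := ne_zero_of_dvd_ne_zero one_ne_zero hc
  have hc0' : c' ≠ 0 := ne_zero_of_dvd_ne_zero one_ne_zero hc'
  rw [polyA_monomial hn0 hd] at hP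
  rw [polyA_monomial hn0 hd'] at hQ
  rw [monomial_mul, monomial_eq_monomial_iff] at hPQ
  have hsum : ∀ i, d (Sum.inl i) + d' (Sum.inl i) =
      (e + e' + Pi.single j 1 : Fin m → ℕ) i := fun i => by
    rcases hPQ with h | h
    · exact DFunLike.congr_fun h.1 (Sum.inl i)
    · exact absurd h.2 one_ne_zero
  have hle := le_of_prod_xA_pow_mul_eq hFg hu hc0 hP
  have hle' := le_of_prod_xA_pow_mul_eq hFg hu hc0' hQ
  have hoff : ∀ i, i ≠ j → d (Sum.inl i) = e i ∧ d' (Sum.inl i) = e' i := fun i hi => by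
    have h1 := hsum i
    rw [Pi.add_apply, Pi.add_apply, Pi.single_eq_of_ne hi] at h1
    have := hle i
    have := hle' i
    omega
  have hj := hsum j
  rw [Pi.add_apply, Pi.add_apply, Pi.single_eq_same] at hj
  have hj1 := hle j
  have hj2 := hle' j
  rcases (by omega : d (Sum.inl j) = e j ∨ d' (Sum.inl j) = e' j) with h | h
  · refine Or.inl (isUnit_of_prod_xA_pow_mul_eq (e := e) hc0 (hP.trans ?_))
    congr 2
    funext i
    by_cases hi : i = j
    · rw [hi, h]
    · rw [(hoff i hi).1]
  · refine Or.inr (isUnit_of_prod_xA_pow_mul_eq (e := e') hc0' (hQ.trans ?_))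
    congr 2
    funext i
    by_cases hi : i = j
    · rw [hi, h]
    · rw [(hoff i hi).2]

end PrimeField

section StablyPolynomial

variable {K : Type} [Field K] {m : ℕ} {r : Fin m → ℕ} {F : MvPolynomial (Fin m ⊕ Fin 2) K}

lemma irreducible_mvPolynomial_C {R σ : Type} [CommRing R] [IsDomain R] {a : R}
    (ha : Irreducible a) : Irreducible (C a : MvPolynomial σ R) := by
  refine ⟨fun h => ha.not_isUnit ?_, fun {p q} hpq => ?_⟩
  · simpa using h.map constantCoeff
  · have h0 : p * q ≠ 0 := hpq ▸ fun h => ha.ne_zero (C_eq_zero.1 h)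
    have hdeg := totalDegree_mul_of_isDomain (left_ne_zero_of_mul h0) (right_ne_zero_of_mul h0)
    rw [← hpq, totalDegree_C] at hdeg
    have hp := totalDegree_eq_zero_iff_eq_C.1 (by omega : p.totalDegree = 0)
    have hq := totalDegree_eq_zero_iff_eq_C.1 (by omega : q.totalDegree = 0)
    rw [hp, hq, ← C_mul] at hpq
    rw [hp, hq]
    exact (ha.isUnit_or_isUnit (C_injective _ _ hpq)).imp (fun h => h.map C) fun h => h.map C

lemma fOf_eq_of_eq_add (hm : 1 ≤ m) {f : MvPolynomial (Fin 2) K}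
    {g : MvPolynomial (Fin m ⊕ Fin 2) K}
    (hFg : F = rename Sum.inr f + (∏ i, X (Sum.inl i)) * g) : fOf K m F = f := by
  rw [fOf, hFg, map_add, map_mul, map_prod, aeval_rename, Sum.elim_comp_inr,
    Finset.prod_eq_zero (Finset.mem_univ ⟨0, hm⟩) (aeval_X _ _), zero_mul, add_zero, aeval_X_left]
  rfl

lemma isDomain_of_algEquiv {l : ℕ} {τ : Type}
    (e : MvPolynomial (Fin l) (RingA K m r F) ≃ₐ[K] MvPolynomial τ K) :
    IsDomain (RingA K m r F) :=
  Function.Injective.isDomain (e.toRingHom.comp C)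
    (e.injective.comp (C_injective (Fin l) (RingA K m r F)))

lemma not_isUnit_of_stably (hm : 1 ≤ m) (hr : ∀ i, 1 < r i) {f : MvPolynomial (Fin 2) K}
    {g : MvPolynomial (Fin m ⊕ Fin 2) K}
    (hFg : F = rename Sum.inr f + (∏ i, X (Sum.inl i)) * g) {l : ℕ} {τ : Type}
    (e : MvPolynomial (Fin l) (RingA K m r F) ≃ₐ[K] MvPolynomial τ K) : ¬ IsUnit f := fun hu => by
  obtain ⟨a, ha⟩ := exists_planeA_eq_xA_mul (r := r) hr hFg ⟨0, hm⟩
  have hx : IsUnit (xA K m r F ⟨0, hm⟩) := isUnit_of_dvd_unit (Dvd.intro _ ha.symm) (hu.map _)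
  obtain ⟨c, -, hc⟩ := eq_C_of_isUnit
    ((hx.map (C : _ →+* MvPolynomial (Fin l) (RingA K m r F))).map e)
  have h1 : (C (xA K m r F ⟨0, hm⟩) : MvPolynomial (Fin l) (RingA K m r F)) =
      C (algebraMap K (RingA K m r F) c) := e.injective (hc.trans (e.commutes c).symm)
  have h2 : (X (Sum.inl ⟨0, hm⟩) : MvPolynomial (Fin m ⊕ Fin 2) K) = C c := by
    refine polyA_injective K m r F ?_
    rw [polyA, aeval_X, aeval_C]
    exact C_injective _ _ h1
  have h3 := congrArg totalDegree h2
  rw [totalDegree_X, totalDegree_C] at h3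
  exact one_ne_zero h3

/-- If `A` is stably a polynomial ring then the plane curve `f = 0` is integral. -/
theorem prime_of_stably (hm : 1 ≤ m) (hr : ∀ i, 1 < r i) {f : MvPolynomial (Fin 2) K}
    (hf : f ≠ 0) {g : MvPolynomial (Fin m ⊕ Fin 2) K}
    (hFg : F = rename Sum.inr f + (∏ i, X (Sum.inl i)) * g) {l : ℕ} {τ : Type}
    (e : MvPolynomial (Fin l) (RingA K m r F) ≃ₐ[K] MvPolynomial τ K) : Prime f := by
  have := isDomain_of_algEquiv e
  have hu := not_isUnit_of_stably hm hr hFg e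
  have hirr : Irreducible (e (C (xA K m r F ⟨0, hm⟩))) :=
    (MulEquiv.irreducible_iff e).2 (irreducible_mvPolynomial_C (irreducible_xA hFg hu _))
  have hx : Prime (xA K m r F ⟨0, hm⟩) :=
    (prime_C_iff (Fin l)).1 ((MulEquiv.prime_iff e).1 hirr.prime)
  obtain ⟨π, hπ, hπw⟩ := exists_specialization (k := K) (m := m) (r := r) (F := F)
  obtain ⟨a, ha⟩ := exists_planeA_eq_xA_mul (r := r) hr hFg ⟨0, hm⟩
  have hdvd : ∀ u, xA K m r F ⟨0, hm⟩ ∣ planeA K m r F u → f ∣ u := by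
    rintro u ⟨b, hb⟩
    have h1 := congrArg π hb
    rw [map_mul, hπ, zero_mul, hπw, Ideal.Quotient.eq_zero_iff_mem, Ideal.mem_span_singleton,
      fOf_eq_of_eq_add hm hFg] at h1
    exact h1
  refine ⟨hf, hu, fun u v huv => ?_⟩
  obtain ⟨w, hw⟩ := huv
  refine (hx.dvd_or_dvd (a := planeA K m r F u) (b := planeA K m r F v) ?_).imp (hdvd u) (hdvd v)
  rw [← map_mul, hw, map_mul, ha, mul_assoc]
  exact Dvd.intro _ rfl

lemma irreducible_of_prime_aeval_X {σ : Type} {i : σ} {p : Polynomial K}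
    (hp : Prime (Polynomial.aeval (X i : MvPolynomial σ K) p)) : Irreducible p := by
  have hback : ∀ q : Polynomial K,
      aeval (fun _ => Polynomial.X) (Polynomial.aeval (X i : MvPolynomial σ K) q) = q := fun q => by
    rw [← Polynomial.aeval_algHom_apply, aeval_X, Polynomial.aeval_X_left_apply]
  refine ⟨fun h => hp.not_isUnit (h.map _), fun {a b} hab => ?_⟩
  have h := hp.irreducible.isUnit_or_isUnit ((congrArg _ hab).trans (map_mul _ a b))
  exact h.imp (fun h => hback a ▸ h.map _) fun h => hback b ▸ h.map _

/-- If `A` is stably a polynomial ring and its Derksen invariant is not contained in `B`, then `f`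
is a coordinate. -/
theorem isCoordinate_of_stably [IsDomain (RingA K m r F)] (hm : 1 ≤ m) (hr : ∀ i, 1 < r i)
    (hf : fOf K m F ≠ 0) {g : MvPolynomial (Fin m ⊕ Fin 2) K}
    (hFg : F = rename Sum.inr (fOf K m F) + (∏ i, X (Sum.inl i)) * g)
    (hD : ¬ Derksen K (RingA K m r F) ≤ BA K m r F) {l : ℕ}
    (e : MvPolynomial (Fin l) (RingA K m r F) ≃ₐ[K] MvPolynomial (Fin (l + m + 2)) K) :
    IsCoordinate (fOf K m F) := by
  obtain ⟨h, s, htop, p, q, hpq⟩ := exists_coordinates_of_derksen hm hr hf hFg hD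
  obtain ⟨σ, hσ0, hσ1⟩ := exists_coordinateEquiv htop
  have hσf : σ.symm (fOf K m F) = Polynomial.aeval (X 0) p + Polynomial.aeval (X 0) q * X 1 := by
    have hX : ∀ a : Polynomial K, σ (Polynomial.aeval (X 0) a) = Polynomial.aeval h a := fun a => by
      rw [← hσ0]
      exact (Polynomial.aeval_algHom_apply σ.toAlgHom _ _).symm
    rw [AlgEquiv.symm_apply_eq, map_add, map_mul, hσ1, hX, hX, hpq]
  have hF' : planeSubst σ.symm.toAlgHom F =
      rename Sum.inr (Polynomial.aeval (X 0) p + Polynomial.aeval (X 0) q * X 1) +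
        (∏ i, X (Sum.inl i)) * planeSubst σ.symm.toAlgHom g := by
    refine (congrArg _ hFg).trans ?_
    rw [map_add, planeSubst_rename, map_mul, map_prod]
    simp only [planeSubst_X_inl]
    rw [← hσf]
    rfl
  obtain ⟨ε⟩ := nonempty_algEquiv_planeSubst (r := r) (F := F) σ.symm
  let L := AlgebraicClosure K
  let φ := algebraMap K L
  have hG := (hasPolynomialQuotient_of_algEquiv K m r _
    ((mapAlgEquiv (Fin l) ε.symm).trans e)).map_relG φ
  have hFL := (congrArg (map φ) hF').trans (map_family φ p q _)
  by_cases hq : q = 0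
  · subst hq
    rw [Polynomial.map_zero, map_zero, zero_mul, add_zero] at hFL
    rw [map_zero, zero_mul, add_zero] at hpq
    obtain ⟨eL⟩ := hG.nonempty_algEquiv (D := MvPolynomial (Fin l) (RingA L m r _))
      (stableMk L m r _ l) (stableMk_surjective L m r _ l) (stableMk_eq_zero_iff L m r _ l)
    have hp : p ≠ 0 := by
      rintro rfl
      exact hf (by rw [hpq, map_zero])
    have hp0 : Polynomial.aeval (X 0 : MvPolynomial (Fin 2) L) (p.map φ) ≠ 0 := by
      rw [← mvPolynomial_map_polynomial_aeval]
      intro h0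
      have h1 := map_injective φ φ.injective (h0.trans (map_zero _).symm)
      refine hf (σ.symm.injective ?_)
      rw [hσf, h1, map_zero, map_zero, zero_mul, add_zero]
    have hdeg := IsAlgClosed.degree_eq_one_of_irreducible L
      (irreducible_of_prime_aeval_X (prime_of_stably hm hr hp0 hFL eL))
    rw [Polynomial.degree_map] at hdeg
    have ha : p.coeff 1 ≠ 0 := Polynomial.coeff_ne_zero_of_eq_degree hdeg
    rw [Polynomial.eq_X_add_C_of_degree_le_one hdeg.le] at hpq
    refine isCoordinate_of_smul_add htop (a := (p.coeff 1)⁻¹)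
      (b := -((p.coeff 1)⁻¹ * p.coeff 0)) ?_
    rw [hpq]
    simp only [map_add, map_mul, Polynomial.aeval_C, Polynomial.aeval_X, algebraMap_eq, map_neg]
    have : (C (p.coeff 1)⁻¹ : MvPolynomial (Fin 2) K) * C (p.coeff 1) = 1 := by
      rw [← C_mul, inv_mul_cancel₀ ha, C_1]
    linear_combination (-h) * this
  · by_cases hdeg : q.degree = 0
    · rw [Polynomial.eq_C_of_degree_eq_zero hdeg] at hpq
      rw [hpq]
      exact isCoordinate_of_const htop p (Polynomial.coeff_ne_zero_of_eq_degree hdeg)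
    · obtain ⟨θ, hθ⟩ := IsAlgClosed.exists_root (q.map φ) (by rwa [Polynomial.degree_map])
      refine absurd (Polynomial.funext (q := 0) fun u => ?_) ((Polynomial.map_ne_zero_iff φ.injective).2 hq)
      rw [Polynomial.eval_zero]
      exact eval_eq_zero_of_hasPolynomialQuotient hm hr hFL hG hθ u

end StablyPolynomial

/-!
STATEMENT 8.  Suppose `F = f(Z,T) + X_1⋯X_m·g(X_1,…,X_m,Z,T)`.  Then the following are
equivalent:
(iv) `A ≅ k^{[m+2]}`;
(vi) `A^{[l]} ≅ k^{[l+m+2]}` for some `l ≥ 0`, and `B ⊊ DK(A)`;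
(vii) `A` is an `𝔸²`-fibration over `E`, and `B ⊊ DK(A)`;
(viii) `f(Z,T)` is a line in `k[Z,T]`, and `B ⊊ DK(A)`.
-/

theorem statement8 (k : Type) [Field k] (m : ℕ) (hm : 1 ≤ m)
    (r : Fin m → ℕ) (hr : ∀ i, 1 < r i)
    (F : MvPolynomial (Fin m ⊕ Fin 2) k) (hf : fOf k m F ≠ 0)
    [IsDomain (RingA k m r F)]
    (g : MvPolynomial (Fin m ⊕ Fin 2) k)
    (hFg : F = rename Sum.inr (fOf k m F) + (∏ i, X (Sum.inl i)) * g) :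
    List.TFAE
      [ Nonempty (RingA k m r F ≃ₐ[k] MvPolynomial (Fin (m + 2)) k),
        (∃ l : ℕ, Nonempty (MvPolynomial (Fin l) (RingA k m r F)
            ≃ₐ[k] MvPolynomial (Fin (l + m + 2)) k))
          ∧ BA k m r F < Derksen k (RingA k m r F),
        IsAnFibration ↥(EA k m r F) (RingA k m r F) 2
          ∧ BA k m r F < Derksen k (RingA k m r F),
        Nonempty ((MvPolynomial (Fin 2) k ⧸ Ideal.span {fOf k m F}) ≃ₐ[k] Polynomial k)
          ∧ BA k m r F < Derksen k (RingA k m r F) ] := by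
  have hnot : BA k m r F < Derksen k (RingA k m r F) →
      ¬ Derksen k (RingA k m r F) ≤ BA k m r F := fun h => h.not_ge
  have htriv : IsCoordinate (fOf k m F) →
      BA k m r F < Derksen k (RingA k m r F) ∧
        Nonempty (RingA k m r F ≃ₐ[k] MvPolynomial (Fin (m + 2)) k) ∧
        IsAnFibration ↥(EA k m r F) (RingA k m r F) 2 := fun h => by
    obtain ⟨Θ, hΘ⟩ := exists_trivialization (r := r) h hFg
    have e : MvPolynomial (Fin (m + 2)) k ≃ₐ[k] RingA k m r F :=
      (renameEquiv k finSumFinEquiv).symm.trans Θ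
    exact ⟨BA_lt_derksen hm hr hf e, ⟨e.symm⟩, isAnFibration_of_trivialization Θ hΘ⟩
  have hstable : ((∃ l : ℕ, Nonempty (MvPolynomial (Fin l) (RingA k m r F)
      ≃ₐ[k] MvPolynomial (Fin (l + m + 2)) k)) ∧ BA k m r F < Derksen k (RingA k m r F)) →
      IsCoordinate (fOf k m F) := by
    rintro ⟨⟨l, ⟨e⟩⟩, hD⟩
    exact isCoordinate_of_stably hm hr hf hFg (hnot hD) e
  tfae_have 1 → 2 := by
    rintro ⟨e⟩
    refine ⟨⟨0, ⟨?_⟩⟩, BA_lt_derksen hm hr hf e.symm⟩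
    exact ((isEmptyAlgEquiv (RingA k m r F) (Fin 0)).restrictScalars k).trans
      (e.trans (renameEquiv k (finCongr (by omega))))
  tfae_have 2 → 3 := fun h => ⟨(htriv (hstable h)).2.2, h.2⟩
  tfae_have 3 → 4 := by
    rintro ⟨hA, hD⟩
    obtain ⟨h, s, htop, p, q, hpq⟩ := exists_coordinates_of_derksen hm hr hf hFg (hnot hD)
    obtain ⟨κ, _, _, hκ, φ, hφ⟩ := exists_embedding_of_isAnFibration hm hr hFg hA
    exact ⟨(IsCoordinate.of_coordinates_of_embedding htop hf p q hpq hκ φ hφ).line, hD⟩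
  tfae_have 4 → 1 := by
    rintro ⟨⟨e⟩, hD⟩
    obtain ⟨h, s, htop, p, q, hpq⟩ := exists_coordinates_of_derksen hm hr hf hFg (hnot hD)
    exact (htriv (.of_line htop hf p q hpq e)).2.1
  tfae_finish
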